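/- Let 1 ≤ d ≤ 3 and let Ψ₁,…,Ψ_N : ℝ^d → ℝ^d be homogeneous and uniformly Lipschitz continuous. If the switched system on ℝ^d defined by Ψ₁,…,Ψ_N is Lyapunov stable and periodically asymptotically stable, then it is globally uniformly exponentially stable. -/

import Mathlib

open scoped NNReal
open Filter Topology MeasureTheory

/-- A switching law: measurable functions `u₁,…,u_N : [0,∞) → [0,1]` with `Σᵢ uᵢ(s) = 1`
for a.e. `s ≥ 0` (the `uᵢ` are extended measurably to all of `ℝ`). -/
def IsSwitchingLaw {N : ℕ} (u : Fin N → ℝ → ℝ) : Prop :=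
  (∀ i, Measurable (u i)) ∧
  (∀ᵐ s ∂(volume.restrict (Set.Ici (0 : ℝ))),
    (∀ i, u i s ∈ Set.Icc (0 : ℝ) 1) ∧ ∑ i, u i s = 1)

/-- `x : [0,∞) → ℝ^d` is the trajectory of the switched system defined by `Ψ₁,…,Ψ_N`
generated by the switching law `u`. -/
def IsTrajectoryWith {d N : ℕ} (Ψ : Fin N → EuclideanSpace ℝ (Fin d) → EuclideanSpace ℝ (Fin d))
    (u : Fin N → ℝ → ℝ) (x : ℝ≥0 → EuclideanSpace ℝ (Fin d)) : Prop :=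
  Continuous x ∧ IsSwitchingLaw u ∧
  ∀ t : ℝ≥0, x t = x 0 + ∫ s in Set.Ioc (0 : ℝ) (t : ℝ), ∑ i, u i s • Ψ i (x (Real.toNNReal s))

/-- `x` is a trajectory of the switched system defined by `Ψ₁,…,Ψ_N`. -/
def IsTrajectory {d N : ℕ} (Ψ : Fin N → EuclideanSpace ℝ (Fin d) → EuclideanSpace ℝ (Fin d))
    (x : ℝ≥0 → EuclideanSpace ℝ (Fin d)) : Prop :=
  ∃ u, IsTrajectoryWith Ψ u x

/-- The switching law `u` is constant (almost everywhere on `[0,∞)`). -/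
def IsConstantLaw {N : ℕ} (u : Fin N → ℝ → ℝ) : Prop :=
  ∃ c : Fin N → ℝ, ∀ i, ∀ᵐ s ∂(volume.restrict (Set.Ici (0 : ℝ))), u i s = c i

/-- The switching law `u` is periodic: for some `p > 0`, `uᵢ(t + p) = uᵢ(t)` a.e. -/
def IsPeriodicLaw {N : ℕ} (u : Fin N → ℝ → ℝ) : Prop :=
  ∃ p : ℝ, 0 < p ∧ ∀ i, ∀ᵐ s ∂(volume.restrict (Set.Ici (0 : ℝ))), u i (s + p) = u i s

/-- `q` is `p` or one of its four neighbours in the square lattice. -/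
def LatticeStep (p q : ℤ × ℤ) : Prop :=
  q = p ∨ q = (p.1 + 1, p.2) ∨ q = (p.1 - 1, p.2) ∨ q = (p.1, p.2 + 1) ∨ q = (p.1, p.2 - 1)

/-- The signed number of traversals of the horizontal edge `(a, b) → (a + 1, b)`. -/
def hFlow (p q : ℤ × ℤ) (a b : ℤ) : ℤ :=
  (if p = (a, b) ∧ q = (a + 1, b) then 1 else 0) - (if q = (a, b) ∧ p = (a + 1, b) then 1 else 0)

/-- The signed number of traversals of the vertical edge `(a, b) → (a, b + 1)`. -/
def vFlow (p q : ℤ × ℤ) (a b : ℤ) : ℤ :=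
  (if p = (a, b) ∧ q = (a, b + 1) then 1 else 0) - (if q = (a, b) ∧ p = (a, b + 1) then 1 else 0)

/-- The contribution of a lattice step to the winding number around the unit face whose lower
left corner is `(a, b)`. -/
def faceFlow (p q : ℤ × ℤ) (a b : ℤ) : ℤ :=
  (if p.1 = a ∧ q.1 = a + 1 ∧ p.2 ≤ b then 1 else 0) -
    (if q.1 = a ∧ p.1 = a + 1 ∧ q.2 ≤ b then 1 else 0)

lemma faceFlow_sub_below {p q : ℤ × ℤ} (h : LatticeStep p q) (a b : ℤ) :
    faceFlow p q a b - faceFlow p q a (b - 1) = hFlow p q a b := by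
  obtain ⟨p1, p2⟩ := p
  rcases h with h | h | h | h | h <;> subst h <;> simp only [faceFlow, hFlow, Prod.mk.injEq] <;>
    split_ifs <;> omega

lemma faceFlow_sub_right {p q : ℤ × ℤ} (h : LatticeStep p q) (a b : ℤ) :
    faceFlow p q (a - 1) b - faceFlow p q a b - vFlow p q a b =
      (if q.1 = a ∧ q.2 ≤ b then 1 else 0) - (if p.1 = a ∧ p.2 ≤ b then 1 else 0) := by
  obtain ⟨p1, p2⟩ := p
  rcases h with h | h | h | h | h <;> subst h <;> simp only [faceFlow, vFlow, Prod.mk.injEq] <;>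
    split_ifs <;> omega

/-- The winding number of a lattice walk around a unit face. -/
def latticeWinding (g : ℕ → ℤ × ℤ) (n : ℕ) (a b : ℤ) : ℤ :=
  ∑ l ∈ Finset.range n, faceFlow (g l) (g (l + 1)) a b

section Winding

variable {g : ℕ → ℤ × ℤ} {n : ℕ}

lemma latticeWinding_sub_below (hstep : ∀ l < n, LatticeStep (g l) (g (l + 1))) (a b : ℤ) :
    latticeWinding g n a b - latticeWinding g n a (b - 1) =
      ∑ l ∈ Finset.range n, hFlow (g l) (g (l + 1)) a b := by
  rw [latticeWinding, latticeWinding, ← Finset.sum_sub_distrib]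
  exact Finset.sum_congr rfl fun l hl => faceFlow_sub_below (hstep l (Finset.mem_range.1 hl)) a b

lemma latticeWinding_sub_right (hstep : ∀ l < n, LatticeStep (g l) (g (l + 1)))
    (hclosed : g n = g 0) (a b : ℤ) :
    latticeWinding g n (a - 1) b - latticeWinding g n a b =
      ∑ l ∈ Finset.range n, vFlow (g l) (g (l + 1)) a b := by
  have h1 : ∑ l ∈ Finset.range n, (faceFlow (g l) (g (l + 1)) (a - 1) b -
      faceFlow (g l) (g (l + 1)) a b - vFlow (g l) (g (l + 1)) a b) = 0 := by
    rw [Finset.sum_congr rfl fun l hl =>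
      faceFlow_sub_right (hstep l (Finset.mem_range.1 hl)) a b,
      Finset.sum_range_sub (fun l => if (g l).1 = a ∧ (g l).2 ≤ b then (1 : ℤ) else 0), hclosed,
      sub_self]
  rw [Finset.sum_sub_distrib, Finset.sum_sub_distrib] at h1
  simp only [latticeWinding]
  linarith

lemma exists_forall_latticeWinding_eq_zero (g : ℕ → ℤ × ℤ) (n : ℕ) :
    ∃ m : ℤ, ∀ a b, b ≤ m → latticeWinding g n a b = 0 := by
  induction n with
  | zero => exact ⟨0, fun a b _ => by simp [latticeWinding]⟩
  | succ n ih =>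
    obtain ⟨m, hm⟩ := ih
    refine ⟨min m (min ((g n).2 - 1) ((g (n + 1)).2 - 1)), fun a b hb => ?_⟩
    have h1 := hm a b (by omega)
    rw [latticeWinding, Finset.sum_range_succ, ← latticeWinding, h1, faceFlow,
      if_neg (by omega), if_neg (by omega)]
    rfl

/-- The value of a face function `N` on the left of the lattice step `p → q`. -/
def leftFace (N : ℤ → ℤ → ℤ) (p q : ℤ × ℤ) : ℤ :=
  if q = (p.1 + 1, p.2) then N p.1 p.2 else if q = (p.1, p.2 + 1) then N (p.1 - 1) p.2
  else if q = (p.1 - 1, p.2) then N (p.1 - 1) (p.2 - 1) else N p.1 (p.2 - 1)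

/-- The value of a face function `N` on the right of the lattice step `p → q`. -/
def rightFace (N : ℤ → ℤ → ℤ) (p q : ℤ × ℤ) : ℤ :=
  if q = (p.1 + 1, p.2) then N p.1 (p.2 - 1) else if q = (p.1, p.2 + 1) then N p.1 p.2
  else if q = (p.1 - 1, p.2) then N (p.1 - 1) p.2 else N (p.1 - 1) (p.2 - 1)

lemma sum_eq_add_of_simple (hinj : ∀ i j, i < j → j ≤ n → g i = g j → i = 0 ∧ j = n)
    {l : ℕ} (hl0 : 0 < l) (hln : l < n) (f : ℤ × ℤ → ℤ × ℤ → ℤ)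
    (hf : ∀ p q, p ≠ g l → q ≠ g l → f p q = 0) :
    ∑ m ∈ Finset.range n, f (g m) (g (m + 1)) =
      f (g (l - 1)) (g l) + f (g l) (g (l + 1)) := by
  have h1 : ∑ m ∈ ({l - 1, l} : Finset ℕ), f (g m) (g (m + 1)) =
      ∑ m ∈ Finset.range n, f (g m) (g (m + 1)) := by
    refine Finset.sum_subset ?_ ?_
    · intro m hm
      simp only [Finset.mem_insert, Finset.mem_singleton] at hm
      exact Finset.mem_range.2 (by omega)
    · intro m hm hm'
      simp only [Finset.mem_insert, Finset.mem_singleton, not_or, Finset.mem_range] at hm hm'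
      refine hf _ _ (fun h => ?_) (fun h => ?_)
      · rcases lt_or_gt_of_ne hm'.2 with h' | h'
        · have := hinj m l h' hln.le h; omega
        · have := hinj l m h' hm.le h.symm; omega
      · rcases lt_trichotomy (m + 1) l with h' | h' | h'
        · have := hinj (m + 1) l h' hln.le h; omega
        · omega
        · have := hinj l (m + 1) h' hm h.symm; omega
  rw [← h1, Finset.sum_pair (by omega), Nat.sub_add_cancel hl0]

lemma leftFace_vertex (hn : 3 ≤ n) (hstep : ∀ l < n, LatticeStep (g l) (g (l + 1)))
    (hclosed : g n = g 0) (hinj : ∀ i j, i < j → j ≤ n → g i = g j → i = 0 ∧ j = n)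
    {l : ℕ} (hl0 : 0 < l) (hln : l < n) :
    leftFace (latticeWinding g n) (g (l - 1)) (g l) =
      leftFace (latticeWinding g n) (g l) (g (l + 1)) ∧
    leftFace (latticeWinding g n) (g (l - 1)) (g l) =
      rightFace (latticeWinding g n) (g (l - 1)) (g l) + 1 ∧
    leftFace (latticeWinding g n) (g l) (g (l + 1)) =
      rightFace (latticeWinding g n) (g l) (g (l + 1)) + 1 := by
  set N := latticeWinding g n with hN
  have e1 := latticeWinding_sub_below hstep (g l).1 (g l).2
  have e2 := latticeWinding_sub_below hstep ((g l).1 - 1) (g l).2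
  have e3 := latticeWinding_sub_right hstep hclosed (g l).1 (g l).2
  have e4 := latticeWinding_sub_right hstep hclosed (g l).1 ((g l).2 - 1)
  rw [sum_eq_add_of_simple hinj hl0 hln (fun p q => hFlow p q _ _)] at e1
  rw [sum_eq_add_of_simple hinj hl0 hln (fun p q => hFlow p q _ _)] at e2
  rw [sum_eq_add_of_simple hinj hl0 hln (fun p q => vFlow p q _ _)] at e3
  rw [sum_eq_add_of_simple hinj hl0 hln (fun p q => vFlow p q _ _)] at e4
  · rw [← hN] at e1 e2 e3 e4
    have s1 := hstep (l - 1) (by omega)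
    have s2 := hstep l hln
    rw [Nat.sub_add_cancel hl0] at s1
    have n1 : g (l - 1) ≠ g l := fun h => by have := hinj _ _ (by omega) hln.le h; omega
    have n2 : g l ≠ g (l + 1) := fun h => by have := hinj _ _ (by omega) hln h; omega
    have n3 : g (l - 1) ≠ g (l + 1) := fun h => by have := hinj _ _ (by omega) hln h; omega
    generalize g (l + 1) = r at *
    generalize g (l - 1) = p at *
    generalize g l = q at *
    obtain ⟨p1, p2⟩ := p
    rcases s1 with h | h | h | h | h
    · exact absurd h.symm n1
    all_goals
      rcases s2 with h' | h' | h' | h' | h'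
      · exact absurd h'.symm n2
      all_goals
        subst h; subst h'
        simp only [hFlow, vFlow, leftFace, rightFace, Prod.mk.injEq, ne_eq, add_sub_cancel_right,
          sub_add_cancel, add_eq_left, sub_eq_self, one_ne_zero, and_true, and_false, true_and,
          false_and, if_true, if_false, not_true, not_false_eq_true, left_eq_add] at *
        try omega
  all_goals
    intro p q h1 h2
    simp only [hFlow, vFlow, ne_eq, Prod.ext_iff] at *
    split_ifs <;> omega

end Winding

section Winding

variable {g : ℕ → ℤ × ℤ} {n : ℕ}

lemma leftFace_const (hn : 3 ≤ n) (hstep : ∀ l < n, LatticeStep (g l) (g (l + 1)))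
    (hclosed : g n = g 0) (hinj : ∀ i j, i < j → j ≤ n → g i = g j → i = 0 ∧ j = n)
    {l : ℕ} (hln : l < n) :
    leftFace (latticeWinding g n) (g l) (g (l + 1)) = leftFace (latticeWinding g n) (g 0) (g 1) ∧
    rightFace (latticeWinding g n) (g l) (g (l + 1)) =
      leftFace (latticeWinding g n) (g 0) (g 1) - 1 := by
  have h1 : leftFace (latticeWinding g n) (g l) (g (l + 1)) =
      leftFace (latticeWinding g n) (g 0) (g 1) := by
    induction l with
    | zero => rfl
    | succ l ih =>
      have := leftFace_vertex hn hstep hclosed hinj (l := l + 1) (by omega) hln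
      rw [← this.1]
      exact ih (by omega)
  refine ⟨h1, ?_⟩
  rcases Nat.eq_zero_or_pos l with h0 | h0
  · subst h0
    have := (leftFace_vertex hn hstep hclosed hinj (l := 1) (by omega) (by omega)).2.1
    simp only [Nat.sub_self] at this
    simp only [zero_add]
    omega
  · have := (leftFace_vertex hn hstep hclosed hinj h0 hln).2.2
    omega

/-- The winding numbers of a simple closed lattice walk are at most one in absolute value. -/
lemma abs_latticeWinding_le_one (hn : 3 ≤ n) (hstep : ∀ l < n, LatticeStep (g l) (g (l + 1)))
    (hclosed : g n = g 0) (hinj : ∀ i j, i < j → j ≤ n → g i = g j → i = 0 ∧ j = n) (a b : ℤ) :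
    |latticeWinding g n a b| ≤ 1 := by
  set N := latticeWinding g n with hN
  set c := leftFace N (g 0) (g 1) with hc
  obtain ⟨m, hm⟩ := exists_forall_latticeWinding_eq_zero g n
  suffices h : N a b = 0 ∨ ((c = 0 ∨ c = 1) ∧ (N a b = c - 1 ∨ N a b = c)) by
    rw [abs_le]; omega
  rcases le_total b m with hb | hb
  · exact Or.inl (hm a b hb)
  induction b, hb using Int.leInduction with
  | base => exact Or.inl (hm a m le_rfl)
  | succ b hb ih =>
    have h1 := latticeWinding_sub_below hstep a (b + 1)
    rw [← hN, add_sub_cancel_right] at h1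
    by_cases h0 : ∑ l ∈ Finset.range n, hFlow (g l) (g (l + 1)) a (b + 1) = 0
    · rw [h0] at h1
      rw [show N a (b + 1) = N a b by omega]
      exact ih
    · obtain ⟨l, hl, hl'⟩ := Finset.exists_ne_zero_of_sum_ne_zero h0
      have hln := Finset.mem_range.1 hl
      have h2 := leftFace_const hn hstep hclosed hinj hln
      rw [← hN, ← hc] at h2
      have h3 : (N a (b + 1) = c ∧ N a b = c - 1) ∨ (N a (b + 1) = c - 1 ∧ N a b = c) := by
        by_cases e1 : g l = (a, b + 1) ∧ g (l + 1) = (a + 1, b + 1)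
        · left
          simpa [leftFace, rightFace, e1.1, e1.2] using h2
        · by_cases e2 : g (l + 1) = (a, b + 1) ∧ g l = (a + 1, b + 1)
          · right
            have e3 : ¬ (a = a + 1 + 1) := by omega
            simpa [leftFace, rightFace, e2.1, e2.2, e3, and_comm] using h2
          · simp [hFlow, e1, e2] at hl'
      omega

end Winding

/-- The weight of the lattice step `p → q`, for weights `h`, `v` of the horizontal and vertical
edges. -/
def stepWeight (h v : ℤ → ℤ → ℝ) (p q : ℤ × ℤ) : ℝ :=
  if q = (p.1 + 1, p.2) then h p.1 p.2 else if q = (p.1 - 1, p.2) then - h q.1 q.2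
  else if q = (p.1, p.2 + 1) then v p.1 p.2 else if q = (p.1, p.2 - 1) then - v q.1 q.2 else 0

lemma stepWeight_self (h v : ℤ → ℤ → ℝ) (p : ℤ × ℤ) : stepWeight h v p p = 0 := by
  simp [stepWeight, Prod.ext_iff, eq_sub_iff_add_eq]

/-- The circulation of the edge weights `h`, `v` around a unit face. -/
def faceCurl (h v : ℤ → ℤ → ℝ) (a b : ℤ) : ℝ := h a b + v (a + 1) b - h a (b + 1) - v a b

/-- The sum of `f` over the integers from `p` to `M`. -/
noncomputable def tailSum (M : ℤ) (f : ℤ → ℝ) (p : ℤ) : ℝ :=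
  ∑ b ∈ Finset.Icc (-M) M, if p ≤ b then f b else 0

lemma tailSum_sub {M : ℤ} {f : ℤ → ℝ} (hf : ∀ b, M < |b| → f b = 0) (p : ℤ) :
    tailSum M f p - tailSum M f (p + 1) = f p := by
  rw [tailSum, tailSum, ← Finset.sum_sub_distrib]
  have : ∀ b ∈ Finset.Icc (-M) M, ((if p ≤ b then f b else 0) - if p + 1 ≤ b then f b else 0) =
      if p = b then f b else 0 := by
    intro b _
    split_ifs <;> first | omega | simp
  rw [Finset.sum_congr rfl this, Finset.sum_ite_eq]
  split_ifs with h
  · rfl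
  · rw [Finset.mem_Icc, ← abs_le] at h
    exact (hf p (by omega)).symm

lemma tailSum_eq_zero {M : ℤ} (f : ℤ → ℝ) {p : ℤ} (hp : M < p) : tailSum M f p = 0 :=
  Finset.sum_eq_zero fun b hb => by
    have := Finset.mem_Icc.1 hb
    rw [if_neg (by omega)]

section Stokes

variable {h v : ℤ → ℤ → ℝ} {M : ℤ}

lemma tailSum_faceCurl (hh : ∀ a b, M ≤ |a| ∨ M ≤ |b| → h a b = 0)
    (hv : ∀ a b, M ≤ |a| ∨ M ≤ |b| → v a b = 0) (a p : ℤ) :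
    tailSum M (faceCurl h v a) p = h a p + tailSum M (v (a + 1)) p - tailSum M (v a) p := by
  have key : ∀ q, tailSum M (faceCurl h v a) q - tailSum M (faceCurl h v a) (q + 1) =
      (h a q + tailSum M (v (a + 1)) q - tailSum M (v a) q) -
      (h a (q + 1) + tailSum M (v (a + 1)) (q + 1) - tailSum M (v a) (q + 1)) := by
    intro q
    have e0 : ∀ b, M < |b| → faceCurl h v a b = 0 := by
      intro b hb
      have : M ≤ |b + 1| := by
        rcases abs_cases b with ⟨h1, h2⟩ | ⟨h1, h2⟩ <;>
          rcases abs_cases (b + 1) with ⟨h3, h4⟩ | ⟨h3, h4⟩ <;> omega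
      rw [faceCurl, hh _ _ (Or.inr hb.le), hv _ _ (Or.inr hb.le), hv _ _ (Or.inr hb.le),
        hh _ _ (Or.inr this)]
      ring
    have e1 := tailSum_sub e0 q
    have e2 := tailSum_sub (M := M) (f := v a) (fun b hb => hv _ _ (Or.inr hb.le)) q
    have e3 := tailSum_sub (M := M) (f := v (a + 1)) (fun b hb => hv _ _ (Or.inr hb.le)) q
    rw [e1, faceCurl]
    linarith
  have top : ∀ q, M < q → tailSum M (faceCurl h v a) q =
      h a q + tailSum M (v (a + 1)) q - tailSum M (v a) q := by
    intro q hq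
    rw [tailSum_eq_zero _ hq, tailSum_eq_zero _ hq, tailSum_eq_zero _ hq,
      hh _ _ (Or.inr (hq.le.trans (le_abs_self q)))]
    simp
  rcases lt_or_ge M p with hp | hp
  · exact top p hp
  · have hp' : p ≤ M + 1 := by omega
    induction p, hp' using Int.leInductionDown with
    | base => exact top _ (by omega)
    | pred q hq ih =>
      have h1 := key (q - 1)
      rw [sub_add_cancel] at h1
      rcases lt_or_ge M q with h2 | h2
      · rw [top q h2] at h1; linarith
      · rw [ih h2] at h1; linarith

lemma stepWeight_eq (hh : ∀ a b, M ≤ |a| ∨ M ≤ |b| → h a b = 0)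
    (hv : ∀ a b, M ≤ |a| ∨ M ≤ |b| → v a b = 0) {p q : ℤ × ℤ} (hpq : LatticeStep p q) :
    stepWeight h v p q =
      ∑ a ∈ Finset.Icc (-M) M, ∑ b ∈ Finset.Icc (-M) M, (faceFlow p q a b : ℝ) * faceCurl h v a b
        - (tailSum M (v q.1) q.2 - tailSum M (v p.1) p.2) := by
  have hcol : ∀ a, a ∉ Finset.Icc (-M) M → ∀ b, faceCurl h v a b = 0 := by
    intro a ha b
    rw [Finset.mem_Icc, ← abs_le, not_le] at ha
    have : M ≤ |a + 1| := by
      rcases abs_cases a with ⟨h1, h2⟩ | ⟨h1, h2⟩ <;>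
        rcases abs_cases (a + 1) with ⟨h3, h4⟩ | ⟨h3, h4⟩ <;> omega
    rw [faceCurl, hh _ _ (Or.inl ha.le), hv _ _ (Or.inl ha.le), hh _ _ (Or.inl ha.le),
      hv _ _ (Or.inl this)]
    ring
  have hsum : ∀ a₀ p₀ : ℤ, ∑ a ∈ Finset.Icc (-M) M, ∑ b ∈ Finset.Icc (-M) M,
      (if a₀ = a ∧ p₀ ≤ b then faceCurl h v a b else 0) = tailSum M (faceCurl h v a₀) p₀ := by
    intro a₀ p₀
    have e1 : ∀ a ∈ Finset.Icc (-M) M, ∑ b ∈ Finset.Icc (-M) M,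
        (if a₀ = a ∧ p₀ ≤ b then faceCurl h v a b else 0) =
        if a₀ = a then tailSum M (faceCurl h v a) p₀ else 0 := by
      intro a _
      split_ifs with h1
      · subst h1; simp [tailSum]
      · simp [h1]
    rw [Finset.sum_congr rfl e1, Finset.sum_ite_eq]
    split_ifs with h1
    · rfl
    · rw [tailSum]
      exact (Finset.sum_eq_zero fun b _ => by rw [hcol a₀ h1 b]; simp).symm
  have hflow : ∑ a ∈ Finset.Icc (-M) M, ∑ b ∈ Finset.Icc (-M) M,
      (faceFlow p q a b : ℝ) * faceCurl h v a b =
      (if q.1 = p.1 + 1 then tailSum M (faceCurl h v p.1) p.2 else 0) -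
      (if p.1 = q.1 + 1 then tailSum M (faceCurl h v q.1) q.2 else 0) := by
    rw [← hsum, ← hsum]
    have e : ∀ a b, (faceFlow p q a b : ℝ) * faceCurl h v a b =
        (if q.1 = p.1 + 1 then if p.1 = a ∧ p.2 ≤ b then faceCurl h v a b else 0 else 0) -
        (if p.1 = q.1 + 1 then if q.1 = a ∧ q.2 ≤ b then faceCurl h v a b else 0 else 0) := by
      intro a b
      rw [faceFlow]
      push_cast
      rw [sub_mul]
      congr 1
      · split_ifs <;> first | omega | simp
      · split_ifs <;> first | omega | simp
    simp_rw [e, Finset.sum_sub_distrib]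
    congr 1 <;> split_ifs <;> simp
  rw [hflow]
  obtain ⟨p1, p2⟩ := p
  have hv' : ∀ a b, M < |b| → v a b = 0 := fun a b hb => hv _ _ (Or.inr hb.le)
  have t := tailSum_faceCurl hh hv
  rcases hpq with h | h | h | h | h <;> subst h
  · simp [stepWeight_self]
  · simp [stepWeight, t, add_assoc]
  · have := t (p1 - 1) p2
    rw [sub_add_cancel] at this
    have e3 : ¬ (p1 - 1 = p1 + 1) := by omega
    simp [stepWeight, this, e3]
  · have := tailSum_sub (hv' p1) p2
    simp [stepWeight]
    linarith
  · have := tailSum_sub (hv' p1) (p2 - 1)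
    rw [sub_add_cancel] at this
    have e3 : ¬ (p2 - 1 = p2 + 1) := by omega
    simp [stepWeight, e3]
    linarith

/-- The total weight of a lattice walk. -/
def walkSum (h v : ℤ → ℤ → ℝ) (g : ℕ → ℤ × ℤ) (n : ℕ) : ℝ :=
  ∑ l ∈ Finset.range n, stepWeight h v (g l) (g (l + 1))

variable {g : ℕ → ℤ × ℤ} {n : ℕ} {D : ℝ}

lemma walkSum_eq (hh : ∀ a b, M ≤ |a| ∨ M ≤ |b| → h a b = 0)
    (hv : ∀ a b, M ≤ |a| ∨ M ≤ |b| → v a b = 0)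
    (hstep : ∀ l < n, LatticeStep (g l) (g (l + 1))) (hclosed : g n = g 0) :
    walkSum h v g n = ∑ a ∈ Finset.Icc (-M) M, ∑ b ∈ Finset.Icc (-M) M,
      (latticeWinding g n a b : ℝ) * faceCurl h v a b := by
  rw [walkSum, Finset.sum_congr rfl fun l hl =>
    stepWeight_eq hh hv (hstep l (Finset.mem_range.1 hl)), Finset.sum_sub_distrib,
    Finset.sum_range_sub (fun l => tailSum M (v (g l).1) (g l).2), hclosed, sub_self, sub_zero,
    Finset.sum_comm]
  refine Finset.sum_congr rfl fun a _ => ?_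
  rw [Finset.sum_comm]
  refine Finset.sum_congr rfl fun b _ => ?_
  rw [latticeWinding, ← Finset.sum_mul]
  push_cast
  rfl

lemma abs_walkSum_le_of_simple (hM : 0 ≤ M) (hD : 0 ≤ D)
    (hh : ∀ a b, M ≤ |a| ∨ M ≤ |b| → h a b = 0)
    (hv : ∀ a b, M ≤ |a| ∨ M ≤ |b| → v a b = 0)
    (hhD : ∀ a b a' b', |h a b - h a' b'| ≤ D * (|a - a'| + |b - b'| : ℤ))
    (hvD : ∀ a b a' b', |v a b - v a' b'| ≤ D * (|a - a'| + |b - b'| : ℤ))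
    (hstep : ∀ l < n, LatticeStep (g l) (g (l + 1))) (hclosed : g n = g 0)
    (hinj : ∀ i j, i < j → j ≤ n → g i = g j → i = 0 ∧ j = n) :
    |walkSum h v g n| ≤ (2 * M + 1) ^ 2 * (2 * D) := by
  have hpos : (0 : ℝ) ≤ (2 * M + 1) ^ 2 * (2 * D) := by positivity
  rcases lt_or_ge n 3 with hn | hn
  · suffices walkSum h v g n = 0 by rw [this]; simpa using hpos
    interval_cases n
    · simp [walkSum]
    · simp [walkSum, hclosed, stepWeight_self]
    · have h1 := hstep 0 (by omega)
      simp only [walkSum, Finset.sum_range_succ, Finset.sum_range_zero, zero_add, Nat.reduceAdd,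
        hclosed] at *
      generalize g 0 = p at *
      generalize g 1 = q at *
      obtain ⟨p1, p2⟩ := p
      have e1 : ¬ (p1 - 1 = p1 + 1) := by omega
      have e2 : ¬ (p2 - 1 = p2 + 1) := by omega
      have e3 : ¬ (p1 = p1 + 1 + 1) := by omega
      have e5 : ¬ (p1 = p1 - 1) := by omega
      have e6 : ¬ (p2 = p2 - 1) := by omega
      have e4 : ¬ (p2 = p2 + 1 + 1) := by omega
      rcases h1 with h | h | h | h | h <;> subst h <;> simp [stepWeight, e1, e2, e3, e4, e5, e6]
  · rw [walkSum_eq hh hv hstep hclosed]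
    have hterm : ∀ a b, |(latticeWinding g n a b : ℝ) * faceCurl h v a b| ≤ 2 * D := by
      intro a b
      have h1 : |(latticeWinding g n a b : ℝ)| ≤ 1 := by
        exact_mod_cast abs_latticeWinding_le_one hn hstep hclosed hinj a b
      have h2 : |faceCurl h v a b| ≤ 2 * D := by
        have e1 := hhD a b a (b + 1)
        have e2 := hvD (a + 1) b a b
        simp at e1 e2
        rw [faceCurl, show h a b + v (a + 1) b - h a (b + 1) - v a b =
          (h a b - h a (b + 1)) + (v (a + 1) b - v a b) by ring]
        exact (abs_add_le _ _).trans (by linarith)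
      rw [abs_mul]
      calc _ ≤ 1 * (2 * D) := by gcongr
        _ = _ := one_mul _
    refine (Finset.abs_sum_le_sum_abs _ _).trans ?_
    have hcard : ((Finset.Icc (-M) M).card : ℝ) = 2 * M + 1 := by
      rw [Int.card_Icc]
      have : ((M + 1 - -M).toNat : ℤ) = 2 * M + 1 := by omega
      exact_mod_cast this
    calc _ ≤ ∑ a ∈ Finset.Icc (-M) M, ∑ b ∈ Finset.Icc (-M) M, 2 * D :=
          Finset.sum_le_sum fun a _ => (Finset.abs_sum_le_sum_abs _ _).trans
            (Finset.sum_le_sum fun b _ => hterm a b)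
      _ = _ := by
        rw [Finset.sum_const, Finset.sum_const, nsmul_eq_mul, nsmul_eq_mul, hcard]
        ring

end Stokes

section Walk

variable {h v : ℤ → ℤ → ℝ} {M : ℤ} {g : ℕ → ℤ × ℤ} {n : ℕ} {D : ℝ}

/-- The `ℓ¹` distance on the square lattice. -/
def latticeDist (p q : ℤ × ℤ) : ℤ := |p.1 - q.1| + |p.2 - q.2|

lemma LatticeStep.dist_le {p q : ℤ × ℤ} (hpq : LatticeStep p q) : latticeDist q p ≤ 1 := by
  obtain ⟨p1, p2⟩ := p
  rcases hpq with h | h | h | h | h <;> subst h <;> simp [latticeDist]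

lemma latticeDist_triangle (p q r : ℤ × ℤ) :
    latticeDist p r ≤ latticeDist p q + latticeDist q r := by
  have h1 := abs_sub_le p.1 q.1 r.1
  have h2 := abs_sub_le p.2 q.2 r.2
  simp only [latticeDist]; omega

lemma latticeDist_walk_le (hstep : ∀ l < n, LatticeStep (g l) (g (l + 1))) {l : ℕ} (hl : l ≤ n) :
    latticeDist (g l) (g 0) ≤ l := by
  induction l with
  | zero => simp [latticeDist]
  | succ l ih =>
    have h1 := (hstep l (by omega)).dist_le
    have h2 := latticeDist_triangle (g (l + 1)) (g l) (g 0)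
    have := ih (by omega)
    push_cast
    omega

/-- The weight of a lattice step differs little from that for weights frozen at a near vertex. -/
lemma abs_stepWeight_sub_le (hD : 0 ≤ D)
    (hhD : ∀ a b a' b', |h a b - h a' b'| ≤ D * (|a - a'| + |b - b'| : ℤ))
    (hvD : ∀ a b a' b', |v a b - v a' b'| ≤ D * (|a - a'| + |b - b'| : ℤ))
    {p q r : ℤ × ℤ} {m : ℕ} (hpq : LatticeStep p q) (hp : latticeDist p r ≤ m)
    (hq : latticeDist q r ≤ m) :
    |stepWeight h v p q - (h r.1 r.2 * (q.1 - p.1) + v r.1 r.2 * (q.2 - p.2))| ≤ D * m := by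
  have b1 : D * (latticeDist p r : ℤ) ≤ D * m := by
    gcongr
    exact_mod_cast hp
  have b2 : D * (latticeDist q r : ℤ) ≤ D * m := by
    gcongr
    exact_mod_cast hq
  have b0 : 0 ≤ D * m := by positivity
  have a1 := (hhD p.1 p.2 r.1 r.2).trans b1
  have a2 := (hhD q.1 q.2 r.1 r.2).trans b2
  have a3 := (hvD p.1 p.2 r.1 r.2).trans b1
  have a4 := (hvD q.1 q.2 r.1 r.2).trans b2
  obtain ⟨p1, p2⟩ := p
  have e1 : ¬ (p1 - 1 = p1 + 1) := by omega
  have e2 : ¬ (p2 - 1 = p2 + 1) := by omega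
  rcases hpq with h | h | h | h | h
  · subst h; rw [stepWeight_self]; simpa using b0
  · subst h; refine le_of_eq_of_le (congrArg _ ?_) a1; simp [stepWeight]
  · subst h; rw [← abs_neg]; refine le_of_eq_of_le (congrArg _ ?_) a2; simp [stepWeight, e1]; ring
  · subst h; refine le_of_eq_of_le (congrArg _ ?_) a3; simp [stepWeight]
  · subst h; rw [← abs_neg]; refine le_of_eq_of_le (congrArg _ ?_) a4; simp [stepWeight, e2]; ring

lemma abs_walkSum_le_sq (hD : 0 ≤ D)
    (hhD : ∀ a b a' b', |h a b - h a' b'| ≤ D * (|a - a'| + |b - b'| : ℤ))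
    (hvD : ∀ a b a' b', |v a b - v a' b'| ≤ D * (|a - a'| + |b - b'| : ℤ))
    (hstep : ∀ l < n, LatticeStep (g l) (g (l + 1))) (hclosed : g n = g 0) :
    |walkSum h v g n| ≤ D * n ^ 2 := by
  set F : ℤ × ℤ → ℝ := fun p => h (g 0).1 (g 0).2 * p.1 + v (g 0).1 (g 0).2 * p.2 with hF
  have h1 : walkSum h v g n =
      ∑ l ∈ Finset.range n, (stepWeight h v (g l) (g (l + 1)) - (F (g (l + 1)) - F (g l))) := by
    rw [Finset.sum_sub_distrib, Finset.sum_range_sub (fun l => F (g l)), hclosed, sub_self,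
      sub_zero, walkSum]
  have h2 : ∀ l ∈ Finset.range n,
      |stepWeight h v (g l) (g (l + 1)) - (F (g (l + 1)) - F (g l))| ≤ D * n := by
    intro l hl
    have hln := Finset.mem_range.1 hl
    have d1 := latticeDist_walk_le hstep hln.le
    have d2 := latticeDist_walk_le hstep (l := l + 1) hln
    have := abs_stepWeight_sub_le hD hhD hvD (r := g 0) (m := n) (hstep l hln)
      (by omega) (by omega)
    convert this using 3
    simp only [hF]; ring
  rw [h1]
  calc _ ≤ ∑ l ∈ Finset.range n, D * (n : ℝ) :=
        (Finset.abs_sum_le_sum_abs _ _).trans (Finset.sum_le_sum h2)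
    _ = _ := by rw [Finset.sum_const, Finset.card_range, nsmul_eq_mul]; ring

/-- The walk `g` with the loop of length `m` based at time `i` removed. -/
def cutWalk (g : ℕ → ℤ × ℤ) (i m : ℕ) (l : ℕ) : ℤ × ℤ := if l ≤ i then g l else g (l + m)

lemma cutWalk_of_ge {i m l : ℕ} (hg : g i = g (i + m)) (hl : i ≤ l) :
    cutWalk g i m l = g (l + m) := by
  rcases hl.eq_or_lt with h | h
  · subst h; simp [cutWalk, hg]
  · rw [cutWalk, if_neg (by omega)]

lemma walkSum_cut {i m : ℕ} (hg : g i = g (i + m)) (hm : i + m ≤ n) :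
    walkSum h v g n = walkSum h v (cutWalk g i m) (n - m) + walkSum h v (fun l => g (i + l)) m := by
  obtain ⟨r, rfl⟩ := Nat.exists_eq_add_of_le hm
  have e : i + m + r - m = i + r := by omega
  simp only [walkSum]
  rw [e, Finset.sum_range_add, Finset.sum_range_add, Finset.sum_range_add]
  have e1 : ∀ l ∈ Finset.range i, stepWeight h v (cutWalk g i m l) (cutWalk g i m (l + 1)) =
      stepWeight h v (g l) (g (l + 1)) := by
    intro l hl
    have := Finset.mem_range.1 hl
    rw [cutWalk, cutWalk, if_pos (by omega), if_pos (by omega)]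
  have e2 : ∀ l ∈ Finset.range r,
      stepWeight h v (cutWalk g i m (i + l)) (cutWalk g i m (i + l + 1)) =
      stepWeight h v (g (i + m + l)) (g (i + m + l + 1)) := by
    intro l _
    rw [cutWalk_of_ge hg (by omega), cutWalk_of_ge hg (by omega)]
    congr 2 <;> omega
  rw [Finset.sum_congr rfl e1, Finset.sum_congr rfl e2]
  simp only [add_assoc]
  ring

lemma latticeStep_cutWalk {i m : ℕ} (hg : g i = g (i + m)) (hm : i + m ≤ n)
    (hstep : ∀ l < n, LatticeStep (g l) (g (l + 1))) {l : ℕ} (hl : l < n - m) :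
    LatticeStep (cutWalk g i m l) (cutWalk g i m (l + 1)) := by
  rcases lt_or_ge l i with h | h
  · rw [cutWalk, cutWalk, if_pos (by omega), if_pos (by omega)]
    exact hstep l (by omega)
  · rw [cutWalk_of_ge hg h, cutWalk_of_ge hg (by omega), show l + 1 + m = l + m + 1 by omega]
    exact hstep _ (by omega)

lemma cutWalk_closed {i m : ℕ} (hg : g i = g (i + m)) (hm : i + m ≤ n) (hclosed : g n = g 0) :
    cutWalk g i m (n - m) = cutWalk g i m 0 := by
  rw [cutWalk_of_ge hg (by omega), Nat.sub_add_cancel (by omega), hclosed]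
  simp [cutWalk]

lemma abs_walkSum_le_of_short_returns (hM : 0 ≤ M) (hD : 0 ≤ D)
    (hh : ∀ a b, M ≤ |a| ∨ M ≤ |b| → h a b = 0)
    (hv : ∀ a b, M ≤ |a| ∨ M ≤ |b| → v a b = 0)
    (hhD : ∀ a b a' b', |h a b - h a' b'| ≤ D * (|a - a'| + |b - b'| : ℤ))
    (hvD : ∀ a b a' b', |v a b - v a' b'| ≤ D * (|a - a'| + |b - b'| : ℤ))
    {k : ℕ} (hstep : ∀ l < n, LatticeStep (g l) (g (l + 1))) (hclosed : g n = g 0)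
    (hret : ∀ i j, i < j → j ≤ n → g i = g j → j - i ≤ k ∨ (i = 0 ∧ j = n)) :
    |walkSum h v g n| ≤ (2 * M + 1) ^ 2 * (2 * D) + D * k * n := by
  induction n using Nat.strong_induction_on generalizing g with
  | _ n ih =>
    by_cases hs : ∀ i j, i < j → j ≤ n → g i = g j → i = 0 ∧ j = n
    · have := abs_walkSum_le_of_simple hM hD hh hv hhD hvD hstep hclosed hs
      have h0 : 0 ≤ D * k * n := by positivity
      linarith
    · push Not at hs
      obtain ⟨i, j, hij, hjn, hg, hne⟩ := hs
      have hjk : j - i ≤ k := by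
        rcases hret i j hij hjn hg with h | h
        · exact h
        · exact absurd h.2 (hne h.1)
      obtain ⟨m, rfl⟩ := Nat.exists_eq_add_of_lt hij
      set m' := m + 1 with hm'
      have hg' : g i = g (i + m') := hg
      have hjn' : i + m' ≤ n := hjn
      rw [walkSum_cut hg' hjn']
      have h1 := ih (n - m') (by omega) (g := cutWalk g i m')
        (fun l hl => latticeStep_cutWalk hg' hjn' hstep hl) (cutWalk_closed hg' hjn' hclosed) ?_
      · have h2 := abs_walkSum_le_sq (n := m') (g := fun l => g (i + l)) hD hhD hvD
          (fun l hl => hstep (i + l) (by omega)) (by simpa using hg'.symm)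
        have h3 : D * (m' : ℝ) ^ 2 ≤ D * k * m' := by
          have : (m' : ℝ) ≤ k := by exact_mod_cast (by omega : m' ≤ k)
          have : (m' : ℝ) ^ 2 ≤ k * m' := by rw [sq]; gcongr
          rw [mul_assoc]; gcongr
        rw [Nat.cast_sub (by omega)] at h1
        refine (abs_add_le _ _).trans ?_
        nlinarith
      · intro a b hab hbn hgab
        have key : ∀ a' b', a' < b' → b' ≤ n → b - a ≤ b' - a' → cutWalk g i m' a = g a' →
            cutWalk g i m' b = g b' → (a' = 0 → b' = n → a = 0 ∧ b = n - m') →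
            b - a ≤ k ∨ (a = 0 ∧ b = n - m') := by
          intro a' b' h1 h2 h3 h4 h5 h6
          rcases hret a' b' h1 h2 (by rw [← h4, ← h5, hgab]) with h | h
          · left; omega
          · exact Or.inr (h6 h.1 h.2)
        rcases le_or_gt b i with hb | hb
        · exact key a b hab (by omega) le_rfl (by rw [cutWalk, if_pos (by omega)])
            (by rw [cutWalk, if_pos (by omega)]) (by omega)
        · rcases le_or_gt a i with ha | ha
          · exact key a (b + m') (by omega) (by omega) (by omega)
              (by rw [cutWalk, if_pos (by omega)]) (cutWalk_of_ge hg' hb.le) (by omega)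
          · exact key (a + m') (b + m') (by omega) (by omega) (by omega)
              (cutWalk_of_ge hg' ha.le) (cutWalk_of_ge hg' hb.le) (by omega)

/-- A closed lattice walk whose returns are all either short or almost complete has small
total weight. -/
lemma abs_walkSum_le (hM : 0 ≤ M) (hD : 0 ≤ D)
    (hh : ∀ a b, M ≤ |a| ∨ M ≤ |b| → h a b = 0)
    (hv : ∀ a b, M ≤ |a| ∨ M ≤ |b| → v a b = 0)
    (hhD : ∀ a b a' b', |h a b - h a' b'| ≤ D * (|a - a'| + |b - b'| : ℤ))
    (hvD : ∀ a b a' b', |v a b - v a' b'| ≤ D * (|a - a'| + |b - b'| : ℤ))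
    {k : ℕ} (hstep : ∀ l < n, LatticeStep (g l) (g (l + 1))) (hclosed : g n = g 0)
    (hret : ∀ i j, i < j → j ≤ n → g i = g j → j - i ≤ k ∨ n ≤ j - i + k) :
    |walkSum h v g n| ≤ (2 * M + 1) ^ 2 * (2 * D) + D * k * n := by
  have hsq : ∀ m ≤ k, D * (m : ℝ) ^ 2 ≤ D * k * m := by
    intro m hm
    have : (m : ℝ) ≤ k := by exact_mod_cast hm
    have : (m : ℝ) ^ 2 ≤ k * m := by rw [sq]; gcongr
    rw [mul_assoc]; gcongr
  rcases le_or_gt n k with hnk | hnk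
  · have h1 := abs_walkSum_le_sq hD hhD hvD hstep hclosed
    have h2 := hsq n hnk
    have h3 : 0 ≤ (2 * (M : ℝ) + 1) ^ 2 * (2 * D) := by positivity
    linarith
  · classical
    have hex : ∃ m, k < m ∧ ∃ i, i + m ≤ n ∧ g i = g (i + m) :=
      ⟨n, hnk, 0, by omega, by simp [hclosed]⟩
    set m := Nat.find hex with hm
    obtain ⟨hkm, i, hin, hg⟩ := Nat.find_spec hex
    rw [← hm] at hkm hin hg
    have hmin : ∀ a b, a < b → b ≤ n → g a = g b → k < b - a → m ≤ b - a := by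
      intro a b hab hbn hgab hk
      exact Nat.find_min' hex ⟨hk, a, by omega, by rw [hgab]; congr 1; omega⟩
    have hnm : n ≤ m + k := by
      rcases hret i (i + m) (by omega) hin hg with h | h <;> omega
    rw [walkSum_cut hg hin]
    have h1 := abs_walkSum_le_sq (n := n - m) (g := cutWalk g i m) hD hhD hvD
      (fun l hl => latticeStep_cutWalk hg hin hstep hl) (cutWalk_closed hg hin hclosed)
    have h2 := hsq (n - m) (by omega)
    have h3 := abs_walkSum_le_of_short_returns (n := m) (g := fun l => g (i + l)) (k := k) hM hD
      hh hv hhD hvD (fun l hl => hstep (i + l) (by omega)) (by simpa using hg.symm) (by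
        intro a b hab hbm hgab
        by_cases hk : b - a ≤ k
        · exact Or.inl hk
        · have := hmin (i + a) (i + b) (by omega) (by omega) hgab (by omega)
          right; omega)
    rw [Nat.cast_sub (by omega)] at h1 h2
    refine (abs_add_le _ _).trans ?_
    nlinarith

end Walk

section ClosedCurve

variable {A₁ A₂ : ℝ → ℝ → ℝ} {K B : ℝ} {ζ₁ ζ₂ R : ℝ → ℝ} {T L C : ℝ}

lemma continuousOn_of_abs_sub_le {f : ℝ → ℝ} {s : Set ℝ}
    (h : ∀ x ∈ s, ∀ y ∈ s, |f x - f y| ≤ L * |x - y|) : ContinuousOn f s := by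
  have : LipschitzOnWith (Real.toNNReal L) f s := LipschitzOnWith.of_dist_le_mul fun x hx y hy => by
    rw [Real.dist_eq, Real.dist_eq]
    exact (h x hx y hy).trans (by gcongr; exact Real.le_coe_toNNReal L)
  exact this.continuousOn

/-- Near returns of a simple closed curve are either short or almost complete. -/
lemma exists_forall_near_return
    (hζ₁ : ContinuousOn ζ₁ (Set.Icc 0 T)) (hζ₂ : ContinuousOn ζ₂ (Set.Icc 0 T))
    (hinj : ∀ s t, 0 ≤ s → s < t → t ≤ T → ζ₁ s = ζ₁ t → ζ₂ s = ζ₂ t → s = 0 ∧ t = T)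
    {κ : ℝ} (hκ : 0 < κ) :
    ∃ η > 0, ∀ s t, 0 ≤ s → s ≤ t → t ≤ T → |ζ₁ s - ζ₁ t| < η → |ζ₂ s - ζ₂ t| < η →
      t - s ≤ κ ∨ T - κ ≤ t - s := by
  set S : Set (ℝ × ℝ) := (Set.Icc 0 T ×ˢ Set.Icc 0 T) ∩ {p | p.1 + κ ≤ p.2 ∧ p.2 - p.1 ≤ T - κ}
  have hS : IsCompact S := by
    refine (isCompact_Icc.prod isCompact_Icc).inter_right ?_
    exact (isClosed_le (f := fun p : ℝ × ℝ => p.1 + κ) (g := fun p => p.2) (by fun_prop)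
      (by fun_prop)).inter (isClosed_le (f := fun p : ℝ × ℝ => p.2 - p.1) (g := fun _ => T - κ)
      (by fun_prop) (by fun_prop))
  have m1 : Set.MapsTo Prod.fst S (Set.Icc 0 T) := fun p hp => hp.1.1
  have m2 : Set.MapsTo Prod.snd S (Set.Icc 0 T) := fun p hp => hp.1.2
  have hf : ContinuousOn (fun p : ℝ × ℝ => max |ζ₁ p.1 - ζ₁ p.2| |ζ₂ p.1 - ζ₂ p.2|) S :=
    ((hζ₁.comp continuousOn_fst m1).sub (hζ₁.comp continuousOn_snd m2)).abs.sup
      ((hζ₂.comp continuousOn_fst m1).sub (hζ₂.comp continuousOn_snd m2)).abs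
  obtain ⟨η, hη, h⟩ := hS.exists_forall_le' hf (a := 0) (by
    rintro ⟨s, t⟩ ⟨⟨hs, ht⟩, h1, h2⟩
    simp only at h1 h2 ⊢
    by_contra h3
    rw [lt_max_iff, not_or, abs_pos, abs_pos, not_not, not_not] at h3
    have := hinj s t hs.1 (by linarith) ht.2 (sub_eq_zero.1 h3.1) (sub_eq_zero.1 h3.2)
    rw [this.1, this.2] at h2
    linarith)
  refine ⟨η, hη, fun s t hs hst ht h1 h2 => ?_⟩
  by_contra h3
  push Not at h3
  have := h (s, t) ⟨⟨⟨hs, by linarith⟩, ⟨by linarith, ht⟩⟩, by simp only; linarith,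
    by simp only; linarith⟩
  exact absurd this (not_le.2 (max_lt h1 h2))

lemma abs_floor_sub_floor_le {x y : ℝ} (h : |x - y| ≤ 1) : |⌊x⌋ - ⌊y⌋| ≤ 1 := by
  rw [abs_le] at h ⊢
  have h1 : ⌊x⌋ ≤ ⌊y + 1⌋ := Int.floor_le_floor (by linarith)
  have h2 : ⌊y⌋ ≤ ⌊x + 1⌋ := Int.floor_le_floor (by linarith)
  rw [Int.floor_add_one] at h1 h2
  omega

lemma abs_sub_mul_floor_le {x ε : ℝ} (hε : 0 < ε) : |x - ε * ⌊x / ε⌋| ≤ ε := by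
  have h1 := Int.floor_le (x / ε)
  have h2 := Int.lt_floor_add_one (x / ε)
  rw [le_div_iff₀ hε] at h1
  rw [div_lt_iff₀ hε] at h2
  rw [abs_le]
  constructor <;> nlinarith

/-- The walk alternating between the vertices `γ i` and `((γ (i + 1)).1, (γ i).2)`. -/
def stairWalk (γ : ℕ → ℤ × ℤ) (l : ℕ) : ℤ × ℤ := ((γ ((l + 1) / 2)).1, (γ (l / 2)).2)

lemma stairWalk_even (γ : ℕ → ℤ × ℤ) (i : ℕ) : stairWalk γ (2 * i) = γ i := by
  simp only [stairWalk]
  rw [show (2 * i + 1) / 2 = i by omega, show 2 * i / 2 = i by omega]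

lemma stairWalk_odd (γ : ℕ → ℤ × ℤ) (i : ℕ) :
    stairWalk γ (2 * i + 1) = ((γ (i + 1)).1, (γ i).2) := by
  simp only [stairWalk]
  rw [show (2 * i + 1 + 1) / 2 = i + 1 by omega, show (2 * i + 1) / 2 = i by omega]

lemma latticeStep_fst {a a' b : ℤ} (h : |a' - a| ≤ 1) : LatticeStep (a, b) (a', b) := by
  rw [abs_le] at h
  have : a' = a ∨ a' = a + 1 ∨ a' = a - 1 := by omega
  rcases this with rfl | rfl | rfl <;> simp [LatticeStep]

lemma latticeStep_snd {a b b' : ℤ} (h : |b' - b| ≤ 1) : LatticeStep (a, b) (a, b') := by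
  rw [abs_le] at h
  have : b' = b ∨ b' = b + 1 ∨ b' = b - 1 := by omega
  rcases this with rfl | rfl | rfl <;> simp [LatticeStep]

lemma latticeStep_stairWalk {γ : ℕ → ℤ × ℤ} {n : ℕ}
    (hγ : ∀ i < n, |(γ (i + 1)).1 - (γ i).1| ≤ 1 ∧ |(γ (i + 1)).2 - (γ i).2| ≤ 1) {l : ℕ}
    (hl : l < 2 * n) : LatticeStep (stairWalk γ l) (stairWalk γ (l + 1)) := by
  rcases Nat.even_or_odd' l with ⟨i, rfl | rfl⟩
  · rw [stairWalk_even, stairWalk_odd]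
    exact latticeStep_fst (hγ i (by omega)).1
  · rw [stairWalk_odd, show 2 * i + 1 + 1 = 2 * (i + 1) by ring, stairWalk_even]
    exact latticeStep_snd (hγ i (by omega)).2

lemma walkSum_stairWalk_ge {h v : ℤ → ℤ → ℝ} {D : ℝ} (hD : 0 ≤ D)
    (hhD : ∀ a b a' b', |h a b - h a' b'| ≤ D * (|a - a'| + |b - b'| : ℤ))
    (hvD : ∀ a b a' b', |v a b - v a' b'| ≤ D * (|a - a'| + |b - b'| : ℤ))
    {γ : ℕ → ℤ × ℤ} {n : ℕ}
    (hγ : ∀ i < n, |(γ (i + 1)).1 - (γ i).1| ≤ 1 ∧ |(γ (i + 1)).2 - (γ i).2| ≤ 1) :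
    |walkSum h v (stairWalk γ) (2 * n) - ∑ i ∈ Finset.range n,
      (h (γ i).1 (γ i).2 * ((γ (i + 1)).1 - (γ i).1) +
        v (γ i).1 (γ i).2 * ((γ (i + 1)).2 - (γ i).2))| ≤ 4 * D * n := by
  have e : ∀ m, walkSum h v (stairWalk γ) (2 * m) = ∑ i ∈ Finset.range m,
      (stepWeight h v (γ i) ((γ (i + 1)).1, (γ i).2) +
        stepWeight h v ((γ (i + 1)).1, (γ i).2) (γ (i + 1))) := by
    intro m
    induction m with
    | zero => simp [walkSum]
    | succ m ih =>
      rw [Finset.sum_range_succ, ← ih, walkSum, show 2 * (m + 1) = 2 * m + 1 + 1 by ring,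
        Finset.sum_range_succ, Finset.sum_range_succ, ← walkSum, stairWalk_even, stairWalk_odd,
        show 2 * m + 1 + 1 = 2 * (m + 1) by ring, stairWalk_even, add_assoc]
  rw [e, ← Finset.sum_sub_distrib]
  refine (Finset.abs_sum_le_sum_abs _ _).trans ?_
  have hterm : ∀ i ∈ Finset.range n, |stepWeight h v (γ i) ((γ (i + 1)).1, (γ i).2) +
        stepWeight h v ((γ (i + 1)).1, (γ i).2) (γ (i + 1)) -
        (h (γ i).1 (γ i).2 * ((γ (i + 1)).1 - (γ i).1) +
        v (γ i).1 (γ i).2 * ((γ (i + 1)).2 - (γ i).2))| ≤ 4 * D := by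
    intro i hi
    obtain ⟨h1, h2⟩ := hγ i (Finset.mem_range.1 hi)
    have a1 := abs_stepWeight_sub_le hD hhD hvD (r := γ i) (m := 2)
      (latticeStep_fst (b := (γ i).2) h1) (by simp [latticeDist])
      (by simp only [latticeDist, sub_self, abs_zero]; push_cast; omega)
    have a2 := abs_stepWeight_sub_le hD hhD hvD (r := γ i) (m := 2)
      (latticeStep_snd (a := (γ (i + 1)).1) h2)
      (by simp only [latticeDist, sub_self, abs_zero]; push_cast; omega)
      (by simp only [latticeDist]; push_cast; omega)
    have := abs_add_le _ _ |>.trans (add_le_add a1 a2)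
    refine le_of_eq_of_le (congrArg _ ?_) (this.trans (le_of_eq ?_))
    · simp; ring
    · push_cast; ring
  refine (Finset.sum_le_sum hterm).trans ?_
  rw [Finset.sum_const, Finset.card_range, nsmul_eq_mul]
  linarith

end ClosedCurve

section ClosedCurve

variable {A₁ A₂ : ℝ → ℝ → ℝ} {K B : ℝ} {ζ₁ ζ₂ R : ℝ → ℝ} {T L C : ℝ}

lemma abs_sub_le_of_lattice_scale {A : ℝ → ℝ → ℝ}
    (hA : ∀ x y x' y', |A x y - A x' y'| ≤ K * (|x - x'| + |y - y'|)) {ε : ℝ} (hε : 0 < ε)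
    (a b a' b' : ℤ) :
    |ε * A (ε * a) (ε * b) - ε * A (ε * a') (ε * b')| ≤
      K * ε ^ 2 * (|a - a'| + |b - b'| : ℤ) := by
  have h := hA (ε * a) (ε * b) (ε * a') (ε * b')
  rw [← mul_sub, ← mul_sub, abs_mul, abs_mul, abs_of_pos hε, ← mul_add] at h
  rw [← mul_sub, abs_mul, abs_of_pos hε]
  push_cast
  calc _ ≤ ε * (K * (ε * (|(a : ℝ) - a'| + |(b : ℝ) - b'|))) := by gcongr
    _ = _ := by ring

lemma closedCurve_discrete_bound (hK : 0 ≤ K) (hB : 0 ≤ B)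
    (hA₁ : ∀ x y x' y', |A₁ x y - A₁ x' y'| ≤ K * (|x - x'| + |y - y'|))
    (hA₂ : ∀ x y x' y', |A₂ x y - A₂ x' y'| ≤ K * (|x - x'| + |y - y'|))
    (hB₁ : ∀ x y, B ≤ |x| ∨ B ≤ |y| → A₁ x y = 0)
    (hB₂ : ∀ x y, B ≤ |x| ∨ B ≤ |y| → A₂ x y = 0)
    {γ : ℕ → ℝ × ℝ} {ρ : ℕ → ℝ} {n k : ℕ} {ε c : ℝ} (hε : 0 < ε)
    (hγ : ∀ i < n, |(γ (i + 1)).1 - (γ i).1| ≤ ε ∧ |(γ (i + 1)).2 - (γ i).2| ≤ ε)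
    (hclosed : γ n = γ 0)
    (hρ : ∀ i < n, ρ (i + 1) - ρ i + (A₁ (γ i).1 (γ i).2 * ((γ (i + 1)).1 - (γ i).1) +
      A₂ (γ i).1 (γ i).2 * ((γ (i + 1)).2 - (γ i).2)) ≤ c)
    (hret : ∀ i j, i < j → j ≤ 2 * n → |(γ (i / 2)).1 - (γ (j / 2)).1| ≤ 4 * ε →
      |(γ (i / 2)).2 - (γ (j / 2)).2| ≤ 4 * ε → j - i ≤ k ∨ 2 * n ≤ j - i + k) :
    ρ n - ρ 0 ≤ 2 * K * (2 * B + 3 * ε) ^ 2 + c * n + 12 * (K * ε ^ 2) * n +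
      2 * (K * ε ^ 2) * k * n := by
  set δ : ℕ → ℤ × ℤ := fun i => (⌊(γ i).1 / ε⌋, ⌊(γ i).2 / ε⌋) with hδ
  set h : ℤ → ℤ → ℝ := fun a b => ε * A₁ (ε * a) (ε * b) with hh
  set v : ℤ → ℤ → ℝ := fun a b => ε * A₂ (ε * a) (ε * b) with hv
  set D := K * ε ^ 2 with hD
  have hD0 : 0 ≤ D := by positivity
  set M : ℤ := ⌈B / ε⌉ with hM
  have hM0 : 0 ≤ M := Int.ceil_nonneg (by positivity)
  have hMB : (M : ℝ) * ε ≤ B + ε := by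
    have := Int.ceil_lt_add_one (B / ε)
    have h2 : (M : ℝ) * ε ≤ (B / ε + 1) * ε := by gcongr
    rwa [add_mul, div_mul_cancel₀ _ hε.ne', one_mul] at h2
  have hbig : ∀ a : ℤ, M ≤ |a| → B ≤ |ε * a| := by
    intro a ha
    have h1 : B / ε ≤ |(a : ℝ)| := (Int.le_ceil _).trans (by exact_mod_cast ha)
    rw [abs_mul, abs_of_pos hε, ← div_le_iff₀' hε]
    exact h1
  have hsupp₁ : ∀ a b, M ≤ |a| ∨ M ≤ |b| → h a b = 0 := fun a b hab => by
    simp only [hh]; rw [hB₁ _ _ (hab.imp (hbig a) (hbig b)), mul_zero]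
  have hsupp₂ : ∀ a b, M ≤ |a| ∨ M ≤ |b| → v a b = 0 := fun a b hab => by
    simp only [hv]; rw [hB₂ _ _ (hab.imp (hbig a) (hbig b)), mul_zero]
  have hhD : ∀ a b a' b', |h a b - h a' b'| ≤ D * (|a - a'| + |b - b'| : ℤ) :=
    abs_sub_le_of_lattice_scale hA₁ hε
  have hvD : ∀ a b a' b', |v a b - v a' b'| ≤ D * (|a - a'| + |b - b'| : ℤ) :=
    abs_sub_le_of_lattice_scale hA₂ hε
  have hdiv : ∀ x y : ℝ, |x - y| ≤ ε → |x / ε - y / ε| ≤ 1 := by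
    intro x y hxy
    rw [← sub_div, abs_div, abs_of_pos hε]
    exact (div_le_one hε).2 hxy
  have hδ' : ∀ i < n, |(δ (i + 1)).1 - (δ i).1| ≤ 1 ∧ |(δ (i + 1)).2 - (δ i).2| ≤ 1 := fun i hi =>
    ⟨abs_floor_sub_floor_le (hdiv _ _ (hγ i hi).1), abs_floor_sub_floor_le (hdiv _ _ (hγ i hi).2)⟩
  have hδn : δ n = δ 0 := by simp only [hδ, hclosed]
  have hξ₁ : ∀ i, |(γ i).1 - ε * (δ i).1| ≤ ε := fun i => abs_sub_mul_floor_le hε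
  have hξ₂ : ∀ i, |(γ i).2 - ε * (δ i).2| ≤ ε := fun i => abs_sub_mul_floor_le hε
  have hW1 := walkSum_stairWalk_ge hD0 hhD hvD hδ'
  have hW2 : |walkSum h v (stairWalk δ) (2 * n)| ≤
      (2 * M + 1) ^ 2 * (2 * D) + D * k * (2 * n : ℕ) := by
    refine abs_walkSum_le hM0 hD0 hsupp₁ hsupp₂ hhD hvD
      (fun l hl => latticeStep_stairWalk hδ' hl) ?_ ?_
    · have := stairWalk_even δ 0
      rw [mul_zero] at this
      rw [stairWalk_even, this, hδn]
    · intro i j hij hj hg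
      have hodd : ∀ l ≤ 2 * n, |(γ (l / 2)).1 - ε * (δ ((l + 1) / 2)).1| ≤ 2 * ε := by
        intro l hl
        rcases Nat.even_or_odd' l with ⟨m, rfl | rfl⟩
        · rw [show (2 * m + 1) / 2 = m by omega, show 2 * m / 2 = m by omega]
          linarith [hξ₁ m]
        · rw [show (2 * m + 1 + 1) / 2 = m + 1 by omega, show (2 * m + 1) / 2 = m by omega]
          have h1 := hξ₁ (m + 1)
          have h2 := (hγ m (by omega)).1
          rw [abs_le] at *
          constructor <;> linarith
      simp only [stairWalk, Prod.mk.injEq] at hg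
      have i1 := hodd i (by omega)
      have j1 := hodd j hj
      have i2 := hξ₂ (i / 2)
      have j2 := hξ₂ (j / 2)
      rw [hg.1] at i1
      rw [hg.2] at i2
      refine hret i j hij hj ?_ ?_
      · rw [abs_le] at *; constructor <;> linarith
      · rw [abs_le] at *; constructor <;> linarith
  set E : ℕ → ℝ := fun i => A₁ (γ i).1 (γ i).2 * ((γ i).1 - ε * (δ i).1) +
    A₂ (γ i).1 (γ i).2 * ((γ i).2 - ε * (δ i).2) with hE
  have hterm : ∀ i ∈ Finset.range n, (h (δ i).1 (δ i).2 * ((δ (i + 1)).1 - (δ i).1) +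
      v (δ i).1 (δ i).2 * ((δ (i + 1)).2 - (δ i).2)) + (ρ (i + 1) - ρ i) + (E (i + 1) - E i) ≤
      c + 8 * D := by
    intro i hi
    have hin := Finset.mem_range.1 hi
    have h0 := hρ i hin
    obtain ⟨g1, g2⟩ := hγ i hin
    have hmul : ∀ x y X Y : ℝ, |x| ≤ X → |y| ≤ Y → x * y ≤ X * Y := fun x y X Y hx hy =>
      (le_abs_self _).trans (by rw [abs_mul]; gcongr; exact (abs_nonneg _).trans hx)
    have hstep : ∀ a b : ℤ, |a - b| ≤ 1 → |ε * ((a : ℝ) - b)| ≤ ε := by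
      intro a b hab
      rw [abs_mul, abs_of_pos hε]
      have : |(a : ℝ) - b| ≤ 1 := by exact_mod_cast hab
      nlinarith
    have s1 := hstep _ _ (hδ' i hin).1
    have s2 := hstep _ _ (hδ' i hin).2
    have near : ∀ A : ℝ → ℝ → ℝ,
        (∀ x y x' y', |A x y - A x' y'| ≤ K * (|x - x'| + |y - y'|)) →
        |A (ε * (δ i).1) (ε * (δ i).2) - A (γ i).1 (γ i).2| ≤ K * (2 * ε) ∧
        |A (γ (i + 1)).1 (γ (i + 1)).2 - A (γ i).1 (γ i).2| ≤ K * (2 * ε) := by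
      intro A hA
      refine ⟨(hA _ _ _ _).trans ?_, (hA _ _ _ _).trans ?_⟩
      · have a1 := hξ₁ i
        have a2 := hξ₂ i
        rw [abs_sub_comm] at a1 a2
        gcongr; linarith
      · gcongr; linarith
    obtain ⟨n1, n1'⟩ := near A₁ hA₁
    obtain ⟨n2, n2'⟩ := near A₂ hA₂
    have m1 := hmul _ _ _ _ n1 s1
    have m2 := hmul _ _ _ _ n2 s2
    have m3 := hmul _ _ _ _ n1' (hξ₁ (i + 1))
    have m4 := hmul _ _ _ _ n2' (hξ₂ (i + 1))
    simp only [hh, hv, hE, hD]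
    nlinarith
  have hsum := Finset.sum_le_sum hterm
  rw [Finset.sum_add_distrib, Finset.sum_add_distrib, Finset.sum_range_sub, Finset.sum_range_sub,
    Finset.sum_const, Finset.card_range, nsmul_eq_mul,
    show E n = E 0 by simp only [hE, hclosed, hδn], sub_self, add_zero] at hsum
  have hbox : (2 * (M : ℝ) + 1) ^ 2 * (2 * D) ≤ 2 * K * (2 * B + 3 * ε) ^ 2 := by
    have h0 : (0 : ℝ) ≤ M := by exact_mod_cast hM0
    calc _ = 2 * K * (2 * (M * ε) + ε) ^ 2 := by rw [hD]; ring
      _ ≤ _ := by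
        refine mul_le_mul_of_nonneg_left (pow_le_pow_left₀ (by positivity) (by linarith) 2)
          (by positivity)
  rw [abs_le] at hW1 hW2
  push_cast at hW2
  linarith [hW1.1, hW2.1, hW1.2, hW2.2]

/-- If a function `R` along a simple closed plane curve decreases at least as fast as the integral
of a compactly supported Lipschitz one-form, then its total increase is bounded
by a constant that does not depend on the curve. -/
lemma closedCurve_bound (hK : 0 ≤ K) (hB : 0 ≤ B)
    (hA₁ : ∀ x y x' y', |A₁ x y - A₁ x' y'| ≤ K * (|x - x'| + |y - y'|))
    (hA₂ : ∀ x y x' y', |A₂ x y - A₂ x' y'| ≤ K * (|x - x'| + |y - y'|))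
    (hB₁ : ∀ x y, B ≤ |x| ∨ B ≤ |y| → A₁ x y = 0)
    (hB₂ : ∀ x y, B ≤ |x| ∨ B ≤ |y| → A₂ x y = 0) (hT : 0 < T)
    (hζ₁ : ∀ s ∈ Set.Icc 0 T, ∀ t ∈ Set.Icc 0 T, |ζ₁ s - ζ₁ t| ≤ L * |s - t|)
    (hζ₂ : ∀ s ∈ Set.Icc 0 T, ∀ t ∈ Set.Icc 0 T, |ζ₂ s - ζ₂ t| ≤ L * |s - t|)
    (hc₁ : ζ₁ T = ζ₁ 0) (hc₂ : ζ₂ T = ζ₂ 0)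
    (hinj : ∀ s t, 0 ≤ s → s < t → t ≤ T → ζ₁ s = ζ₁ t → ζ₂ s = ζ₂ t → s = 0 ∧ t = T)
    (hR : ∀ s t, 0 ≤ s → s ≤ t → t ≤ T → R t - R s +
      (A₁ (ζ₁ s) (ζ₂ s) * (ζ₁ t - ζ₁ s) + A₂ (ζ₁ s) (ζ₂ s) * (ζ₂ t - ζ₂ s)) ≤ C * (t - s) ^ 2) :
    R T - R 0 ≤ 8 * K * B ^ 2 := by
  wlog hL : 0 < L generalizing L
  · have h1 : L ≤ |L| + 1 := by linarith [le_abs_self L]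
    refine this (L := |L| + 1) (fun s hs t ht => (hζ₁ s hs t ht).trans (by gcongr))
      (fun s hs t ht => (hζ₂ s hs t ht).trans (by gcongr)) (by positivity)
  have key : ∀ κ > 0, R T - R 0 ≤ 8 * K * B ^ 2 + 4 * K * L ^ 2 * T * κ := by
    intro κ hκ
    obtain ⟨η, hη, hret⟩ := exists_forall_near_return (continuousOn_of_abs_sub_le hζ₁)
      (continuousOn_of_abs_sub_le hζ₂) hinj hκ
    have hlim0 : Tendsto (fun n : ℕ => (1 : ℝ) / n) atTop (𝓝 0) :=
      tendsto_one_div_atTop_nhds_zero_nat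
    have hlim : Tendsto (fun n : ℕ => 2 * K * (2 * B + 3 * (L * T * (1 / (n : ℝ)))) ^ 2 +
        C * T ^ 2 * (1 / (n : ℝ)) + 12 * (K * (L * T) ^ 2) * (1 / (n : ℝ)) +
        2 * (K * (L * T) ^ 2) * (2 * κ / T + 1 * (1 / (n : ℝ)))) atTop
        (𝓝 (2 * K * (2 * B + 3 * (L * T * 0)) ^ 2 +
        C * T ^ 2 * 0 + 12 * (K * (L * T) ^ 2) * 0 +
        2 * (K * (L * T) ^ 2) * (2 * κ / T + 1 * 0))) := by
      have := hlim0
      refine Tendsto.add (Tendsto.add (Tendsto.add ?_ (this.const_mul _)) (this.const_mul _))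
        ((tendsto_const_nhds.add (this.const_mul _)).const_mul _)
      exact ((tendsto_const_nhds.add ((this.const_mul _).const_mul _)).pow 2).const_mul _
    rw [show 2 * K * (2 * B + 3 * (L * T * 0)) ^ 2 + C * T ^ 2 * 0 +
        12 * (K * (L * T) ^ 2) * 0 + 2 * (K * (L * T) ^ 2) * (2 * κ / T + 1 * 0) =
        8 * K * B ^ 2 + 4 * K * L ^ 2 * T * κ by field_simp; ring] at hlim
    refine ge_of_tendsto hlim ?_
    have hev : ∀ᶠ n : ℕ in atTop, 4 * (L * T * (1 / (n : ℝ))) < η := by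
      have h2 := (hlim0.const_mul (L * T)).const_mul 4
      rw [mul_zero, mul_zero] at h2
      exact h2.eventually_lt_const hη
    filter_upwards [hev, eventually_ge_atTop 1] with n hn hn1
    have hn0 : (0 : ℝ) < n := by exact_mod_cast hn1
    set τ : ℕ → ℝ := fun i => i * (T / n) with hτ
    have hτ0 : ∀ i, 0 ≤ τ i := fun i => by positivity
    have hτT : ∀ i ≤ n, τ i ≤ T := fun i hi => by
      have : (i : ℝ) ≤ n := by exact_mod_cast hi
      calc τ i ≤ n * (T / n) := by simp only [hτ]; gcongr
        _ = T := by field_simp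
    have hτs : ∀ i, τ (i + 1) - τ i = T / n := fun i => by simp only [hτ]; push_cast; ring
    have hτmono : ∀ i j, i ≤ j → τ i ≤ τ j := fun i j hij => by
      simp only [hτ]; gcongr
    have hτn : τ n = T := by simp only [hτ]; field_simp
    have hτz : τ 0 = 0 := by simp [hτ]
    have hε : 0 < L * T * (1 / (n : ℝ)) := by positivity
    have hlipstep : ∀ ζ : ℝ → ℝ, (∀ s ∈ Set.Icc 0 T, ∀ t ∈ Set.Icc 0 T,
        |ζ s - ζ t| ≤ L * |s - t|) → ∀ i < n, |ζ (τ (i + 1)) - ζ (τ i)| ≤ L * T * (1 / n) := by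
      intro ζ hζ i hi
      have := hζ _ ⟨hτ0 (i + 1), hτT _ hi⟩ _ ⟨hτ0 i, hτT _ hi.le⟩
      rw [hτs, abs_of_pos (show 0 < T / n by positivity)] at this
      refine this.trans (le_of_eq (by ring))
    have hb := closedCurve_discrete_bound hK hB hA₁ hA₂ hB₁ hB₂
      (γ := fun i => (ζ₁ (τ i), ζ₂ (τ i))) (ρ := fun i => R (τ i)) (n := n)
      (k := ⌊2 * n * κ / T⌋₊ + 1) (c := C * (T / n) ^ 2) hε
      (fun i hi => ⟨hlipstep ζ₁ hζ₁ i hi, hlipstep ζ₂ hζ₂ i hi⟩)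
      (by simp only [hτn, hτz, hc₁, hc₂]) (fun i hi => by
        have := hR (τ i) (τ (i + 1)) (hτ0 i) (hτmono _ _ (by omega)) (hτT _ hi)
        rwa [hτs] at this) (by
      intro i j hij hj e1 e2
      have hji : τ (j / 2) - τ (i / 2) = ((j / 2 : ℕ) - (i / 2 : ℕ) : ℝ) * (T / n) := by
        simp only [hτ]; ring
      have hle : i / 2 ≤ j / 2 := Nat.div_le_div_right hij.le
      rcases hret (τ (i / 2)) (τ (j / 2)) (hτ0 _) (hτmono _ _ hle) (hτT _ (by omega))
        (e1.trans_lt hn) (e2.trans_lt hn) with h | h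
      · left
        rw [hji, ← Nat.cast_sub hle] at h
        have h3 : ((2 * (j / 2 - i / 2) : ℕ) : ℝ) ≤ 2 * n * κ / T := by
          rw [le_div_iff₀ hT]
          push_cast
          calc _ = 2 * n * (((j / 2 - i / 2 : ℕ) : ℝ) * (T / n)) := by field_simp
            _ ≤ _ := by gcongr
        have := Nat.le_floor h3
        omega
      · right
        rw [hji, ← Nat.cast_sub hle] at h
        have h3 : ((2 * n - 2 * (j / 2 - i / 2) : ℕ) : ℝ) ≤ 2 * n * κ / T := by
          rw [Nat.cast_sub (by omega), le_div_iff₀ hT]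
          push_cast
          calc _ = 2 * n * (T - (((j / 2 - i / 2 : ℕ) : ℝ) * (T / n))) := by field_simp
            _ ≤ 2 * n * κ := by gcongr; linarith
        have := Nat.le_floor h3
        omega)
    simp only [hτn, hτz] at hb
    refine hb.trans ?_
    have hfl : ((⌊2 * n * κ / T⌋₊ + 1 : ℕ) : ℝ) ≤ 2 * n * κ / T + 1 := by
      push_cast
      gcongr
      exact Nat.floor_le (by positivity)
    have h4 : 2 * (K * (L * T * (1 / (n : ℝ))) ^ 2) * ((⌊2 * n * κ / T⌋₊ + 1 : ℕ) : ℝ) * n ≤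
        2 * (K * (L * T) ^ 2) * (2 * κ / T + 1 * (1 / n)) := by
      calc _ ≤ 2 * (K * (L * T * (1 / (n : ℝ))) ^ 2) * (2 * n * κ / T + 1) * n := by gcongr
        _ = _ := by field_simp
    have h5 : C * (T / n) ^ 2 * n = C * T ^ 2 * (1 / n) := by field_simp
    have h6 : 12 * (K * (L * T * (1 / (n : ℝ))) ^ 2) * n = 12 * (K * (L * T) ^ 2) * (1 / n) := by
      field_simp
    linarith
  have hlim : Tendsto (fun κ : ℝ => 8 * K * B ^ 2 + 4 * K * L ^ 2 * T * κ) (𝓝[>] 0)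
      (𝓝 (8 * K * B ^ 2 + 4 * K * L ^ 2 * T * 0)) :=
    (tendsto_const_nhds.add (tendsto_id.const_mul _)).mono_left nhdsWithin_le_nhds
  rw [mul_zero, add_zero] at hlim
  exact ge_of_tendsto hlim (eventually_mem_nhdsWithin.mono fun κ hκ => key κ hκ)

end ClosedCurve

section PlaneCurve

variable {A₁ A₂ : ℝ → ℝ → ℝ} {K B M b δ : ℝ} {z : ℝ → ℝ × ℝ} {R : ℝ → ℝ}

lemma abs_fst_le_norm (p : ℝ × ℝ) : |p.1| ≤ ‖p‖ := norm_fst_le p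

lemma abs_snd_le_norm (p : ℝ × ℝ) : |p.2| ≤ ‖p‖ := norm_snd_le p

/-- The value of the one-form `A₁ dx + A₂ dy` at `p` on the vector `w`. -/
def planeForm (A₁ A₂ : ℝ → ℝ → ℝ) (p w : ℝ × ℝ) : ℝ := A₁ p.1 p.2 * w.1 + A₂ p.1 p.2 * w.2

lemma planeForm_le (hM : 0 ≤ M) (hM₁ : ∀ x y, |A₁ x y| ≤ M) (hM₂ : ∀ x y, |A₂ x y| ≤ M)
    (p w : ℝ × ℝ) : planeForm A₁ A₂ p w ≤ 2 * M * ‖w‖ := by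
  have h : ∀ x y : ℝ, |x| ≤ M → |y| ≤ ‖w‖ → x * y ≤ M * ‖w‖ := fun x y hx hy =>
    (le_abs_self _).trans (by rw [abs_mul]; gcongr)
  have h1 := h _ _ (hM₁ p.1 p.2) (abs_fst_le_norm w)
  have h2 := h _ _ (hM₂ p.1 p.2) (abs_snd_le_norm w)
  rw [planeForm]; linarith

lemma planeForm_sub_le (hK : 0 ≤ K)
    (hA₁ : ∀ x y x' y', |A₁ x y - A₁ x' y'| ≤ K * (|x - x'| + |y - y'|))
    (hA₂ : ∀ x y x' y', |A₂ x y - A₂ x' y'| ≤ K * (|x - x'| + |y - y'|)) (p q w : ℝ × ℝ) :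
    planeForm A₁ A₂ p w - planeForm A₁ A₂ q w ≤ 4 * K * ‖p - q‖ * ‖w‖ := by
  have h : ∀ x y : ℝ, |x| ≤ K * (|p.1 - q.1| + |p.2 - q.2|) → |y| ≤ ‖w‖ →
      x * y ≤ 2 * K * ‖p - q‖ * ‖w‖ := fun x y hx hy => by
    have e1 := abs_fst_le_norm (p - q)
    have e2 := abs_snd_le_norm (p - q)
    rw [Prod.fst_sub] at e1
    rw [Prod.snd_sub] at e2
    have hx' : |x| ≤ 2 * K * ‖p - q‖ := hx.trans (by nlinarith)
    exact (le_abs_self _).trans (by rw [abs_mul]; gcongr)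
  have h1 := h _ _ (hA₁ p.1 p.2 q.1 q.2) (abs_fst_le_norm w)
  have h2 := h _ _ (hA₂ p.1 p.2 q.1 q.2) (abs_snd_le_norm w)
  simp only [planeForm]; nlinarith

/-- A quadratic error in an infinitesimal inequality disappears after subdivision. -/
lemma sub_le_of_forall_sub_le_quadratic {f : ℝ → ℝ} {a c C δ : ℝ} (hac : a ≤ c)
    (h : ∀ s t, a ≤ s → s ≤ t → t ≤ c → f t - f s ≤ δ * (t - s) + C * (t - s) ^ 2) :
    f c - f a ≤ δ * (c - a) := by
  have key : ∀ n : ℕ, 1 ≤ n →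
      f c - f a ≤ δ * (c - a) + C * (c - a) ^ 2 * (1 / (n : ℝ)) := by
    intro n hn
    have hn0 : (0 : ℝ) < n := by exact_mod_cast hn
    have hca : 0 ≤ c - a := sub_nonneg.2 hac
    have hb : ∀ i : ℕ, i ≤ n → f (a + i * ((c - a) / n)) - f a ≤
        i * (δ * ((c - a) / n) + C * ((c - a) / n) ^ 2) := by
      intro i
      induction i with
      | zero => simp
      | succ i ih =>
        intro hi
        have h1 := ih (by omega)
        have hstep : 0 ≤ (c - a) / n := by positivity
        have hin : ((i + 1 : ℕ) : ℝ) * ((c - a) / n) ≤ c - a := by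
          calc _ ≤ (n : ℝ) * ((c - a) / n) := by gcongr
            _ = _ := by field_simp
        have h2 := h (a + i * ((c - a) / n)) (a + (i + 1 : ℕ) * ((c - a) / n))
          (by linarith [mul_nonneg (Nat.cast_nonneg (α := ℝ) i) hstep])
          (by push_cast; linarith) (by linarith)
        rw [show a + ((i + 1 : ℕ) : ℝ) * ((c - a) / n) - (a + i * ((c - a) / n)) = (c - a) / n by
          push_cast; ring] at h2
        push_cast at h2 ⊢
        linarith
    have h3 := hb n le_rfl
    rw [show a + (n : ℝ) * ((c - a) / n) = c by field_simp; ring] at h3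
    refine h3.trans (le_of_eq ?_)
    field_simp
  have hlim := (tendsto_one_div_atTop_nhds_zero_nat.const_mul (C * (c - a) ^ 2)).const_add
    (δ * (c - a))
  rw [mul_zero, add_zero] at hlim
  exact ge_of_tendsto hlim ((eventually_ge_atTop 1).mono key)

lemma exists_time_mem_box (hδ : 0 < δ)
    (hB₁ : ∀ x y, B ≤ |x| ∨ B ≤ |y| → A₁ x y = 0)
    (hB₂ : ∀ x y, B ≤ |x| ∨ B ≤ |y| → A₂ x y = 0)
    (hR : ∀ t, 0 ≤ t → |R t| ≤ b)
    (hineq : ∀ T, ∃ C, ∀ s t, 0 ≤ s → s ≤ t → t ≤ T →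
      R t - R s + planeForm A₁ A₂ (z s) (z t - z s) ≤ -δ * (t - s) + C * (t - s) ^ 2)
    {t₀ : ℝ} (ht₀ : 0 ≤ t₀) : ∃ t, t₀ ≤ t ∧ |(z t).1| ≤ B ∧ |(z t).2| ≤ B := by
  by_contra hcon
  push Not at hcon
  have hout : ∀ t, t₀ ≤ t → B ≤ |(z t).1| ∨ B ≤ |(z t).2| := fun t ht => by
    by_cases h : |(z t).1| ≤ B
    · exact Or.inr (hcon t ht h).le
    · exact Or.inl (le_of_not_ge h)
  have hb : 0 ≤ b := (abs_nonneg _).trans (hR 0 le_rfl)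
  set c := t₀ + (2 * b + 1) / δ with hc
  have hc' : t₀ ≤ c := by rw [hc]; linarith [show 0 ≤ (2 * b + 1) / δ by positivity]
  obtain ⟨C, hC⟩ := hineq c
  have h1 := sub_le_of_forall_sub_le_quadratic (f := R) (δ := -δ) (C := C) hc'
    (fun s t hs hst htc => by
      have := hC s t (ht₀.trans hs) hst htc
      rwa [planeForm, hB₁ _ _ (hout s hs), hB₂ _ _ (hout s hs), zero_mul, zero_mul, add_zero,
        add_zero] at this)
  have h2 := hR c (ht₀.trans hc')
  have h3 := hR t₀ ht₀
  rw [show -δ * (c - t₀) = -(2 * b + 1) by rw [hc]; field_simp; ring] at h1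
  rw [abs_le] at h2 h3
  linarith

lemma exists_near_return {τ m : ℝ} (hτ : 0 < τ) (hm : 0 < m)
    (hbox : ∀ t₀, 0 ≤ t₀ → ∃ t, t₀ ≤ t ∧ |(z t).1| ≤ B ∧ |(z t).2| ≤ B) :
    ∃ s t, 0 ≤ s ∧ s + τ ≤ t ∧ ‖z t - z s‖ < m := by
  have hex : ∀ t₀ : {t : ℝ // 0 ≤ t}, ∃ t : {t : ℝ // 0 ≤ t}, t₀.1 + τ ≤ t.1 ∧
      |(z t.1).1| ≤ B ∧ |(z t.1).2| ≤ B := by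
    rintro ⟨t₀, h0⟩
    obtain ⟨t, h1, h2⟩ := hbox (t₀ + τ) (by linarith)
    exact ⟨⟨t, by linarith⟩, h1, h2⟩
  choose nxt hnxt using hex
  set σ : ℕ → {t : ℝ // 0 ≤ t} := fun n => nxt^[n + 1] ⟨0, le_rfl⟩ with hσ
  have hsucc : ∀ n, σ (n + 1) = nxt (σ n) := fun n => by
    simp only [hσ]; rw [Function.iterate_succ_apply']
  have hmem : ∀ n, z (σ n).1 ∈ Set.Icc (-B) B ×ˢ Set.Icc (-B) B := by
    intro n
    have : ∃ u, σ n = nxt u :=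
      ⟨nxt^[n] ⟨0, le_rfl⟩, by simp only [hσ]; rw [Function.iterate_succ_apply']⟩
    obtain ⟨u, hu⟩ := this
    rw [hu]
    exact ⟨abs_le.1 (hnxt u).2.1, abs_le.1 (hnxt u).2.2⟩
  have hgap : ∀ i j, i < j → (σ i).1 + τ ≤ (σ j).1 := by
    intro i j hij
    induction j, hij using Nat.le_induction with
    | base => rw [hsucc]; exact (hnxt _).1
    | succ j hj ih => rw [hsucc]; linarith [(hnxt (σ j)).1]
  obtain ⟨p, -, φ, hφ, hlim⟩ := (isCompact_Icc.prod isCompact_Icc).tendsto_subseq hmem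
  obtain ⟨n, hn⟩ := Metric.cauchySeq_iff'.1 hlim.cauchySeq m hm
  have := hn (n + 1) (by omega)
  rw [dist_eq_norm] at this
  exact ⟨_, _, (σ (φ n)).2, hgap _ _ (hφ (by omega)), this⟩

end PlaneCurve

section PlaneCurve

variable {A₁ A₂ : ℝ → ℝ → ℝ} {K B M b δ : ℝ} {z : ℝ → ℝ × ℝ} {R : ℝ → ℝ}

/-- The path `z` on `[0, ℓ]`, closed up by a segment traversed during `[ℓ, ℓ + 1]`. -/
noncomputable def closeUp (z : ℝ → ℝ × ℝ) (ℓ r : ℝ) : ℝ × ℝ :=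
  if r ≤ ℓ then z r else z ℓ + (r - ℓ) • (z 0 - z ℓ)

lemma closeUp_of_ge {ℓ r : ℝ} (h : ℓ ≤ r) : closeUp z ℓ r = z ℓ + (r - ℓ) • (z 0 - z ℓ) := by
  rcases h.eq_or_lt with h | h
  · subst h; simp [closeUp]
  · rw [closeUp, if_neg (not_le.2 h)]

lemma norm_closeUp_sub_le {ℓ L : ℝ} (hL : 0 ≤ L) (hd : ‖z ℓ - z 0‖ ≤ 1)
    (hz : ∀ s t, 0 ≤ s → s ≤ t → t ≤ ℓ → ‖z t - z s‖ ≤ L * (t - s)) {s t : ℝ} (hs : 0 ≤ s)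
    (hst : s ≤ t) : ‖closeUp z ℓ t - closeUp z ℓ s‖ ≤ (L + 1) * (t - s) := by
  have h1 : ∀ s t, 0 ≤ s → s ≤ t → t ≤ ℓ → ‖closeUp z ℓ t - closeUp z ℓ s‖ ≤ L * (t - s) := by
    intro s t hs hst ht
    rw [closeUp, closeUp, if_pos ht, if_pos (hst.trans ht)]
    exact hz s t hs hst ht
  have h2 : ∀ s t, ℓ ≤ s → s ≤ t → ‖closeUp z ℓ t - closeUp z ℓ s‖ ≤ 1 * (t - s) := by
    intro s t hs hst
    rw [closeUp_of_ge hs, closeUp_of_ge (hs.trans hst), add_sub_add_left_eq_sub, ← sub_smul,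
      norm_smul, Real.norm_eq_abs, abs_of_nonneg (by linarith), mul_comm, norm_sub_rev]
    rw [sub_sub_sub_cancel_right]
    gcongr
  rcases le_total t ℓ with ht | ht
  · exact (h1 s t hs hst ht).trans (by nlinarith)
  · rcases le_total s ℓ with hs' | hs'
    · have a1 := h1 s ℓ hs hs' le_rfl
      have a2 := h2 ℓ t le_rfl ht
      have a3 := norm_sub_le_norm_sub_add_norm_sub (closeUp z ℓ t) (closeUp z ℓ ℓ) (closeUp z ℓ s)
      nlinarith
    · exact (h2 s t hs' hst).trans (by nlinarith)

lemma closeUp_injective {ℓ : ℝ} (hz0 : ∀ s t, 0 ≤ s → s < t → t ≤ ℓ → z s ≠ z t)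
    (hmin : ∀ u, 0 < u → u < ℓ → ‖z u - z 0‖ < ‖z ℓ - z 0‖ → ‖z ℓ - z u‖ < ‖z ℓ - z 0‖ → False)
    (hℓ : 0 < ℓ) {s t : ℝ} (hs : 0 ≤ s) (hst : s < t) (ht : t ≤ ℓ + 1)
    (h : closeUp z ℓ s = closeUp z ℓ t) : s = 0 ∧ t = ℓ + 1 := by
  have hne : z ℓ - z 0 ≠ 0 := fun h => hz0 0 ℓ le_rfl hℓ le_rfl (sub_eq_zero.1 h).symm
  have hpos : 0 < ‖z ℓ - z 0‖ := norm_pos_iff.2 hne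
  have hne' : z 0 - z ℓ ≠ 0 := by rw [← neg_sub]; exact neg_ne_zero.2 hne
  rcases le_or_gt t ℓ with htl | htl
  · rw [closeUp, closeUp, if_pos htl, if_pos (hst.le.trans htl)] at h
    exact absurd h (hz0 s t hs hst htl)
  rcases le_or_gt ℓ s with hsl | hsl
  · rw [closeUp_of_ge hsl, closeUp_of_ge htl.le, add_right_inj] at h
    have := smul_left_injective ℝ hne' h
    linarith
  rw [closeUp, if_pos hsl.le, closeUp_of_ge htl.le] at h
  have e1 : z s - z 0 = (1 - (t - ℓ)) • (z ℓ - z 0) := by rw [h]; module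
  have e2 : z ℓ - z s = (t - ℓ) • (z ℓ - z 0) := by rw [h]; module
  rcases ht.eq_or_lt with ht' | ht'
  · rw [ht', show 1 - (ℓ + 1 - ℓ) = (0 : ℝ) by ring, zero_smul, sub_eq_zero] at e1
    rcases hs.eq_or_lt with h0 | h0
    · exact ⟨h0.symm, ht'⟩
    · exact absurd e1.symm (hz0 0 s le_rfl h0 hsl.le)
  · exfalso
    rcases hs.eq_or_lt with h0 | h0
    · rw [← h0, sub_self] at e1
      rcases smul_eq_zero.1 e1.symm with h1 | h1
      · linarith
      · exact hne h1
    · refine hmin s h0 hsl ?_ ?_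
      · rw [e1, norm_smul, Real.norm_eq_abs, abs_of_nonneg (by linarith)]
        nlinarith
      · rw [e2, norm_smul, Real.norm_eq_abs, abs_of_nonneg (by linarith)]
        nlinarith

lemma almostClosed_bound (hK : 0 ≤ K) (hB : 0 ≤ B) (hM : 0 ≤ M)
    (hA₁ : ∀ x y x' y', |A₁ x y - A₁ x' y'| ≤ K * (|x - x'| + |y - y'|))
    (hA₂ : ∀ x y x' y', |A₂ x y - A₂ x' y'| ≤ K * (|x - x'| + |y - y'|))
    (hB₁ : ∀ x y, B ≤ |x| ∨ B ≤ |y| → A₁ x y = 0)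
    (hB₂ : ∀ x y, B ≤ |x| ∨ B ≤ |y| → A₂ x y = 0)
    (hM₁ : ∀ x y, |A₁ x y| ≤ M) (hM₂ : ∀ x y, |A₂ x y| ≤ M)
    {ℓ L C : ℝ} (hℓ : 0 < ℓ) (hL : 0 ≤ L) (hd : ‖z ℓ - z 0‖ ≤ 1)
    (hz : ∀ s t, 0 ≤ s → s ≤ t → t ≤ ℓ → ‖z t - z s‖ ≤ L * (t - s))
    (hz0 : ∀ s t, 0 ≤ s → s < t → t ≤ ℓ → z s ≠ z t)
    (hmin : ∀ u, 0 < u → u < ℓ → ‖z u - z 0‖ < ‖z ℓ - z 0‖ → ‖z ℓ - z u‖ < ‖z ℓ - z 0‖ → False)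
    (hR : ∀ s t, 0 ≤ s → s ≤ t → t ≤ ℓ →
      R t - R s + planeForm A₁ A₂ (z s) (z t - z s) ≤ C * (t - s) ^ 2) :
    R ℓ - R 0 ≤ 8 * K * B ^ 2 + 2 * M := by
  set ζ := closeUp z ℓ with hζ
  set ρ : ℝ → ℝ := fun r => if r ≤ ℓ then R r else R ℓ - 2 * M * (r - ℓ) with hρ
  have hρ' : ∀ r, ℓ ≤ r → ρ r = R ℓ - 2 * M * (r - ℓ) := by
    intro r hr
    rcases hr.eq_or_lt with h | h
    · subst h; simp [hρ]
    · simp only [hρ]; rw [if_neg (not_le.2 h)]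
  have hlip := fun s t (hs : 0 ≤ s) (hst : s ≤ t) => norm_closeUp_sub_le (ℓ := ℓ) hL hd hz hs hst
  have hlip' : ∀ s ∈ Set.Icc 0 (ℓ + 1), ∀ t ∈ Set.Icc 0 (ℓ + 1),
      ‖ζ s - ζ t‖ ≤ (L + 1) * |s - t| := by
    intro s hs t ht
    rcases le_total s t with h | h
    · rw [norm_sub_rev, abs_sub_comm, abs_of_nonneg (by linarith)]
      exact hlip s t hs.1 h
    · rw [abs_of_nonneg (by linarith)]
      exact hlip t s ht.1 h
  have hend : ζ (ℓ + 1) = ζ 0 := by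
    rw [hζ, closeUp_of_ge (by linarith), closeUp, if_pos hℓ.le]
    simp
  have c1 : ∀ s t, 0 ≤ s → s ≤ t → t ≤ ℓ →
      ρ t - ρ s + planeForm A₁ A₂ (ζ s) (ζ t - ζ s) ≤ |C| * (t - s) ^ 2 := by
    intro s t hs hst ht
    simp only [hρ, hζ, closeUp, if_pos ht, if_pos (hst.trans ht)]
    refine (hR s t hs hst ht).trans ?_
    gcongr
    exact le_abs_self C
  have c2 : ∀ s t, ℓ ≤ s → s ≤ t → ρ t - ρ s + planeForm A₁ A₂ (ζ s) (ζ t - ζ s) ≤ 0 := by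
    intro s t hs hst
    have h1 := planeForm_le hM hM₁ hM₂ (ζ s) (ζ t - ζ s)
    have h2 : ‖ζ t - ζ s‖ ≤ t - s := by
      rw [hζ, closeUp_of_ge hs, closeUp_of_ge (hs.trans hst), add_sub_add_left_eq_sub, ← sub_smul,
        norm_smul, Real.norm_eq_abs, abs_of_nonneg (by linarith), norm_sub_rev,
        sub_sub_sub_cancel_right]
      nlinarith
    rw [hρ' s hs, hρ' t (hs.trans hst)]
    nlinarith
  have c3 : ∀ s t, 0 ≤ s → s ≤ t → t ≤ ℓ + 1 → ρ t - ρ s + planeForm A₁ A₂ (ζ s) (ζ t - ζ s) ≤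
      (|C| + 4 * K * (L + 1) ^ 2) * (t - s) ^ 2 := by
    intro s t hs hst _
    have hk : 0 ≤ 4 * K * (L + 1) ^ 2 * (t - s) ^ 2 := by positivity
    have hk' : 0 ≤ |C| * (t - s) ^ 2 := by positivity
    rcases le_total t ℓ with ht | ht
    · linarith [c1 s t hs hst ht]
    · rcases le_total s ℓ with hs' | hs'
      · have a1 := c1 s ℓ hs hs' le_rfl
        have a2 := c2 ℓ t le_rfl ht
        have a3 := planeForm_sub_le hK hA₁ hA₂ (ζ s) (ζ ℓ) (ζ t - ζ ℓ)
        have a4 : planeForm A₁ A₂ (ζ s) (ζ t - ζ s) = planeForm A₁ A₂ (ζ s) (ζ ℓ - ζ s) +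
            planeForm A₁ A₂ (ζ s) (ζ t - ζ ℓ) := by
          simp only [planeForm, Prod.fst_sub, Prod.snd_sub]; ring
        have a5 : ‖ζ s - ζ ℓ‖ ≤ (L + 1) * (t - s) := by
          rw [norm_sub_rev]
          exact (hlip s ℓ hs hs').trans (by gcongr)
        have a6 : ‖ζ t - ζ ℓ‖ ≤ (L + 1) * (t - s) :=
          (hlip ℓ t hℓ.le ht).trans (by gcongr)
        have a7 : |C| * (ℓ - s) ^ 2 ≤ |C| * (t - s) ^ 2 := by
          gcongr
        have a8 : 4 * K * ‖ζ s - ζ ℓ‖ * ‖ζ t - ζ ℓ‖ ≤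
            4 * K * ((L + 1) * (t - s)) * ((L + 1) * (t - s)) := by
          gcongr
        nlinarith
      · linarith [c2 s t hs' hst]
  have hfinal := closedCurve_bound (ζ₁ := fun r => (ζ r).1) (ζ₂ := fun r => (ζ r).2) (R := ρ)
    (T := ℓ + 1) (L := L + 1) (C := |C| + 4 * K * (L + 1) ^ 2) hK hB hA₁ hA₂ hB₁ hB₂ (by linarith)
    (fun s hs t ht => (abs_fst_le_norm (ζ s - ζ t)).trans (hlip' s hs t ht))
    (fun s hs t ht => (abs_snd_le_norm (ζ s - ζ t)).trans (hlip' s hs t ht))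
    (by simp only [hend]) (by simp only [hend])
    (fun s t hs hst ht h1 h2 => closeUp_injective hz0 hmin hℓ hs hst ht (Prod.ext h1 h2))
    (fun s t hs hst ht => c3 s t hs hst ht)
  rw [hρ' (ℓ + 1) (by linarith), show ρ 0 = R 0 by simp only [hρ]; rw [if_pos hℓ.le]] at hfinal
  linarith

lemma exists_minimal_pair {τ m : ℝ} (hz : ∀ T, ContinuousOn z (Set.Icc 0 T))
    (hex : ∃ s t, 0 ≤ s ∧ s + τ ≤ t ∧ ‖z t - z s‖ < m) (hτ : 0 < τ) :
    ∃ s t, 0 ≤ s ∧ s + τ ≤ t ∧ ‖z t - z s‖ < m ∧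
      ∀ s' t', s ≤ s' → t' ≤ t → s' + τ ≤ t' → ‖z t - z s‖ ≤ ‖z t' - z s'‖ := by
  obtain ⟨s₀, T, h0, h1, h2⟩ := hex
  set S : Set (ℝ × ℝ) := (Set.Icc 0 T ×ˢ Set.Icc 0 T) ∩ {p | p.1 + τ ≤ p.2}
  have hS : IsCompact S := (isCompact_Icc.prod isCompact_Icc).inter_right
    (isClosed_le (f := fun p : ℝ × ℝ => p.1 + τ) (g := fun p => p.2) (by fun_prop) (by fun_prop))
  have m1 : Set.MapsTo Prod.fst S (Set.Icc 0 T) := fun p hp => hp.1.1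
  have m2 : Set.MapsTo Prod.snd S (Set.Icc 0 T) := fun p hp => hp.1.2
  have hf : ContinuousOn (fun p : ℝ × ℝ => ‖z p.2 - z p.1‖) S :=
    (((hz T).comp continuousOn_snd m2).sub ((hz T).comp continuousOn_fst m1)).norm
  have hmem : (s₀, T) ∈ S := ⟨⟨⟨h0, by linarith⟩, ⟨by linarith, le_rfl⟩⟩, h1⟩
  obtain ⟨⟨s, t⟩, hst, hmin⟩ := hS.exists_isMinOn ⟨_, hmem⟩ hf
  refine ⟨s, t, hst.1.1.1, hst.2, (hmin hmem).trans_lt h2, fun s' t' hs' ht' hle => ?_⟩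
  have g1 : 0 ≤ s := hst.1.1.1
  have g2 : t ≤ T := hst.1.2.2
  exact hmin (a := (s', t')) ⟨⟨⟨by linarith, by linarith⟩, ⟨by linarith, by linarith⟩⟩, hle⟩

/-- There is no bounded function decreasing faster than the integral of a compactly supported
one-form along a plane curve without returns. -/
theorem plane_no_escape (hK : 0 ≤ K) (hB : 0 ≤ B) (hM : 0 ≤ M) (hδ : 0 < δ)
    (hA₁ : ∀ x y x' y', |A₁ x y - A₁ x' y'| ≤ K * (|x - x'| + |y - y'|))
    (hA₂ : ∀ x y x' y', |A₂ x y - A₂ x' y'| ≤ K * (|x - x'| + |y - y'|))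
    (hB₁ : ∀ x y, B ≤ |x| ∨ B ≤ |y| → A₁ x y = 0)
    (hB₂ : ∀ x y, B ≤ |x| ∨ B ≤ |y| → A₂ x y = 0)
    (hM₁ : ∀ x y, |A₁ x y| ≤ M) (hM₂ : ∀ x y, |A₂ x y| ≤ M)
    (hR : ∀ t, 0 ≤ t → |R t| ≤ b)
    (hz : ∀ T, ∃ L, 0 ≤ L ∧ ∀ s t, 0 ≤ s → s ≤ t → t ≤ T → ‖z t - z s‖ ≤ L * (t - s))
    (hineq : ∀ T, ∃ C, ∀ s t, 0 ≤ s → s ≤ t → t ≤ T →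
      R t - R s + planeForm A₁ A₂ (z s) (z t - z s) ≤ -δ * (t - s) + C * (t - s) ^ 2)
    (hret : ∀ α β : ℝ, 0 < α → α ≤ β → ∃ m > 0, ∀ s h, 0 ≤ s → α ≤ h → h ≤ β →
      m ≤ ‖z (s + h) - z s‖) : False := by
  have hb : 0 ≤ b := (abs_nonneg _).trans (hR 0 le_rfl)
  set τ := (8 * K * B ^ 2 + 2 * M + 2 * b + 1) / (2 * δ) with hτ
  have hτ0 : 0 < τ := by positivity
  obtain ⟨m, hm, hmret⟩ := hret τ (2 * τ) hτ0 (by linarith)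
  have hcont : ∀ T, ContinuousOn z (Set.Icc 0 T) := by
    intro T
    obtain ⟨L, hL, h⟩ := hz T
    have : LipschitzOnWith (Real.toNNReal L) z (Set.Icc 0 T) :=
      LipschitzOnWith.of_dist_le_mul fun x hx y hy => by
        rw [Real.coe_toNNReal L hL, Real.dist_eq, dist_eq_norm]
        rcases le_total x y with hxy | hxy
        · rw [norm_sub_rev, abs_sub_comm, abs_of_nonneg (by linarith)]
          exact h x y hx.1 hxy hy.2
        · rw [abs_of_nonneg (by linarith)]
          exact h y x hy.1 hxy hx.2
    exact this.continuousOn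
  have hne : ∀ s t, 0 ≤ s → s < t → z s ≠ z t := by
    intro s t hs hst h
    obtain ⟨m', hm', h'⟩ := hret (t - s) (t - s) (by linarith) le_rfl
    have := h' s (t - s) hs le_rfl le_rfl
    rw [add_sub_cancel, h, sub_self, norm_zero] at this
    linarith
  obtain ⟨s, t, hs, hst, hlt, hmin⟩ := exists_minimal_pair hcont
    (exists_near_return (m := min m 1) hτ0 (lt_min hm one_pos)
      (fun t₀ ht₀ => exists_time_mem_box hδ hB₁ hB₂ hR hineq ht₀)) hτ0
  have hlong : 2 * τ < t - s := by
    by_contra hcon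
    have := hmret s (t - s) hs (by linarith) (by linarith)
    rw [add_sub_cancel] at this
    linarith [min_le_left m 1]
  obtain ⟨L, hL, hzL⟩ := hz t
  obtain ⟨C, hC⟩ := hineq t
  have hfin := almostClosed_bound (z := fun r => z (s + r)) (R := fun r => R (s + r) + δ * r)
    (ℓ := t - s) (L := L) (C := C) hK hB hM hA₁ hA₂ hB₁ hB₂ hM₁ hM₂ (by linarith) hL
    (by
      simp only [add_sub_cancel, add_zero]
      exact hlt.le.trans (min_le_right _ _))
    (fun a c ha hac hc => by
      refine (hzL (s + a) (s + c) (by linarith) (by linarith) (by linarith)).trans (le_of_eq ?_)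
      ring)
    (fun a c ha hac hc => hne _ _ (by linarith) (by linarith))
    (fun u hu hul h1 h2 => by
      simp only [add_sub_cancel, add_zero] at h1 h2
      by_cases h3 : τ ≤ u
      · linarith [hmin s (s + u) le_rfl (by linarith) (by linarith)]
      · linarith [hmin (s + u) t (by linarith) le_rfl (by linarith)])
    (fun a c ha hac hc => by
      have := hC (s + a) (s + c) (by linarith) (by linarith) (by linarith)
      rw [add_sub_add_left_eq_sub] at this
      linarith)
  simp only [add_sub_cancel, add_zero, mul_zero] at hfin
  have h1 := hR t (by linarith)
  have h2 := hR s hs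
  rw [abs_le] at h1 h2
  have h3 : δ * (2 * τ) ≤ δ * (t - s) := by gcongr
  rw [show δ * (2 * τ) = 8 * K * B ^ 2 + 2 * M + 2 * b + 1 by rw [hτ]; field_simp] at h3
  linarith

end PlaneCurve

section Covector

variable {V : Type*} [NormedAddCommGroup V] [InnerProductSpace ℝ V] [FiniteDimensional ℝ V]

/-- A smooth choice of covectors that are positive on the base point and negative on a finite
family of vector fields along the unit sphere, and radial near a prescribed point. -/
theorem exists_contDiff_covector {ι : Type*} [Finite ι] {F : ι → V → V}
    (hF : ∀ i, Continuous (F i)) {e : V} (he : ‖e‖ = 1) (heF : ∀ i, inner ℝ e (F i e) < 0)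
    (hp : ∀ v : V, v ≠ 0 → ∃ p : V, 0 < inner ℝ p v ∧ ∀ i, inner ℝ p (F i v) < 0) :
    ∃ p : V → V, ContDiff ℝ 2 p ∧
      (∀ v, ‖v‖ = 1 → 0 < inner ℝ (p v) v ∧ ∀ i, inner ℝ (p v) (F i v) < 0) ∧
      ∃ ε > 0, ∀ v, ‖v - e‖ ≤ ε → p v = v := by
  have hev : ∀ (p v : V), 0 < inner ℝ p v → (∀ i, inner ℝ p (F i v) < 0) →
      ∀ᶠ y in 𝓝 v, 0 < inner ℝ p y ∧ ∀ i, inner ℝ p (F i y) < 0 := by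
    intro p v h1 h2
    refine (ContinuousAt.eventually_lt (by fun_prop) (by fun_prop) h1).and ?_
    refine eventually_all.2 fun i => ?_
    have := hF i
    exact ContinuousAt.eventually_lt (by fun_prop) (by fun_prop) (h2 i)
  have hee : ∀ᶠ y in 𝓝 e, 0 < inner ℝ y y ∧ ∀ i, inner ℝ y (F i y) < 0 := by
    refine (ContinuousAt.eventually_lt (by fun_prop) (by fun_prop) ?_).and ?_
    · simp [he]
    · refine eventually_all.2 fun i => ?_
      have := hF i
      exact ContinuousAt.eventually_lt (by fun_prop) (by fun_prop) (heF i)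
  obtain ⟨ε, hε, hball⟩ := Metric.eventually_nhds_iff_ball.1 hee
  let t : V → Set V := fun v => {p | (‖v‖ = 1 → 0 < inner ℝ p v ∧ ∀ i, inner ℝ p (F i v) < 0) ∧
    (‖v - e‖ ≤ ε / 2 → p = v)}
  obtain ⟨g, hg⟩ := exists_contMDiffMap_forall_mem_convex_of_local (n := 2) (t := t)
    (modelWithCornersSelf ℝ V) (M := V) (F := V) (by
      intro v p hpt p' hpt' a b ha hb hab
      refine ⟨fun hv => ?_, fun hv => ?_⟩
      · have hcomb : ∀ {r r' : ℝ}, 0 < r → 0 < r' → 0 < a * r + b * r' := by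
          intro r r' hr hr'
          rcases ha.lt_or_eq with h | h
          · have := mul_pos h hr
            have := mul_nonneg hb hr'.le
            linarith
          · have hb1 : b = 1 := by linarith
            simp [← h, hb1, hr']
        simp only [inner_add_left, real_inner_smul_left]
        refine ⟨hcomb (hpt.1 hv).1 (hpt'.1 hv).1, fun i => ?_⟩
        have := hcomb (neg_pos.2 ((hpt.1 hv).2 i)) (neg_pos.2 ((hpt'.1 hv).2 i))
        linarith
      · rw [hpt.2 hv, hpt'.2 hv, ← add_smul, hab, one_smul]) (by
      intro v
      by_cases hv : ‖v‖ = 1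
      · by_cases hve : ‖v - e‖ < ε
        · refine ⟨Metric.ball e ε, Metric.isOpen_ball.mem_nhds (by simpa [dist_eq_norm] using hve),
            id, contMDiffOn_id, fun y hy => ⟨fun _ => hball y hy, fun _ => rfl⟩⟩
        · obtain ⟨p, h1, h2⟩ := hp v (by rintro rfl; simp at hv)
          have h3 : ∀ᶠ y in 𝓝 v, ε / 2 < ‖y - e‖ :=
            ContinuousAt.eventually_lt (by fun_prop) (by fun_prop) (by linarith)
          refine ⟨_, (hev p v h1 h2).and h3, fun _ => p, contMDiffOn_const, fun y hy =>
            ⟨fun _ => hy.1, fun h => absurd h (not_le.2 hy.2)⟩⟩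
      · have h3 : ∀ᶠ y in 𝓝 v, ‖y‖ ≠ 1 := by
          have : ContinuousAt (fun y : V => ‖y‖) v := by fun_prop
          exact this.eventually_ne hv
        exact ⟨_, h3, id, contMDiffOn_id, fun y hy => ⟨fun h => absurd h hy, fun _ => rfl⟩⟩)
  exact ⟨g, contMDiff_iff_contDiff.1 g.contMDiff, fun v hv => (hg v).1 hv, ε / 2, by positivity,
    fun v hv => (hg v).2 hv⟩

end Covector

section Taylor

variable {E F : Type*} [NormedAddCommGroup E] [NormedSpace ℝ E]
  [NormedAddCommGroup F] [NormedSpace ℝ F]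

theorem ContDiff.exists_norm_sub_sub_fderiv_le {G : E → F} (hG : ContDiff ℝ 2 G) {s : Set E}
    (hs : IsCompact s) (hc : Convex ℝ s) :
    ∃ C, 0 ≤ C ∧ ∀ x ∈ s, ∀ y ∈ s, ‖G y - G x - fderiv ℝ G x (y - x)‖ ≤ C * ‖y - x‖ ^ 2 := by
  have hG1 : ContDiff ℝ 1 (fderiv ℝ G) := hG.fderiv_right (by norm_num)
  obtain ⟨C, hC⟩ := hs.exists_bound_of_continuousOn (f := fun x => fderiv ℝ (fderiv ℝ G) x)
    (hG1.continuous_fderiv (by norm_num)).continuousOn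
  refine ⟨max C 0, le_max_right _ _, fun x hx y hy => ?_⟩
  have hlip : ∀ w ∈ segment ℝ x y, ‖fderiv ℝ G w - fderiv ℝ G x‖ ≤ max C 0 * ‖y - x‖ := by
    intro w hw
    have h1 := hc.norm_image_sub_le_of_norm_fderiv_le (𝕜 := ℝ) (f := fderiv ℝ G)
      (fun x _ => (hG1.differentiable (by norm_num)).differentiableAt)
      (fun x hx => (hC x hx).trans (le_max_left _ 0)) hx (hc.segment_subset hx hy hw)
    refine h1.trans (mul_le_mul_of_nonneg_left ?_ (le_max_right _ _))
    obtain ⟨a, b, ha, hb, hab, rfl⟩ := hw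
    have : a • x + b • y - x = b • (y - x) := by
      rw [show a = 1 - b by linarith]; module
    rw [this, norm_smul, Real.norm_eq_abs, abs_of_nonneg hb]
    exact mul_le_of_le_one_left (norm_nonneg _) (by linarith)
  have := (convex_segment x y).norm_image_sub_le_of_norm_fderiv_le' (𝕜 := ℝ) (f := G)
    (fun x _ => (hG.differentiable (by norm_num)).differentiableAt) hlip
    (left_mem_segment ℝ x y) (right_mem_segment ℝ x y)
  rwa [mul_assoc, ← sq] at this

end Taylor

section Stereographic

/-- Inverse stereographic projection from the north pole, as a map on the coordinate plane. -/
noncomputable def invStereo (z : ℝ × ℝ) : EuclideanSpace ℝ (Fin 3) :=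
  !₂[2 * z.1 / (1 + z.1 ^ 2 + z.2 ^ 2), 2 * z.2 / (1 + z.1 ^ 2 + z.2 ^ 2),
    (z.1 ^ 2 + z.2 ^ 2 - 1) / (1 + z.1 ^ 2 + z.2 ^ 2)]

/-- Stereographic projection from the north pole of the direction of a vector. -/
noncomputable def stereoDir (x : EuclideanSpace ℝ (Fin 3)) : ℝ × ℝ :=
  (x 0 / (‖x‖ - x 2), x 1 / (‖x‖ - x 2))

lemma one_add_sq_add_sq_pos (a b : ℝ) : 0 < 1 + a ^ 2 + b ^ 2 := by positivity

lemma contDiff_invStereo {n : WithTop ℕ∞} : ContDiff ℝ n invStereo := by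
  have hne : ∀ z : ℝ × ℝ, 1 + z.1 ^ 2 + z.2 ^ 2 ≠ 0 := fun z => (one_add_sq_add_sq_pos _ _).ne'
  rw [contDiff_euclidean]
  intro i
  fin_cases i
  · simp only [invStereo, Fin.zero_eta, PiLp.toLp_apply, Matrix.cons_val_zero]
    exact ContDiff.div (by fun_prop) (by fun_prop) hne
  · simp only [invStereo, Fin.mk_one, PiLp.toLp_apply, Matrix.cons_val_one]
    exact ContDiff.div (by fun_prop) (by fun_prop) hne
  · simp only [invStereo, Fin.reduceFinMk, PiLp.toLp_apply, Matrix.cons_val]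
    exact ContDiff.div (by fun_prop) (by fun_prop) hne

lemma norm_sq_fin_three (x : EuclideanSpace ℝ (Fin 3)) :
    ‖x‖ ^ 2 = x 0 ^ 2 + x 1 ^ 2 + x 2 ^ 2 := by
  simp [EuclideanSpace.norm_sq_eq, Fin.sum_univ_three]

lemma norm_invStereo (z : ℝ × ℝ) : ‖invStereo z‖ = 1 := by
  have h : ‖invStereo z‖ ^ 2 = 1 := by
    rw [norm_sq_fin_three]
    have := (one_add_sq_add_sq_pos z.1 z.2).ne'
    simp [invStereo]
    field_simp
    ring
  have := norm_nonneg (invStereo z)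
  nlinarith

lemma norm_invStereo_sub_le (z z' : ℝ × ℝ) :
    ‖invStereo z - invStereo z'‖ ≤ 4 * ‖z - z'‖ := by
  have h1 := one_add_sq_add_sq_pos z.1 z.2
  have h2 := one_add_sq_add_sq_pos z'.1 z'.2
  have h : ‖invStereo z - invStereo z'‖ ^ 2 = 4 * ((z.1 - z'.1) ^ 2 + (z.2 - z'.2) ^ 2) /
      ((1 + z.1 ^ 2 + z.2 ^ 2) * (1 + z'.1 ^ 2 + z'.2 ^ 2)) := by
    rw [norm_sq_fin_three]
    simp [invStereo]
    field_simp
    ring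
  have h3 : ‖invStereo z - invStereo z'‖ ^ 2 ≤ 4 * ((z.1 - z'.1) ^ 2 + (z.2 - z'.2) ^ 2) := by
    rw [h]
    refine div_le_self (by positivity) ?_
    nlinarith [sq_nonneg z.1, sq_nonneg z.2, sq_nonneg z'.1, sq_nonneg z'.2]
  have h4 : |z.1 - z'.1| ≤ ‖z - z'‖ := abs_fst_le_norm (z - z')
  have h5 : |z.2 - z'.2| ≤ ‖z - z'‖ := abs_snd_le_norm (z - z')
  have h6 := sq_le_sq' (by linarith [abs_nonneg (z.1 - z'.1), norm_nonneg (z - z')]) h4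
  have h7 := sq_le_sq' (by linarith [abs_nonneg (z.2 - z'.2), norm_nonneg (z - z')]) h5
  rw [sq_abs] at h6 h7
  exact abs_le_of_sq_le_sq' (by nlinarith [norm_nonneg (z - z')])
    (by positivity) |>.2

lemma norm_invStereo_sub_north_le (z : ℝ × ℝ) {B : ℝ} (hB : 0 < B)
    (hz : B ≤ |z.1| ∨ B ≤ |z.2|) :
    ‖invStereo z - EuclideanSpace.single 2 1‖ ≤ 2 / B := by
  have h1 := one_add_sq_add_sq_pos z.1 z.2
  have h : ‖invStereo z - EuclideanSpace.single 2 1‖ ^ 2 = 4 / (1 + z.1 ^ 2 + z.2 ^ 2) := by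
    rw [norm_sq_fin_three]
    simp [invStereo]
    field_simp
    ring
  refine abs_le_of_sq_le_sq' ?_ (by positivity) |>.2
  rw [h, div_pow]
  norm_num
  refine div_le_div_of_nonneg_left (by norm_num) (by positivity) ?_
  rcases hz with hz | hz <;>
    nlinarith [sq_abs z.1, sq_abs z.2, sq_nonneg z.1, sq_nonneg z.2]

lemma apply_two_lt_norm {x : EuclideanSpace ℝ (Fin 3)}
    (hx : ∀ l : ℝ, 0 ≤ l → x ≠ l • EuclideanSpace.single 2 1) : x 2 < ‖x‖ := by
  by_contra! h
  have h1 := norm_sq_fin_three x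
  have h2 : ‖x‖ ^ 2 ≤ x 2 ^ 2 := pow_le_pow_left₀ (norm_nonneg _) h 2
  have h3 : x 0 = 0 := by nlinarith [sq_nonneg (x 0), sq_nonneg (x 1)]
  have h4 : x 1 = 0 := by nlinarith [sq_nonneg (x 0), sq_nonneg (x 1)]
  refine hx (x 2) ((norm_nonneg _).trans h) ?_
  ext i
  fin_cases i <;> simp [h3, h4]

lemma norm_smul_invStereo_stereoDir {x : EuclideanSpace ℝ (Fin 3)} (hx : x 2 < ‖x‖) :
    ‖x‖ • invStereo (stereoDir x) = x := by
  have h1 := norm_sq_fin_three x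
  have h2 : ‖x‖ - x 2 ≠ 0 := by linarith
  have hn : ‖x‖ ≠ 0 := by
    intro h
    rw [norm_eq_zero] at h
    simp [h] at hx
  have h3 : 1 + (x 0 / (‖x‖ - x 2)) ^ 2 + (x 1 / (‖x‖ - x 2)) ^ 2 = 2 * ‖x‖ / (‖x‖ - x 2) := by
    field_simp
    linarith
  have h4 : (x 0 / (‖x‖ - x 2)) ^ 2 + (x 1 / (‖x‖ - x 2)) ^ 2 - 1 = 2 * x 2 / (‖x‖ - x 2) := by
    field_simp
    linarith
  ext i
  fin_cases i
  · simp only [invStereo, stereoDir, h3]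
    simp
    field_simp
  · simp only [invStereo, stereoDir, h3]
    simp
    field_simp
  · simp only [invStereo, stereoDir, h3, h4]
    simp
    field_simp

lemma inner_invStereo_fderiv (z w : ℝ × ℝ) :
    inner ℝ (invStereo z) (fderiv ℝ invStereo z w) = 0 := by
  have hd : DifferentiableAt ℝ invStereo z :=
    (contDiff_invStereo (n := 1)).differentiable (by norm_num) z
  have h1 := fderiv_inner_apply ℝ hd hd w
  have h2 : (fun t => inner ℝ (invStereo t) (invStereo t)) = fun _ => (1 : ℝ) := by
    ext t
    rw [real_inner_self_eq_norm_sq, norm_invStereo, one_pow]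
  rw [h2] at h1
  simp only [fderiv_fun_const, Pi.zero_apply, _root_.zero_apply] at h1
  rw [real_inner_comm (invStereo z)] at h1
  linarith

/-- A path that stays off a ray has, on bounded time intervals, Lipschitz stereographic image. -/
lemma exists_norm_stereoDir_sub_le {x : ℝ → EuclideanSpace ℝ (Fin 3)} {L b : ℝ} (hL : 0 ≤ L)
    (hxL : ∀ s t, 0 ≤ s → s ≤ t → ‖x t - x s‖ ≤ L * (t - s))
    (hxb : ∀ t, 0 ≤ t → ‖x t‖ ≤ b) (hx : ∀ t, 0 ≤ t → x t 2 < ‖x t‖) (T : ℝ) :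
    ∃ L', 0 ≤ L' ∧ ∀ s t, 0 ≤ s → s ≤ t → t ≤ T →
      ‖stereoDir (x t) - stereoDir (x s)‖ ≤ L' * (t - s) := by
  have hcoord : ∀ (v : EuclideanSpace ℝ (Fin 3)) i, |v i| ≤ ‖v‖ := fun v i => by
    simpa using EuclideanSpace.norm_eq v ▸ PiLp.norm_apply_le v i
  have hcont : ContinuousOn x (Set.Icc 0 T) := by
    refine LipschitzOnWith.continuousOn (K := ⟨L, hL⟩) (LipschitzOnWith.of_dist_le_mul ?_)
    intro s hs t ht
    rw [dist_eq_norm, dist_eq_norm, Real.norm_eq_abs]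
    rcases le_total s t with h | h
    · rw [norm_sub_rev, abs_sub_comm, abs_of_nonneg (by linarith)]
      exact hxL s t hs.1 h
    · rw [abs_of_nonneg (by linarith)]
      exact hxL t s ht.1 h
  obtain ⟨η, hη, hη'⟩ : ∃ η > 0, ∀ t ∈ Set.Icc 0 T, η ≤ ‖x t‖ - x t 2 :=
    isCompact_Icc.exists_forall_le' (by fun_prop) fun t ht => by linarith [hx t ht.1]
  have hb : 0 ≤ b := (norm_nonneg _).trans (hxb 0 le_rfl)
  have key : ∀ s t, 0 ≤ s → s ≤ t → t ≤ T → ∀ i,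
      |x t i / (‖x t‖ - x t 2) - x s i / (‖x s‖ - x s 2)| ≤ 4 * b * L / η ^ 2 * (t - s) := by
    intro s t hs hst ht i
    have d1 := hη' s ⟨hs, hst.trans ht⟩
    have d2 := hη' t ⟨hs.trans hst, ht⟩
    have p1 : 0 < ‖x s‖ - x s 2 := by linarith
    have p2 : 0 < ‖x t‖ - x t 2 := by linarith
    have hD := hxL s t hs hst
    have hLt : 0 ≤ L * (t - s) := (norm_nonneg _).trans hD
    have e1 : |x t i - x s i| ≤ L * (t - s) := (hcoord (x t - x s) i).trans hD
    have e2 : |x t 2 - x s 2| ≤ L * (t - s) := (hcoord (x t - x s) 2).trans hD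
    have e3 : |‖x t‖ - ‖x s‖| ≤ L * (t - s) := (abs_norm_sub_norm_le _ _).trans hD
    have e4 : |x s i| ≤ b := (hcoord _ i).trans (hxb s hs)
    have e5 : |‖x s‖ - x s 2| ≤ 2 * b := by
      have := (hcoord (x s) 2).trans (hxb s hs)
      have := hxb s hs
      rw [abs_le] at *
      constructor <;> linarith [norm_nonneg (x s)]
    rw [div_sub_div _ _ p2.ne' p1.ne', abs_div, abs_of_pos (mul_pos p2 p1),
      div_le_iff₀ (by positivity)]
    have hnum : x t i * (‖x s‖ - x s 2) - (‖x t‖ - x t 2) * x s i =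
      (x t i - x s i) * (‖x s‖ - x s 2) - ((‖x t‖ - ‖x s‖) - (x t 2 - x s 2)) * x s i := by ring
    have h1 : |x t i * (‖x s‖ - x s 2) - (‖x t‖ - x t 2) * x s i| ≤ 4 * b * (L * (t - s)) := by
      rw [hnum]
      refine (abs_sub _ _).trans ?_
      rw [abs_mul, abs_mul]
      have := mul_le_mul e1 e5 (abs_nonneg _) hLt
      have := mul_le_mul ((abs_sub (‖x t‖ - ‖x s‖) (x t 2 - x s 2)).trans (add_le_add e3 e2)) e4
        (abs_nonneg _) (by linarith)
      linarith
    refine h1.trans ?_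
    have h2 : η ^ 2 ≤ (‖x t‖ - x t 2) * (‖x s‖ - x s 2) := by
      rw [sq]; exact mul_le_mul d2 d1 hη.le p2.le
    calc 4 * b * (L * (t - s)) = 4 * b * L / η ^ 2 * (t - s) * η ^ 2 := by field_simp
      _ ≤ _ := mul_le_mul_of_nonneg_left h2 (by
        have : 0 ≤ t - s := by linarith
        positivity)
  refine ⟨4 * b * L / η ^ 2, by positivity, fun s t hs hst ht => ?_⟩
  rw [Prod.norm_def]
  exact max_le (key s t hs hst ht 0) (key s t hs hst ht 1)

end Stereographic

section Space

/-- The coefficient at `z`, in the direction `v`, of the one-form on the plane induced by a field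
of covectors along the sphere. -/
noncomputable def stereoCoeff (p : EuclideanSpace ℝ (Fin 3) → EuclideanSpace ℝ (Fin 3))
    (v z : ℝ × ℝ) : ℝ :=
  inner ℝ (p (invStereo z)) (fderiv ℝ invStereo z v) / inner ℝ (p (invStereo z)) (invStereo z)

variable {p : EuclideanSpace ℝ (Fin 3) → EuclideanSpace ℝ (Fin 3)}

lemma exists_stereoCoeff_bounds (hp : ContDiff ℝ 2 p)
    (hpos : ∀ v, ‖v‖ = 1 → 0 < inner ℝ (p v) v) {B : ℝ}
    (hB : ∀ z : ℝ × ℝ, B ≤ |z.1| ∨ B ≤ |z.2| → p (invStereo z) = invStereo z) (v : ℝ × ℝ) :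
    (∀ z : ℝ × ℝ, B ≤ |z.1| ∨ B ≤ |z.2| → stereoCoeff p v z = 0) ∧
    (∃ M, 0 ≤ M ∧ ∀ z, |stereoCoeff p v z| ≤ M) ∧
    ∃ K, 0 ≤ K ∧ ∀ x y x' y', |stereoCoeff p v (x, y) - stereoCoeff p v (x', y')| ≤
      K * (|x - x'| + |y - y'|) := by
  have hzero : ∀ z : ℝ × ℝ, B ≤ |z.1| ∨ B ≤ |z.2| → stereoCoeff p v z = 0 := by
    intro z hz
    rw [stereoCoeff, hB z hz, inner_invStereo_fderiv, zero_div]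
  have hsmooth : ContDiff ℝ 1 (stereoCoeff p v) := by
    have h1 : ContDiff ℝ 1 fun z => p (invStereo z) :=
      (hp.of_le (by norm_num)).comp contDiff_invStereo
    have h2 : ContDiff ℝ 1 (fderiv ℝ invStereo) :=
      (contDiff_invStereo (n := 2)).fderiv_right (by norm_num)
    exact (h1.inner ℝ (h2.clm_apply contDiff_const)).div (h1.inner ℝ contDiff_invStereo)
      fun z => (hpos _ (norm_invStereo z)).ne'
  have hsupp : HasCompactSupport (stereoCoeff p v) := by
    refine HasCompactSupport.intro (isCompact_closedBall (0 : ℝ × ℝ) B) fun z hz => hzero z ?_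
    by_contra! h
    refine hz ?_
    rw [mem_closedBall_zero_iff, Prod.norm_def]
    exact max_le h.1.le h.2.le
  refine ⟨hzero, ?_, ?_⟩
  · obtain ⟨M, hM⟩ := hsupp.exists_bound_of_continuous hsmooth.continuous
    exact ⟨M, (norm_nonneg _).trans (hM 0), hM⟩
  · obtain ⟨K, hK⟩ := hsmooth.lipschitzWith_of_hasCompactSupport hsupp (by norm_num)
    refine ⟨K, K.2, fun x y x' y' => ?_⟩
    have := hK.dist_le_mul (x, y) (x', y')
    rw [Real.dist_eq] at this
    refine this.trans (mul_le_mul_of_nonneg_left ?_ K.2)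
    rw [Prod.dist_eq, Real.dist_eq, Real.dist_eq]
    exact max_le_add_of_nonneg (abs_nonneg _) (abs_nonneg _)

/-- Logarithmic polar coordinates, with the direction given by stereographic projection. -/
noncomputable def polarStereo (y : ℝ × (ℝ × ℝ)) : EuclideanSpace ℝ (Fin 3) :=
  Real.exp y.1 • invStereo y.2

lemma contDiff_polarStereo : ContDiff ℝ 2 polarStereo :=
  (Real.contDiff_exp.comp contDiff_fst).smul (contDiff_invStereo.comp contDiff_snd)

lemma fderiv_polarStereo (y w : ℝ × (ℝ × ℝ)) : fderiv ℝ polarStereo y w =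
    Real.exp y.1 • (w.1 • invStereo y.2 + fderiv ℝ invStereo y.2 w.2) := by
  have hd : DifferentiableAt ℝ invStereo y.2 :=
    (contDiff_invStereo (n := 1)).differentiable (by norm_num) y.2
  have h1 := ((Real.hasDerivAt_exp y.1).hasFDerivAt.comp y hasFDerivAt_fst).smul
    (hd.hasFDerivAt.comp y hasFDerivAt_snd)
  have h2 : fderiv ℝ polarStereo y = _ := h1.fderiv
  rw [h2]
  simp [smul_smul]
  rw [add_comm, mul_comm]

lemma inner_fderiv_polarStereo (y w : ℝ × (ℝ × ℝ))
    (hy : inner ℝ (p (invStereo y.2)) (invStereo y.2) ≠ 0) :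
    inner ℝ (p (invStereo y.2)) (fderiv ℝ polarStereo y w) =
      Real.exp y.1 * inner ℝ (p (invStereo y.2)) (invStereo y.2) *
      (w.1 + planeForm (fun a b => stereoCoeff p (1, 0) (a, b))
        (fun a b => stereoCoeff p (0, 1) (a, b)) y.2 w.2) := by
  have h : fderiv ℝ invStereo y.2 w.2 =
      w.2.1 • fderiv ℝ invStereo y.2 (1, 0) + w.2.2 • fderiv ℝ invStereo y.2 (0, 1) := by
    rw [← map_smul, ← map_smul, ← map_add]
    simp
  rw [fderiv_polarStereo, h]
  simp only [planeForm, stereoCoeff, Prod.mk.eta, inner_smul_right, inner_add_right]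
  field_simp

lemma abs_log_norm_sub_le {V : Type*} [NormedAddCommGroup V] {v w : V} {a : ℝ} (ha : 0 < a)
    (hv : a ≤ ‖v‖) (hw : a ≤ ‖w‖) : |Real.log ‖v‖ - Real.log ‖w‖| ≤ ‖v - w‖ / a := by
  have key : ∀ {v w : V}, a ≤ ‖v‖ → a ≤ ‖w‖ → Real.log ‖v‖ - Real.log ‖w‖ ≤ ‖v - w‖ / a := by
    intro v w hv hw
    have hv' := ha.trans_le hv
    have hw' := ha.trans_le hw
    rw [← Real.log_div hv'.ne' hw'.ne']
    refine (Real.log_le_sub_one_of_pos (by positivity)).trans ?_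
    rw [div_sub_one hw'.ne']
    have h1 := norm_sub_norm_le v w
    exact (div_le_div_of_nonneg_right h1 hw'.le).trans
      (div_le_div_of_nonneg_left (norm_nonneg _) ha hw)
  rw [abs_le]
  have := key hw hv
  rw [norm_sub_rev] at this
  exact ⟨by linarith, key hv hw⟩

theorem space_no_escape {N : ℕ}
    {F : Fin N → EuclideanSpace ℝ (Fin 3) → EuclideanSpace ℝ (Fin 3)}
    {x : ℝ → EuclideanSpace ℝ (Fin 3)} {a b L C : ℝ}
    (hF : ∀ i, Continuous (F i)) (hhom : ∀ i (c : ℝ), 0 ≤ c → ∀ v, F i (c • v) = c • F i v)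
    (hp : ∀ v, v ≠ 0 → ∃ p, 0 < inner ℝ p v ∧ ∀ i, inner ℝ p (F i v) < 0)
    (he : ∀ i, F i (EuclideanSpace.single 2 1) 2 < 0)
    (ha : 0 < a) (hL : 0 ≤ L) (hC : 0 ≤ C) (hxa : ∀ t, 0 ≤ t → a ≤ ‖x t‖)
    (hxb : ∀ t, 0 ≤ t → ‖x t‖ ≤ b) (hxL : ∀ s t, 0 ≤ s → s ≤ t → ‖x t - x s‖ ≤ L * (t - s))
    (hincr : ∀ s t, 0 ≤ s → s ≤ t → ∀ p, ∃ i,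
      inner ℝ p (x t - x s) ≤ (t - s) * inner ℝ p (F i (x s)) + C * ‖p‖ * (t - s) ^ 2)
    (hray : ∀ t, 0 ≤ t → ∀ l : ℝ, 0 ≤ l → x t ≠ l • EuclideanSpace.single 2 1)
    (hret : ∀ α β, 0 < α → α ≤ β → ∃ m > 0, ∀ s h, 0 ≤ s → α ≤ h → h ≤ β → ∀ l : ℝ, 0 ≤ l →
      m ≤ ‖x (s + h) - l • x s‖) : False := by
  have hb : 0 < b := ha.trans_le ((hxa 0 le_rfl).trans (hxb 0 le_rfl))
  obtain ⟨p, hp2, hpF, ε, hε, hpe⟩ := exists_contDiff_covector hF (e := EuclideanSpace.single 2 1)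
    (by simp) (fun i => by simpa [EuclideanSpace.inner_single_left] using he i) hp
  have hpos : ∀ v, ‖v‖ = 1 → 0 < inner ℝ (p v) v := fun v hv => (hpF v hv).1
  have hpc : Continuous p := hp2.continuous
  have hsph := isCompact_sphere (0 : EuclideanSpace ℝ (Fin 3)) 1
  obtain ⟨η, hη, hη'⟩ : ∃ η > 0, ∀ v ∈ Metric.sphere (0 : EuclideanSpace ℝ (Fin 3)) 1,
      η ≤ inner ℝ (p v) v :=
    hsph.exists_forall_le' (by fun_prop) fun v hv => hpos v (by simpa using hv)
  obtain ⟨Mp, hMp⟩ := hsph.exists_bound_of_continuousOn hpc.continuousOn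
  obtain ⟨δ, hδ, hδ'⟩ : ∃ δ > 0, ∀ i, ∀ v, ‖v‖ = 1 →
      inner ℝ (p v) (F i v) / inner ℝ (p v) v ≤ -δ := by
    have hi : ∀ i, ∃ δ > 0, ∀ v ∈ Metric.sphere (0 : EuclideanSpace ℝ (Fin 3)) 1,
        δ ≤ - (inner ℝ (p v) (F i v) / inner ℝ (p v) v) := by
      intro i
      have := hF i
      refine hsph.exists_forall_le' (ContinuousOn.neg (ContinuousOn.div (by fun_prop)
        (by fun_prop) fun v hv => (hpos v (by simpa using hv)).ne')) fun v hv => ?_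
      have := hpF v (by simpa using hv)
      rw [← neg_div]
      exact div_pos (neg_pos.2 (this.2 i)) this.1
    choose D hD hD' using hi
    have hev : ∀ᶠ δ in 𝓝[>] (0 : ℝ), (∀ i, δ ≤ D i) ∧ 0 < δ :=
      (eventually_all.2 fun i => mem_nhdsWithin_of_mem_nhds (Iic_mem_nhds (hD i))).and
        self_mem_nhdsWithin
    obtain ⟨δ, h1, h2⟩ := hev.exists
    exact ⟨δ, h2, fun i v hv => by linarith [hD' i v (by simpa using hv), h1 i]⟩
  have hx2 : ∀ t, 0 ≤ t → x t 2 < ‖x t‖ := fun t ht => apply_two_lt_norm (hray t ht)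
  set z : ℝ → ℝ × ℝ := fun t => stereoDir (x t)
  set R : ℝ → ℝ := fun t => Real.log ‖x t‖
  have hxn : ∀ t, 0 ≤ t → 0 < ‖x t‖ := fun t ht => ha.trans_le (hxa t ht)
  have hpolar : ∀ t, 0 ≤ t → polarStereo (R t, z t) = x t := fun t ht => by
    rw [polarStereo, Real.exp_log (hxn t ht)]
    exact norm_smul_invStereo_stereoDir (hx2 t ht)
  have hdir : ∀ t, 0 ≤ t → ‖x t‖ • invStereo (z t) = x t := fun t ht =>
    norm_smul_invStereo_stereoDir (hx2 t ht)
  have hzL := exists_norm_stereoDir_sub_le hL hxL hxb hx2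
  have hRL : ∀ s t, 0 ≤ s → s ≤ t → |R t - R s| ≤ L / a * (t - s) := fun s t hs hst => by
    refine (abs_log_norm_sub_le ha (hxa t (hs.trans hst)) (hxa s hs)).trans ?_
    rw [div_mul_eq_mul_div]
    exact div_le_div_of_nonneg_right (hxL s t hs hst) ha.le
  have hRb : ∀ t, 0 ≤ t → |R t| ≤ |Real.log a| + |Real.log b| := fun t ht => by
    have h1 := Real.log_le_log ha (hxa t ht)
    have h2 := Real.log_le_log (hxn t ht) (hxb t ht)
    rw [abs_le]
    constructor <;> linarith [neg_abs_le (Real.log a), le_abs_self (Real.log b),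
      abs_nonneg (Real.log a), abs_nonneg (Real.log b)]
  have hB : ∀ z : ℝ × ℝ, 2 / ε ≤ |z.1| ∨ 2 / ε ≤ |z.2| → p (invStereo z) = invStereo z :=
    fun z hz => hpe _ ((norm_invStereo_sub_north_le z (by positivity) hz).trans
      (by rw [div_div_eq_mul_div, mul_div_cancel_left₀ _ two_ne_zero]))
  obtain ⟨hZ₁, ⟨M₁, hM₁, hM₁'⟩, K₁, hK₁, hK₁'⟩ := exists_stereoCoeff_bounds hp2 hpos hB (1, 0)
  obtain ⟨hZ₂, ⟨M₂, hM₂, hM₂'⟩, K₂, hK₂, hK₂'⟩ := exists_stereoCoeff_bounds hp2 hpos hB (0, 1)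
  refine plane_no_escape (A₁ := fun a b => stereoCoeff p (1, 0) (a, b))
    (A₂ := fun a b => stereoCoeff p (0, 1) (a, b)) (K := K₁ + K₂) (B := 2 / ε) (M := M₁ + M₂)
    (δ := δ) (z := z) (R := R) (by positivity) (by positivity) (by positivity) hδ
    (fun x y x' y' => (hK₁' x y x' y').trans (by gcongr; linarith))
    (fun x y x' y' => (hK₂' x y x' y').trans (by gcongr; linarith))
    (fun x y h => hZ₁ (x, y) h) (fun x y h => hZ₂ (x, y) h)
    (fun x y => (hM₁' _).trans (by linarith)) (fun x y => (hM₂' _).trans (by linarith))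
    hRb hzL ?_ ?_
  · intro T
    obtain ⟨L', hL', hL''⟩ := hzL T
    have hcpt := isCompact_closedBall (0 : ℝ × (ℝ × ℝ))
      (max (|Real.log a| + |Real.log b|) (‖z 0‖ + L' * T))
    obtain ⟨C', hC', hT⟩ := contDiff_polarStereo.exists_norm_sub_sub_fderiv_le hcpt
      (convex_closedBall _ _)
    have hmem : ∀ t, 0 ≤ t → t ≤ T → (R t, z t) ∈ Metric.closedBall (0 : ℝ × (ℝ × ℝ))
        (max (|Real.log a| + |Real.log b|) (‖z 0‖ + L' * T)) := by
      intro t ht htT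
      rw [mem_closedBall_zero_iff, Prod.norm_def]
      refine max_le_max (hRb t ht) ?_
      have h1 := hL'' 0 t le_rfl ht htT
      have h2 := norm_le_norm_add_norm_sub (z 0) (z t)
      rw [norm_sub_rev] at h2
      have h3 : L' * (t - 0) ≤ L' * T := by gcongr; linarith
      exact h2.trans (add_le_add le_rfl (h1.trans h3))
    set Q := Mp / (a * η)
    refine ⟨Q * (C + C' * (L / a + L') ^ 2), fun s t hs hst ht => ?_⟩
    have ht0 := hs.trans hst
    set w := invStereo (z s)
    have hw : ‖w‖ = 1 := norm_invStereo _
    have hws : w ∈ Metric.sphere (0 : EuclideanSpace ℝ (Fin 3)) 1 := by simpa using hw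
    set k := ‖x s‖ * inner ℝ (p w) w
    have hk : 0 < k := mul_pos (hxn s hs) (hpos w hw)
    have hk' : a * η ≤ k := mul_le_mul (hxa s hs) (hη' w hws) hη.le (hxn s hs).le
    have hpQ : ‖p w‖ / k ≤ Q := div_le_div₀ ((norm_nonneg _).trans (hMp w hws)) (hMp w hws)
      (by positivity) hk'
    obtain ⟨i, hi⟩ := hincr s t hs hst (p w)
    have hFi : inner ℝ (p w) (F i (x s)) ≤ -δ * k := by
      have h1 := hδ' i w hw
      rw [div_le_iff₀ (hpos w hw)] at h1
      rw [← hdir s hs, hhom i _ (norm_nonneg _), inner_smul_right]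
      calc _ ≤ ‖x s‖ * (-δ * inner ℝ (p w) w) := mul_le_mul_of_nonneg_left h1 (norm_nonneg _)
        _ = _ := by ring
    have hD := hT _ (hmem s hs (hst.trans ht)) _ (hmem t ht0 ht)
    rw [hpolar s hs, hpolar t ht0] at hD
    have hin := inner_fderiv_polarStereo (p := p) (R s, z s) ((R t, z t) - (R s, z s))
      (hpos w hw).ne'
    rw [Real.exp_log (hxn s hs)] at hin
    have hΔ : ‖(R t, z t) - (R s, z s)‖ ≤ (L / a + L') * (t - s) := by
      rw [Prod.norm_def]
      have h1 := hRL s t hs hst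
      have h2 := hL'' s t hs hst ht
      have h3 : 0 ≤ L / a * (t - s) := (abs_nonneg _).trans h1
      have h4 : 0 ≤ L' * (t - s) := (norm_nonneg _).trans h2
      refine max_le (h1.trans ?_) (h2.trans ?_) <;> linarith
    have hΔ2 := pow_le_pow_left₀ (norm_nonneg _) hΔ 2
    have hD' := hD.trans (mul_le_mul_of_nonneg_left hΔ2 hC')
    have hcs := abs_le.1 (abs_real_inner_le_norm (p w)
      (x t - x s - fderiv ℝ polarStereo (R s, z s) ((R t, z t) - (R s, z s))))
    rw [inner_sub_right, hin] at hcs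
    have hmain : k * (R t - R s + planeForm (fun a b => stereoCoeff p (1, 0) (a, b))
        (fun a b => stereoCoeff p (0, 1) (a, b)) (z s) (z t - z s)) ≤
        k * (-δ * (t - s)) + ‖p w‖ * ((C + C' * (L / a + L') ^ 2) * (t - s) ^ 2) := by
      have h1 := mul_le_mul_of_nonneg_left hD' (norm_nonneg (p w))
      have h2 := mul_le_mul_of_nonneg_left hFi (sub_nonneg.2 hst)
      have h3 := hcs.1
      simp only [Prod.fst_sub, Prod.snd_sub] at h3
      change _ ≤ inner ℝ (p w) (x t - x s) - k * _ at h3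
      linarith
    have hmain2 := div_le_div_of_nonneg_right hmain hk.le
    rw [mul_div_cancel_left₀ _ hk.ne', add_div, mul_div_cancel_left₀ _ hk.ne',
      mul_div_right_comm] at hmain2
    refine hmain2.trans (add_le_add le_rfl ?_)
    rw [mul_assoc]
    exact mul_le_mul_of_nonneg_right hpQ (by positivity)
  · intro α β hα hαβ
    obtain ⟨m, hm, hm'⟩ := hret α β hα hαβ
    refine ⟨m / (b * 4), by positivity, fun s h hs h1 h2 => ?_⟩
    have hsh : 0 ≤ s + h := by linarith
    have h3 := hm' s h hs h1 h2 (‖x (s + h)‖ / ‖x s‖) (by positivity)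
    have h4 : x (s + h) - (‖x (s + h)‖ / ‖x s‖) • x s =
        ‖x (s + h)‖ • (invStereo (z (s + h)) - invStereo (z s)) := by
      rw [smul_sub, hdir _ hsh]
      conv_lhs => arg 2; arg 2; rw [← hdir s hs]
      rw [smul_smul, div_mul_cancel₀ _ (hxn s hs).ne']
    rw [h4, norm_smul, norm_norm] at h3
    rw [div_le_iff₀ (by positivity)]
    calc m ≤ _ := h3
      _ ≤ b * (4 * ‖z (s + h) - z s‖) := mul_le_mul (hxb _ hsh) (norm_invStereo_sub_le _ _)
        (norm_nonneg _) hb.le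
      _ = _ := by ring

end Space

section Escaping

variable {N : ℕ} {E V : Type*} [NormedAddCommGroup E] [InnerProductSpace ℝ E]
  [NormedAddCommGroup V] [InnerProductSpace ℝ V]

/-- A path in an annulus whose increments are controlled by a homogeneous switched system without
eigendirections, and whose direction never comes back close to itself after a time bounded away
from `0`. -/
structure IsEscaping (F : Fin N → E → E) (x : ℝ → E) : Prop where
  continuous : ∀ i, Continuous (F i)
  homogeneous : ∀ i (c : ℝ), 0 ≤ c → ∀ v, F i (c • v) = c • F i v
  exists_covector : ∀ v, v ≠ 0 → ∃ p, 0 < inner ℝ p v ∧ ∀ i, inner ℝ p (F i v) < 0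
  lower : ∃ a > 0, ∀ t, 0 ≤ t → a ≤ ‖x t‖
  upper : ∃ b, ∀ t, 0 ≤ t → ‖x t‖ ≤ b
  lipschitz : ∃ L, 0 ≤ L ∧ ∀ s t, 0 ≤ s → s ≤ t → ‖x t - x s‖ ≤ L * (t - s)
  increment : ∃ C, 0 ≤ C ∧ ∀ s t, 0 ≤ s → s ≤ t → ∀ p, ∃ i,
    inner ℝ p (x t - x s) ≤ (t - s) * inner ℝ p (F i (x s)) + C * ‖p‖ * (t - s) ^ 2
  no_return : ∀ α β, 0 < α → α ≤ β → ∃ m > 0, ∀ s h, 0 ≤ s → α ≤ h → h ≤ β → ∀ l : ℝ, 0 ≤ l →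
    m ≤ ‖x (s + h) - l • x s‖

/-- The image of a vector field under a linear embedding with a given left inverse, completed by
a contraction in the kernel of the left inverse. -/
def pushField (J : E →L[ℝ] V) (P : V →L[ℝ] E) (F : E → E) (v : V) : V := J (F (P v)) - (v - J (P v))

theorem IsEscaping.map [FiniteDimensional ℝ E] [FiniteDimensional ℝ V]
    {F : Fin N → E → E} {x : ℝ → E} (h : IsEscaping F x) (J : E →L[ℝ] V)
    (P : V →L[ℝ] E) (hPJ : ∀ v, P (J v) = v) :
    IsEscaping (fun i => pushField J P (F i)) (fun t => J (x t)) := by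
  have hJ : ∀ v, ‖v‖ ≤ (‖P‖ + 1) * ‖J v‖ := fun v => by
    have := P.le_opNorm (J v)
    rw [hPJ] at this
    nlinarith [norm_nonneg (J v)]
  have hP : 0 < ‖P‖ + 1 := by positivity
  have hfield : ∀ i v, pushField J P (F i) (J v) = J (F i v) := fun i v => by
    simp [pushField, hPJ]
  constructor
  · intro i
    have := h.continuous i
    unfold pushField
    fun_prop
  · intro i c hc v
    simp only [pushField, map_smul, h.homogeneous i c hc, smul_sub]
  · intro v hv
    by_cases hPv : P v = 0
    · refine ⟨v, real_inner_self_pos.2 hv, fun i => ?_⟩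
      have h0 : F i 0 = 0 := by simpa using h.homogeneous i 0 le_rfl 0
      simpa [pushField, hPv, h0] using pow_pos (norm_pos_iff.2 hv) 2
    · obtain ⟨p, h1, h2⟩ := h.exists_covector _ hPv
      refine ⟨P.adjoint p, by rwa [ContinuousLinearMap.adjoint_inner_left], fun i => ?_⟩
      rw [ContinuousLinearMap.adjoint_inner_left]
      simpa [pushField, hPJ] using h2 i
  · obtain ⟨a, ha, ha'⟩ := h.lower
    refine ⟨a / (‖P‖ + 1), by positivity, fun t ht => ?_⟩
    rw [div_le_iff₀' hP]
    exact (ha' t ht).trans (hJ _)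
  · obtain ⟨b, hb⟩ := h.upper
    exact ⟨‖J‖ * b, fun t ht => J.le_opNorm_of_le (hb t ht)⟩
  · obtain ⟨L, hL, hL'⟩ := h.lipschitz
    refine ⟨‖J‖ * L, by positivity, fun s t hs hst => ?_⟩
    rw [← map_sub, mul_assoc]
    exact J.le_opNorm_of_le (hL' s t hs hst)
  · obtain ⟨C, hC, hC'⟩ := h.increment
    refine ⟨C * ‖J‖, by positivity, fun s t hs hst p => ?_⟩
    obtain ⟨i, hi⟩ := hC' s t hs hst (J.adjoint p)
    refine ⟨i, ?_⟩
    rw [ContinuousLinearMap.adjoint_inner_left, ContinuousLinearMap.adjoint_inner_left] at hi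
    rw [hfield, ← map_sub]
    refine hi.trans (add_le_add le_rfl ?_)
    have h1 := J.adjoint.le_opNorm p
    rw [LinearIsometryEquiv.norm_map] at h1
    rw [mul_assoc C ‖J‖]
    gcongr
  · intro α β hα hαβ
    obtain ⟨m, hm, hm'⟩ := h.no_return α β hα hαβ
    refine ⟨m / (‖P‖ + 1), by positivity, fun s k hs h1 h2 l hl => ?_⟩
    rw [div_le_iff₀' hP, ← map_smul, ← map_sub]
    exact (hm' s k hs h1 h2 l hl).trans (hJ _)

/-- The lines through the points of a Lipschitz path do not fill three-space. -/
theorem exists_forall_ne_smul [FiniteDimensional ℝ V] (hdim : Module.finrank ℝ V = 3)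
    {x : ℝ → V} {L b : ℝ} (hL : 0 ≤ L) (hb : 0 ≤ b)
    (hxL : ∀ s t, 0 ≤ s → s ≤ t → ‖x t - x s‖ ≤ L * (t - s))
    (hxb : ∀ t, 0 ≤ t → ‖x t‖ ≤ b) : ∃ q : V, ∀ t, 0 ≤ t → ∀ l : ℝ, q ≠ l • x t := by
  let g : ℝ × ℝ → V := fun y => y.1 • x (max y.2 0)
  have hlip : ∀ s t, ‖x (max t 0) - x (max s 0)‖ ≤ L * |t - s| := by
    have key : ∀ s t, s ≤ t → ‖x (max t 0) - x (max s 0)‖ ≤ L * |t - s| := fun s t hst =>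
      (hxL _ _ (le_max_right _ _) (max_le_max_right _ hst)).trans
        (mul_le_mul_of_nonneg_left ((le_abs_self _).trans (abs_max_sub_max_le_abs t s 0)) hL)
    intro s t
    rcases le_total s t with h | h
    · exact key s t h
    · rw [norm_sub_rev, abs_sub_comm]
      exact key t s h
  have hg : dimH (Set.range g) ≤ dimH (Set.univ : Set (ℝ × ℝ)) := by
    refine dimH_range_le_of_locally_lipschitzOn fun y => ⟨.mk (b + (|y.1| + 1) * L) (by positivity),
      Metric.ball y 1, Metric.ball_mem_nhds _ one_pos, LipschitzOnWith.of_dist_le_mul ?_⟩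
    intro u hu w hw
    have h1 : |w.1| ≤ |y.1| + 1 := by
      have h2 : |w.1 - y.1| ≤ ‖w - y‖ := abs_fst_le_norm (w - y)
      rw [Metric.mem_ball, dist_eq_norm] at hw
      have h3 := abs_sub_abs_le_abs_sub w.1 y.1
      linarith
    have h2 : |u.1 - w.1| ≤ ‖u - w‖ := abs_fst_le_norm (u - w)
    have h3 : |u.2 - w.2| ≤ ‖u - w‖ := abs_snd_le_norm (u - w)
    rw [dist_eq_norm, dist_eq_norm]
    have h4 : g u - g w = (u.1 - w.1) • x (max u.2 0) +
        w.1 • (x (max u.2 0) - x (max w.2 0)) := by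
      simp only [g]; module
    rw [h4]
    refine (norm_add_le _ _).trans ?_
    rw [norm_smul, norm_smul, Real.norm_eq_abs, Real.norm_eq_abs, NNReal.coe_mk, add_mul]
    refine add_le_add ?_ ?_
    · rw [mul_comm b]
      exact mul_le_mul h2 (hxb _ (le_max_right _ _)) (norm_nonneg _) (norm_nonneg _)
    · rw [mul_assoc]
      refine mul_le_mul h1 ((hlip _ _).trans (mul_le_mul_of_nonneg_left h3 hL)) (norm_nonneg _)
        (by positivity)
  have hlt : dimH (Set.range g) < Module.finrank ℝ V := by
    refine hg.trans_lt ?_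
    rw [Real.dimH_univ_eq_finrank, hdim, Module.finrank_prod, Module.finrank_self]
    norm_num
  obtain ⟨q, hq⟩ := (dense_compl_of_dimH_lt_finrank hlt).nonempty
  refine ⟨q, fun t ht l h => hq ⟨(l, t), ?_⟩⟩
  simp [g, h, ht]

lemma exists_equiv_smul_eq_of_inner_pos [CompleteSpace V] {e p q : V} (he : ‖e‖ = 1)
    (hpq : 0 < inner ℝ p q) :
    ∃ (c : ℝ) (k : ℝ) (T : V ≃L[ℝ] V), 0 < c ∧ 0 < k ∧ T q = c • e ∧
      ∀ v, inner ℝ e (T v) = k * inner ℝ p v := by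
  have hp : 0 < ‖p‖ := norm_pos_iff.2 (by rintro rfl; simp at hpq)
  have hn : ‖(‖p‖⁻¹ • p)‖ = ‖e‖ := by
    rw [norm_smul, norm_inv, norm_norm, inv_mul_cancel₀ hp.ne', he]
  set U := (Submodule.span ℝ {‖p‖⁻¹ • p - e})ᗮ.reflection
  have hU : U (‖p‖⁻¹ • p) = e := Submodule.reflection_sub hn
  have hUe : ∀ v, inner ℝ e (U v) = ‖p‖⁻¹ * inner ℝ p v := fun v => by
    rw [← hU, LinearIsometryEquiv.inner_map_map, real_inner_smul_left]
  set c := inner ℝ e (U q)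
  have hc : 0 < c := by
    simp only [c, hUe]
    positivity
  have hee : inner ℝ e e = (1 : ℝ) := by rw [real_inner_self_eq_norm_sq, he, one_pow]
  set f := e - c⁻¹ • U q
  have hf : inner ℝ e f = (0 : ℝ) := by
    simp only [f, inner_sub_right, inner_smul_right, hee]
    rw [inv_mul_cancel₀ hc.ne', sub_self]
  let S : V ≃L[ℝ] V := ContinuousLinearEquiv.equivOfInverse
    (ContinuousLinearMap.id ℝ V + (innerSL ℝ e).smulRight f)
    (ContinuousLinearMap.id ℝ V - (innerSL ℝ e).smulRight f)
    (fun v => by simp [inner_add_right, inner_smul_right, hf])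
    (fun v => by simp [inner_sub_right, inner_smul_right, hf])
  have hS : ∀ v, S v = v + (inner ℝ e v : ℝ) • f := fun v => rfl
  refine ⟨c, ‖p‖⁻¹, U.toContinuousLinearEquiv.trans S, hc, by positivity, ?_, fun v => ?_⟩
  · change S (U q) = _
    rw [hS]
    change U q + c • f = _
    simp only [f, smul_sub, smul_smul, mul_inv_cancel₀ hc.ne', one_smul]
    abel
  · change inner ℝ e (S (U v)) = _
    rw [hS, inner_add_right, inner_smul_right, hf, mul_zero, add_zero, hUe]

theorem not_isEscaping_space {F : Fin N → EuclideanSpace ℝ (Fin 3) → EuclideanSpace ℝ (Fin 3)}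
    {x : ℝ → EuclideanSpace ℝ (Fin 3)} : ¬ IsEscaping F x := by
  intro h
  obtain ⟨a, ha, hxa⟩ := h.lower
  obtain ⟨b, hxb⟩ := h.upper
  obtain ⟨L, hL, hxL⟩ := h.lipschitz
  obtain ⟨q, hq⟩ := exists_forall_ne_smul (by simp) hL ((norm_nonneg _).trans (hxb 0 le_rfl))
    hxL hxb
  have hq0 : q ≠ 0 := by simpa using hq 0 le_rfl 0
  obtain ⟨p, hp, hpF⟩ := h.exists_covector q hq0
  obtain ⟨c, k, T, hc, hk, hTq, hTp⟩ := exists_equiv_smul_eq_of_inner_pos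
    (e := EuclideanSpace.single (2 : Fin 3) (1 : ℝ)) (by simp) hp
  have h' := h.map T.toContinuousLinearMap T.symm.toContinuousLinearMap (by simp)
  have hTe : T.symm (EuclideanSpace.single 2 1) = c⁻¹ • q := by
    rw [ContinuousLinearEquiv.symm_apply_eq, map_smul, hTq, smul_smul, inv_mul_cancel₀ hc.ne',
      one_smul]
  obtain ⟨a', ha', hxa'⟩ := h'.lower
  obtain ⟨b', hxb'⟩ := h'.upper
  obtain ⟨L', hL', hxL'⟩ := h'.lipschitz
  obtain ⟨C', hC', hinc'⟩ := h'.increment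
  refine space_no_escape h'.continuous h'.homogeneous h'.exists_covector (fun i => ?_) ha' hL' hC'
    hxa' hxb' hxL' hinc' (fun t ht l hl hl' => ?_) h'.no_return
  · have h1 := hTp (F i (c⁻¹ • q))
    rw [EuclideanSpace.inner_single_left, h.homogeneous i _ (by positivity), inner_smul_right] at h1
    have h2 : pushField T.toContinuousLinearMap T.symm.toContinuousLinearMap (F i)
        (EuclideanSpace.single 2 1) =
        T (c⁻¹ • F i q) := by
      simp [pushField, hTe, h.homogeneous i c⁻¹ (by positivity), hTq, smul_smul, hc.ne']
    simp only [h2]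
    simp only [map_one, one_mul] at h1
    rw [h1]
    exact mul_neg_of_pos_of_neg hk (mul_neg_of_pos_of_neg (by positivity) (hpF i))
  · have h1 : x t = (l * c⁻¹) • q := by
      have := congrArg T.symm hl'
      simpa [hTe, smul_smul] using this
    rcases hl.eq_or_lt with h0 | h0
    · have h2 := hxa t ht
      rw [h1, ← h0] at h2
      simp at h2
      linarith
    · refine hq t ht (l * c⁻¹)⁻¹ ?_
      rw [h1, smul_smul, inv_mul_cancel₀ (by positivity), one_smul]

theorem not_isEscaping {d : ℕ} (hd : d ≤ 3)
    {F : Fin N → EuclideanSpace ℝ (Fin d) → EuclideanSpace ℝ (Fin d)}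
    {x : ℝ → EuclideanSpace ℝ (Fin d)} : ¬ IsEscaping F x := by
  intro h
  let J : EuclideanSpace ℝ (Fin d) →ₗ[ℝ] EuclideanSpace ℝ (Fin 3) :=
    { toFun := fun v => WithLp.toLp 2 fun k => if hk : (k : ℕ) < d then v ⟨k, hk⟩ else 0
      map_add' := fun v w => by ext k; by_cases hk : (k : ℕ) < d <;> simp [hk]
      map_smul' := fun c v => by ext k; by_cases hk : (k : ℕ) < d <;> simp [hk] }
  let P : EuclideanSpace ℝ (Fin 3) →ₗ[ℝ] EuclideanSpace ℝ (Fin d) :=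
    { toFun := fun v => WithLp.toLp 2 fun i => v (Fin.castLE hd i)
      map_add' := fun v w => by ext k; simp
      map_smul' := fun c v => by ext k; simp }
  refine not_isEscaping_space (h.map J.toContinuousLinearMap P.toContinuousLinearMap fun v => ?_)
  ext i
  simp [J, P]

end Escaping

section Selection

/-- A closed relation with fibres in the unit cube has a measurable selection. -/
theorem exists_measurable_selection (n : ℕ) {Y : Type*} [TopologicalSpace Y]
    [SecondCountableTopology Y] [MeasurableSpace Y] [BorelSpace Y]
    {G : Set (Y × (Fin n → ℝ))} (hG : IsClosed G)
    (hG01 : ∀ y c, (y, c) ∈ G → ∀ i, c i ∈ Set.Icc (0 : ℝ) 1) :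
    ∃ s : Y → Fin n → ℝ, Measurable s ∧ ∀ y c, (y, c) ∈ G → (y, s y) ∈ G := by
  induction n generalizing Y with
  | zero =>
    refine ⟨fun _ => 0, measurable_const, fun y c h => ?_⟩
    rwa [Subsingleton.elim c 0] at h
  | succ n ih =>
    let m : Y → ℝ := fun y => sSup {r | ∃ c, (y, c) ∈ G ∧ c 0 = r}
    have hbdd : ∀ y, BddAbove {r | ∃ c, (y, c) ∈ G ∧ c 0 = r} := fun y =>
      ⟨1, by rintro _ ⟨c, hc, rfl⟩; exact (hG01 y c hc 0).2⟩
    have hcube : IsCompact (Set.pi Set.univ fun _ : Fin (n + 1) => Set.Icc (0 : ℝ) 1) :=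
      isCompact_univ_pi fun _ => isCompact_Icc
    have hmax : ∀ y c, (y, c) ∈ G → ∃ c', (y, c') ∈ G ∧ c' 0 = m y := by
      intro y c hc
      have hcl : IsClosed {c : Fin (n + 1) → ℝ | (y, c) ∈ G} :=
        hG.preimage (Continuous.prodMk_right y)
      have hcpt : IsCompact {c : Fin (n + 1) → ℝ | (y, c) ∈ G} :=
        hcube.of_isClosed_subset hcl fun c hc i _ => hG01 y c hc i
      have himg := hcpt.image (continuous_apply (0 : Fin (n + 1)))
      obtain ⟨c', hc', h⟩ := himg.sSup_mem ⟨_, c, hc, rfl⟩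
      exact ⟨c', hc', h⟩
    have hm : Measurable m := by
      refine measurable_of_Ici fun a => ?_
      rcases le_or_gt a 0 with ha | ha
      · have : m ⁻¹' Set.Ici a = Set.univ := by
          refine Set.eq_univ_of_forall fun y => ha.trans ?_
          refine Real.sSup_nonneg ?_
          rintro _ ⟨c, hc, rfl⟩
          exact (hG01 y c hc 0).1
        rw [this]
        exact MeasurableSet.univ
      · have : m ⁻¹' Set.Ici a = Prod.fst '' (G ∩ {q | a ≤ q.2 0}) := by
          ext y
          constructor
          · intro hy
            have hne : {r | ∃ c, (y, c) ∈ G ∧ c 0 = r}.Nonempty := by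
              by_contra hne
              rw [Set.not_nonempty_iff_eq_empty] at hne
              have h0 : m y = 0 := by simp only [m, hne, Real.sSup_empty]
              have : a ≤ m y := hy
              linarith
            obtain ⟨_, c, hc, -⟩ := hne
            obtain ⟨c', hc', h⟩ := hmax y c hc
            exact ⟨(y, c'), ⟨hc', by simpa [h] using hy⟩, rfl⟩
          · rintro ⟨⟨y', c⟩, ⟨hc, ha'⟩, rfl⟩
            exact le_trans ha' (le_csSup (hbdd y') ⟨c, hc, rfl⟩)
        rw [this]
        refine IsClosed.measurableSet ?_
        have hclosed : IsClosed (G ∩ {q : Y × (Fin (n + 1) → ℝ) | a ≤ q.2 0}) :=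
          hG.inter (isClosed_le continuous_const (by fun_prop))
        have hsub : G ∩ {q : Y × (Fin (n + 1) → ℝ) | a ≤ q.2 0} ⊆
            Set.univ ×ˢ (Set.pi Set.univ fun _ : Fin (n + 1) => Set.Icc (0 : ℝ) 1) :=
          fun q hq => ⟨trivial, fun i _ => hG01 q.1 q.2 hq.1 i⟩
        have hcs : CompactSpace (Set.pi Set.univ fun _ : Fin (n + 1) => Set.Icc (0 : ℝ) 1) :=
          isCompact_iff_compactSpace.1 hcube
        have hpre := hclosed.preimage (f := fun q : Y × (Set.pi Set.univ
          fun _ : Fin (n + 1) => Set.Icc (0 : ℝ) 1) => (q.1, (q.2 : Fin (n + 1) → ℝ)))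
          (by fun_prop)
        have himg := isClosedMap_fst_of_compactSpace _ hpre
        convert himg using 1
        ext y
        constructor
        · rintro ⟨⟨y', c⟩, hc, rfl⟩
          exact ⟨(y', ⟨c, (hsub hc).2⟩), hc, rfl⟩
        · rintro ⟨⟨y', c⟩, hc, rfl⟩
          exact ⟨(y', c), hc, rfl⟩
    obtain ⟨s, hs, hsG⟩ := ih (Y := Y × ℝ)
      (G := {q | (q.1.1, (Fin.cons q.1.2 q.2 : Fin (n + 1) → ℝ)) ∈ G})
      (hG.preimage (by fun_prop)) (fun y c h i => by simpa using hG01 _ _ h i.succ)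
    refine ⟨fun y => Fin.cons (m y) (s (y, m y)), ?_, fun y c hc => ?_⟩
    · have h1 : Measurable fun y => s (y, m y) := hs.comp (measurable_id.prodMk hm)
      refine measurable_pi_lambda _ fun i => ?_
      refine Fin.cases ?_ (fun j => ?_) i
      · simpa using hm
      · simp only [Fin.cons_succ]
        exact (measurable_pi_apply j).comp h1
    · obtain ⟨c', hc', h⟩ := hmax y c hc
      refine hsG (y, m y) (Fin.tail c') ?_
      change (y, Fin.cons (m y) (Fin.tail c')) ∈ G
      rwa [← h, Fin.cons_self_tail]

end Selection

section Relaxation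

lemma exists_mem_stdSimplex_sum_smul_eq {N : ℕ} {E : Type*} [NormedAddCommGroup E]
    [InnerProductSpace ℝ E] [CompleteSpace E] {a : Fin N → E} {w : E}
    (h : ∀ p : E, ∃ i, inner ℝ p w ≤ inner ℝ p (a i)) :
    ∃ c ∈ stdSimplex ℝ (Fin N), ∑ i, c i • a i = w := by
  by_contra hw
  have hS : IsCompact ((fun c : Fin N → ℝ => ∑ i, c i • a i) '' stdSimplex ℝ (Fin N)) :=
    (isCompact_stdSimplex ℝ (Fin N)).image (by fun_prop)
  have hconv : Convex ℝ ((fun c : Fin N → ℝ => ∑ i, c i • a i) '' stdSimplex ℝ (Fin N)) := by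
    refine (convex_stdSimplex ℝ (Fin N)).is_linear_image ?_
    exact ⟨fun c d => by simp [add_smul, Finset.sum_add_distrib],
      fun r c => by simp [Finset.smul_sum, smul_smul]⟩
  obtain ⟨f, r, h1, h2⟩ := geometric_hahn_banach_point_closed hconv hS.isClosed
    (x := w) fun ⟨c, hc, hcw⟩ => hw ⟨c, hc, hcw⟩
  obtain ⟨i, hi⟩ := h (-(InnerProductSpace.toDual ℝ E).symm f)
  simp only [inner_neg_left, InnerProductSpace.toDual_symm_apply] at hi
  have h3 := h2 (a i) ⟨Pi.single i 1, single_mem_stdSimplex ℝ i, by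
    simp [Pi.single_apply, ite_smul]⟩
  linarith

variable {d N : ℕ} {Ψ : Fin N → EuclideanSpace ℝ (Fin d) → EuclideanSpace ℝ (Fin d)}

lemma exists_inner_deriv_le {E : Type*} [NormedAddCommGroup E] [InnerProductSpace ℝ E]
    {a : Fin N → E} {y : ℝ → E} {t : ℝ} (hy : DifferentiableAt ℝ y t) {p : E}
    (hinc : ∃ C η : ℝ, 0 < η ∧ ∀ h, 0 < h → h < η → ∃ i,
      inner ℝ p (y (t + h) - y t) ≤ h * inner ℝ p (a i) + C * h ^ 2) :
    ∃ i, inner ℝ p (deriv y t) ≤ inner ℝ p (a i) := by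
  obtain ⟨C, η, hη, hinc⟩ := hinc
  by_contra! hlt
  have hd := hy.hasDerivAt.tendsto_slope_zero_right
  have h1 : Tendsto (fun h : ℝ => inner ℝ p (h⁻¹ • (y (t + h) - y t)) - C * h) (𝓝[>] 0)
      (𝓝 (inner ℝ p (deriv y t) - C * 0)) :=
    (Tendsto.inner tendsto_const_nhds hd).sub
      (tendsto_const_nhds.mul (tendsto_id.mono_left nhdsWithin_le_nhds))
  rw [mul_zero, sub_zero] at h1
  have h2 : ∀ᶠ h in 𝓝[>] (0 : ℝ), ∀ i,
      inner ℝ p (a i) < inner ℝ p (h⁻¹ • (y (t + h) - y t)) - C * h :=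
    eventually_all.2 fun i => h1.eventually_const_lt (hlt i)
  have h3 : ∀ᶠ h in 𝓝[>] (0 : ℝ), h ∈ Set.Ioo 0 η := Ioo_mem_nhdsGT hη
  obtain ⟨h, h4, h5, h6⟩ := (h2.and h3).exists
  obtain ⟨i, hi⟩ := hinc h h5 h6
  have h7 := h4 i
  rw [inner_smul_right] at h7
  have h8 := mul_lt_mul_of_pos_left h7 h5
  rw [mul_sub, mul_inv_cancel_left₀ h5.ne'] at h8
  nlinarith

lemma integral_deriv_of_lipschitzWith {y : ℝ → EuclideanSpace ℝ (Fin d)} {L : ℝ≥0}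
    (hy : LipschitzWith L y) (a b : ℝ) : ∫ t in a..b, deriv y t = y b - y a := by
  have hmeas : Measurable (deriv y) := measurable_deriv y
  have hintg : IntervalIntegrable (deriv y) volume a b := by
    refine IntervalIntegrable.mono_fun' (g := fun _ => (L : ℝ)) intervalIntegrable_const
      hmeas.aestronglyMeasurable (ae_of_all _ fun t => ?_)
    exact norm_deriv_le_of_lipschitz hy
  ext i
  have h1 : LipschitzWith L fun t => y t i := by
    have h2 := (LipschitzWith.eval i).comp ((PiLp.lipschitzWith_ofLp 2 _).comp hy)
    rw [one_mul, one_mul] at h2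
    exact h2
  have h2 : (∫ t in a..b, deriv y t) i = ∫ t in a..b, deriv y t i :=
    ((EuclideanSpace.proj (𝕜 := ℝ) i).intervalIntegral_comp_comm hintg).symm
  rw [h2, PiLp.sub_apply,
    ← (h1.lipschitzOnWith (s := Set.uIcc a b)).absolutelyContinuousOnInterval.integral_deriv_eq_sub]
  refine intervalIntegral.integral_congr_ae ?_
  filter_upwards [hy.ae_differentiableAt] with t ht _
  exact (((EuclideanSpace.proj (𝕜 := ℝ) i).hasFDerivAt.comp_hasDerivAt t ht.hasDerivAt).deriv).symm

/-- A Lipschitz path whose right increments are controlled by the switched system is generated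
by a switching law, which has all the periods of the path. -/
theorem exists_isTrajectoryWith (hΨ : ∀ i, Continuous (Ψ i))
    {y : ℝ → EuclideanSpace ℝ (Fin d)} {L : ℝ≥0} (hy : LipschitzWith L y)
    (hinc : ∀ t, 0 ≤ t → ∀ p, ∃ C η : ℝ, 0 < η ∧ ∀ h, 0 < h → h < η → ∃ i,
      inner ℝ p (y (t + h) - y t) ≤ h * inner ℝ p (Ψ i (y t)) + C * h ^ 2) :
    ∃ u, IsTrajectoryWith Ψ u (fun t : ℝ≥0 => y t) ∧
      ∀ q, (∀ t, y (t + q) = y t) → ∀ i t, u i (t + q) = u i t := by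
  obtain ⟨s, hs, hsG⟩ := exists_measurable_selection N
    (Y := EuclideanSpace ℝ (Fin d) × EuclideanSpace ℝ (Fin d))
    (G := {q | q.2 ∈ stdSimplex ℝ (Fin N) ∧ ∑ i, q.2 i • Ψ i q.1.1 = q.1.2})
    (((isClosed_stdSimplex ℝ (Fin N)).preimage continuous_snd).inter
      (isClosed_eq (by fun_prop) (by fun_prop)))
    (fun y c h i => ⟨h.1.1 i, by
      rw [← h.1.2]
      exact Finset.single_le_sum (fun j _ => h.1.1 j) (Finset.mem_univ i)⟩)
  have hae : ∀ᵐ t ∂(volume.restrict (Set.Ici (0 : ℝ))),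
      s (y t, deriv y t) ∈ stdSimplex ℝ (Fin N) ∧
        ∑ i, s (y t, deriv y t) i • Ψ i (y t) = deriv y t := by
    rw [ae_restrict_iff' measurableSet_Ici]
    filter_upwards [hy.ae_differentiableAt] with t ht ht0
    obtain ⟨c, hc, hc'⟩ := exists_mem_stdSimplex_sum_smul_eq fun p =>
      exists_inner_deriv_le ht (hinc t ht0 p)
    exact hsG (y t, deriv y t) c ⟨hc, hc'⟩
  refine ⟨fun i t => s (y t, deriv y t) i, ⟨hy.continuous.comp NNReal.continuous_coe,
    ⟨fun i => ?_, ?_⟩, fun t => ?_⟩, fun q hq i t => ?_⟩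
  · exact (measurable_pi_apply i).comp
      (hs.comp (hy.continuous.measurable.prodMk (measurable_deriv y)))
  · filter_upwards [hae] with t ht
    refine ⟨fun i => ⟨ht.1.1 i, ?_⟩, ht.1.2⟩
    rw [← ht.1.2]
    exact Finset.single_le_sum (fun j _ => ht.1.1 j) (Finset.mem_univ i)
  · have h1 := integral_deriv_of_lipschitzWith hy 0 t
    rw [intervalIntegral.integral_of_le t.coe_nonneg] at h1
    have h2 : ∫ r in Set.Ioc (0 : ℝ) t,
        ∑ i, s (y r, deriv y r) i • Ψ i (y (Real.toNNReal r)) = ∫ r in Set.Ioc (0 : ℝ) t,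
        deriv y r := by
      refine integral_congr_ae ?_
      filter_upwards [ae_restrict_of_ae_restrict_of_subset
        (Set.Ioc_subset_Ioi_self.trans Set.Ioi_subset_Ici_self) hae,
        ae_restrict_mem measurableSet_Ioc] with r hr hr0
      rw [Real.coe_toNNReal r hr0.1.le]
      exact hr.2
    simp only [h2, h1, NNReal.coe_zero]
    abel
  · have h1 : deriv y (t + q) = deriv y t := by
      rw [← deriv_comp_add_const]
      congr 1
      exact funext hq
    simp only [hq, h1]

end Relaxation

section Solution

variable {d N : ℕ} {Ψ : Fin N → EuclideanSpace ℝ (Fin d) → EuclideanSpace ℝ (Fin d)} {K : ℝ≥0}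
  {u : Fin N → ℝ → ℝ}

lemma norm_sum_smul_sub_le {N : ℕ} {E : Type*} [NormedAddCommGroup E] [NormedSpace ℝ E]
    {Ψ : Fin N → E → E} {K : ℝ≥0} (hΨ : ∀ i, LipschitzWith K (Ψ i)) {c : Fin N → ℝ}
    (hc : (∀ i, c i ∈ Set.Icc (0 : ℝ) 1) ∧ ∑ i, c i = 1) (v w : E) :
    ‖∑ i, c i • Ψ i v - ∑ i, c i • Ψ i w‖ ≤ K * ‖v - w‖ := by
  rw [← Finset.sum_sub_distrib]
  calc ‖∑ i, (c i • Ψ i v - c i • Ψ i w)‖ ≤ ∑ i, c i * (K * ‖v - w‖) := by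
        refine norm_sum_le_of_le _ fun i _ => ?_
        rw [← smul_sub, norm_smul, Real.norm_of_nonneg (hc.1 i).1]
        exact mul_le_mul_of_nonneg_left ((hΨ i).norm_sub_le v w) (hc.1 i).1
    _ = K * ‖v - w‖ := by rw [← Finset.sum_mul, hc.2, one_mul]

lemma norm_sum_smul_le {N : ℕ} {E : Type*} [NormedAddCommGroup E] [NormedSpace ℝ E]
    {Ψ : Fin N → E → E} {K : ℝ≥0} (hΨ : ∀ i, LipschitzWith K (Ψ i)) (hΨ0 : ∀ i, Ψ i 0 = 0)
    {c : Fin N → ℝ} (hc : (∀ i, c i ∈ Set.Icc (0 : ℝ) 1) ∧ ∑ i, c i = 1) (v : E) :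
    ‖∑ i, c i • Ψ i v‖ ≤ K * ‖v‖ := by
  simpa [hΨ0] using norm_sum_smul_sub_le hΨ hc v 0

lemma IsSwitchingLaw.intervalIntegrable (hu : IsSwitchingLaw u)
    (hΨ : ∀ i, LipschitzWith K (Ψ i)) (hΨ0 : ∀ i, Ψ i 0 = 0)
    {w : ℝ → EuclideanSpace ℝ (Fin d)} (hw : Continuous w) {s t : ℝ} (hs : 0 ≤ s) (ht : 0 ≤ t) :
    IntervalIntegrable (fun r => ∑ i, u i r • Ψ i (w r)) volume s t := by
  refine IntervalIntegrable.mono_fun' (g := fun r => K * ‖w r‖)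
    (Continuous.intervalIntegrable (by fun_prop) _ _) ?_ ?_
  · refine Measurable.aestronglyMeasurable ?_
    refine Finset.measurable_sum _ fun i _ => (hu.1 i).smul ?_
    exact ((hΨ i).continuous.comp hw).measurable
  · have hsub : Set.uIoc s t ⊆ Set.Ici 0 := fun r hr => (le_min hs ht).trans hr.1.le
    filter_upwards [ae_restrict_of_ae_restrict_of_subset hsub hu.2] with r hr
    exact norm_sum_smul_le hΨ hΨ0 hr (w r)

/-- Paths whose increments are governed by the switched system, in a form which is stable under
pointwise limits. -/
structure IsSolution (Ψ : Fin N → EuclideanSpace ℝ (Fin d) → EuclideanSpace ℝ (Fin d))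
    (K : ℝ≥0) (L : ℝ) (x : ℝ → EuclideanSpace ℝ (Fin d)) : Prop where
  lipschitz : ∀ s t, 0 ≤ s → s ≤ t → ‖x t - x s‖ ≤ L * (t - s)
  increment : ∀ s t, 0 ≤ s → s ≤ t → ∀ p, ∃ i,
    inner ℝ p (x t - x s) ≤ (t - s) * inner ℝ p (Ψ i (x s)) + K * L * ‖p‖ * (t - s) ^ 2

lemma exists_forall_inner_sum_smul_le {N : ℕ} {E : Type*} [NormedAddCommGroup E]
    [InnerProductSpace ℝ E] {c₀ : Fin N → ℝ} (hc₀ : ∑ i, c₀ i = 1) (a : Fin N → E) (p : E) :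
    ∃ i, ∀ c : Fin N → ℝ, (∀ i, c i ∈ Set.Icc (0 : ℝ) 1) ∧ ∑ i, c i = 1 →
      inner ℝ p (∑ i, c i • a i) ≤ inner ℝ p (a i) := by
  have hne : Nonempty (Fin N) := by
    by_contra hne
    rw [not_nonempty_iff] at hne
    simp at hc₀
  obtain ⟨i, hi⟩ := Finite.exists_max fun i => inner ℝ p (a i)
  refine ⟨i, fun c hc => ?_⟩
  rw [inner_sum]
  calc ∑ j, inner ℝ p (c j • a j) ≤ ∑ j, c j * inner ℝ p (a i) := by
        refine Finset.sum_le_sum fun j _ => ?_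
        rw [inner_smul_right]
        exact mul_le_mul_of_nonneg_left (hi j) (hc.1 j).1
    _ = inner ℝ p (a i) := by rw [← Finset.sum_mul, hc.2, one_mul]

lemma IsTrajectoryWith.sub_eq (hΨ : ∀ i, LipschitzWith K (Ψ i)) (hΨ0 : ∀ i, Ψ i 0 = 0)
    {x : ℝ≥0 → EuclideanSpace ℝ (Fin d)} (hx : IsTrajectoryWith Ψ u x) {s t : ℝ} (hs : 0 ≤ s)
    (ht : 0 ≤ t) : x t.toNNReal - x s.toNNReal = ∫ r in s..t, ∑ i, u i r • Ψ i (x r.toNNReal) := by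
  obtain ⟨hc, hu, hxt⟩ := hx
  have hintg : ∀ {t : ℝ}, 0 ≤ t →
      IntervalIntegrable (fun r => ∑ i, u i r • Ψ i (x r.toNNReal)) volume 0 t := fun ht =>
    hu.intervalIntegrable hΨ hΨ0 (hc.comp continuous_real_toNNReal) le_rfl ht
  have h : ∀ {t : ℝ}, 0 ≤ t →
      x t.toNNReal = x 0 + ∫ r in 0..t, ∑ i, u i r • Ψ i (x r.toNNReal) := fun {t} ht => by
    rw [hxt t.toNNReal, intervalIntegral.integral_of_le ht, Real.coe_toNNReal t ht]
  rw [← intervalIntegral.integral_interval_sub_left (hintg ht) (hintg hs), h ht, h hs]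
  abel

lemma IsTrajectory.isSolution (hΨ : ∀ i, LipschitzWith K (Ψ i)) (hΨ0 : ∀ i, Ψ i 0 = 0)
    {x : ℝ≥0 → EuclideanSpace ℝ (Fin d)} (hx : IsTrajectory Ψ x) {b : ℝ} (hb : ∀ t, ‖x t‖ ≤ b) :
    IsSolution Ψ K (K * b) fun t => x t.toNNReal := by
  obtain ⟨u, hx⟩ := hx
  have hu := hx.2.1
  have hae : ∀ s t : ℝ, 0 ≤ s → s ≤ t → ∀ᵐ r ∂(volume.restrict (Set.Ioc s t)),
      r ∈ Set.Ioc s t ∧ (∀ i, u i r ∈ Set.Icc (0 : ℝ) 1) ∧ ∑ i, u i r = 1 := fun s t hs _ => by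
    filter_upwards [ae_restrict_of_ae_restrict_of_subset
      (fun r (hr : r ∈ Set.Ioc s t) => Set.mem_Ici.2 (hs.trans hr.1.le)) hu.2,
      ae_restrict_mem measurableSet_Ioc] with r h1 h2
    exact ⟨h2, h1⟩
  have hL : ∀ s t : ℝ, 0 ≤ s → s ≤ t → ‖x t.toNNReal - x s.toNNReal‖ ≤ K * b * (t - s) := by
    intro s t hs hst
    rw [hx.sub_eq hΨ hΨ0 hs (hs.trans hst)]
    have := intervalIntegral.norm_integral_le_of_norm_le_const_ae (a := s) (b := t)
      (f := fun r => ∑ i, u i r • Ψ i (x r.toNNReal)) (C := K * b) (by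
        have h := hae s t hs hst
        rw [ae_restrict_iff' measurableSet_Ioc] at h
        filter_upwards [h] with r hr hr'
        rw [Set.uIoc_of_le hst] at hr'
        refine (norm_sum_smul_le hΨ hΨ0 (hr hr').2 _).trans ?_
        gcongr
        exact hb _)
    rwa [abs_of_nonneg (sub_nonneg.2 hst)] at this
  refine ⟨hL, fun s t hs hst p => ?_⟩
  have hne : ∃ c₀ : Fin N → ℝ, ∑ i, c₀ i = 1 := by
    have : NeZero (volume.restrict (Set.Ici (0 : ℝ))) := ⟨by simp⟩
    obtain ⟨r, hr⟩ := hu.2.exists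
    exact ⟨fun i => u i r, hr.2⟩
  obtain ⟨c₀, hc₀⟩ := hne
  obtain ⟨i, hi⟩ := exists_forall_inner_sum_smul_le hc₀ (fun i => Ψ i (x s.toNNReal)) p
  have hintg := hu.intervalIntegrable hΨ hΨ0 (hx.1.comp continuous_real_toNNReal) hs (hs.trans hst)
  refine ⟨i, ?_⟩
  rw [hx.sub_eq hΨ hΨ0 hs (hs.trans hst)]
  have h1 : inner ℝ p (∫ r in s..t, ∑ i, u i r • Ψ i (x r.toNNReal)) =
      ∫ r in s..t, inner ℝ p (∑ i, u i r • Ψ i (x r.toNNReal)) :=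
    ((innerSL ℝ p).intervalIntegral_comp_comm hintg).symm
  have h2 : ∫ r in s..t, inner ℝ p (∑ i, u i r • Ψ i (x r.toNNReal)) ≤
      ∫ r in s..t, (inner ℝ p (Ψ i (x s.toNNReal)) + K * (K * b) * ‖p‖ * (t - s)) := by
    refine intervalIntegral.integral_mono_ae_restrict hst ?_ intervalIntegrable_const ?_
    · exact ⟨(innerSL ℝ p).integrable_comp hintg.1, (innerSL ℝ p).integrable_comp hintg.2⟩
    · rw [← Measure.restrict_congr_set Ioc_ae_eq_Icc]
      filter_upwards [hae s t hs hst] with r hr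
      have h3 := hi _ hr.2
      have h4 := norm_sum_smul_sub_le hΨ hr.2 (x r.toNNReal) (x s.toNNReal)
      have h5 := hL s r hs hr.1.1.le
      have h6 := real_inner_le_norm p (∑ i, u i r • Ψ i (x r.toNNReal) -
        ∑ i, u i r • Ψ i (x s.toNNReal))
      rw [inner_sub_right] at h6
      have h7 : K * (K * b * (r - s)) ≤ K * (K * b * (t - s)) := by
        have : 0 ≤ b := (norm_nonneg _).trans (hb 0)
        gcongr
        exact hr.1.2
      have h8 := mul_le_mul_of_nonneg_left (h4.trans ((mul_le_mul_of_nonneg_left h5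
        K.coe_nonneg).trans h7)) (norm_nonneg p)
      linarith
  rw [intervalIntegral.integral_const, smul_eq_mul] at h2
  rw [h1]
  linarith

namespace IsSolution

variable {L : ℝ} {x y : ℝ → EuclideanSpace ℝ (Fin d)}

lemma nonneg (hx : IsSolution Ψ K L x) : 0 ≤ L := by
  simpa using (norm_nonneg _).trans (hx.lipschitz 0 1 le_rfl zero_le_one)

lemma isTrajectory (hΨ : ∀ i, LipschitzWith K (Ψ i)) (hx : IsSolution Ψ K L x) :
    IsTrajectory Ψ fun t : ℝ≥0 => x t := by
  have hlip : ∀ s t : ℝ, s ≤ t → ‖x (max t 0) - x (max s 0)‖ ≤ L * (t - s) := fun s t hst => by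
    refine (hx.lipschitz _ _ (le_max_right _ _) (max_le_max_right 0 hst)).trans
      (mul_le_mul_of_nonneg_left ?_ hx.nonneg)
    rcases le_total s 0 with h | h <;> rcases le_total t 0 with h' | h' <;> simp [h, h'] <;>
      linarith
  have h1 : LipschitzWith L.toNNReal fun t => x (max t 0) := by
    refine LipschitzWith.of_dist_le_mul fun t s => ?_
    rw [Real.coe_toNNReal L hx.nonneg, dist_eq_norm, Real.dist_eq]
    rcases le_total s t with h | h
    · rw [abs_of_nonneg (sub_nonneg.2 h)]
      exact hlip s t h
    · rw [abs_sub_comm, abs_of_nonneg (sub_nonneg.2 h), norm_sub_rev]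
      exact hlip t s h
  obtain ⟨u, hu, -⟩ := exists_isTrajectoryWith (fun i => (hΨ i).continuous) h1
    fun t ht p => ⟨K * L * ‖p‖, 1, one_pos, fun h hh _ => by
      obtain ⟨i, hi⟩ := hx.increment t (t + h) ht (by linarith) p
      refine ⟨i, ?_⟩
      simpa [ht, max_eq_left (by linarith : 0 ≤ t + h)] using hi⟩
  refine ⟨u, ?_⟩
  simpa using hu

lemma mono (hx : IsSolution Ψ K L x) {L' : ℝ} (hL : L ≤ L') : IsSolution Ψ K L' x := by
  refine ⟨fun s t hs hst => (hx.lipschitz s t hs hst).trans ?_, fun s t hs hst p => ?_⟩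
  · exact mul_le_mul_of_nonneg_right hL (sub_nonneg.2 hst)
  · obtain ⟨i, hi⟩ := hx.increment s t hs hst p
    refine ⟨i, hi.trans ?_⟩
    gcongr

lemma shift (hx : IsSolution Ψ K L x) {r : ℝ} (hr : 0 ≤ r) :
    IsSolution Ψ K L fun t => x (r + t) := by
  constructor
  · intro s t hs hst
    simpa using hx.lipschitz (r + s) (r + t) (by linarith) (by linarith)
  · intro s t hs hst p
    simpa using hx.increment (r + s) (r + t) (by linarith) (by linarith) p

lemma smul (hhom : ∀ i (c : ℝ), 0 ≤ c → ∀ v, Ψ i (c • v) = c • Ψ i v)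
    (hx : IsSolution Ψ K L x) {c : ℝ} (hc : 0 ≤ c) : IsSolution Ψ K (c * L) fun t => c • x t := by
  constructor
  · intro s t hs hst
    rw [← smul_sub, norm_smul, Real.norm_of_nonneg hc, mul_assoc]
    exact mul_le_mul_of_nonneg_left (hx.lipschitz s t hs hst) hc
  · intro s t hs hst p
    obtain ⟨i, hi⟩ := hx.increment s t hs hst p
    refine ⟨i, ?_⟩
    rw [← smul_sub, inner_smul_right, hhom i c hc, inner_smul_right]
    linarith [mul_le_mul_of_nonneg_left hi hc]

lemma concat (hΨ : ∀ i, LipschitzWith K (Ψ i)) (hx : IsSolution Ψ K L x)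
    (hy : IsSolution Ψ K L y) {r : ℝ} (hxy : y 0 = x r) :
    IsSolution Ψ K L fun t => if t ≤ r then x t else y (t - r) := by
  have hL := hx.nonneg
  constructor
  · intro s t hs hst
    rcases le_or_gt t r with ht | ht
    · simpa [ht, hst.trans ht] using hx.lipschitz s t hs hst
    rcases le_or_gt s r with hsr | hsr
    · simp only [hsr, not_le.2 ht, if_true, if_false]
      have h1 := hx.lipschitz s r hs hsr
      have h2 := hy.lipschitz 0 (t - r) le_rfl (by linarith)
      rw [hxy] at h2
      linarith [norm_sub_le_norm_sub_add_norm_sub (y (t - r)) (x r) (x s)]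
    · simpa [not_le.2 ht, not_le.2 hsr] using hy.lipschitz (s - r) (t - r) (by linarith)
        (by linarith)
  · intro s t hs hst p
    rcases le_or_gt t r with ht | ht
    · simpa [ht, hst.trans ht] using hx.increment s t hs hst p
    rcases le_or_gt s r with hsr | hsr
    · simp only [hsr, not_le.2 ht, if_true, if_false]
      obtain ⟨i, hi⟩ := hx.increment s r hs hsr p
      obtain ⟨j, hj⟩ := hy.increment 0 (t - r) le_rfl (by linarith) p
      rw [hxy, sub_zero] at hj
      have h1 : inner ℝ p (Ψ j (x r)) ≤ inner ℝ p (Ψ j (x s)) + K * L * ‖p‖ * (r - s) := by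
        have h2 := real_inner_le_norm p (Ψ j (x r) - Ψ j (x s))
        rw [inner_sub_right] at h2
        have h3 := ((hΨ j).norm_sub_le (x r) (x s)).trans
          (mul_le_mul_of_nonneg_left (hx.lipschitz s r hs hsr) K.coe_nonneg)
        linarith [mul_le_mul_of_nonneg_left h3 (norm_nonneg p)]
      have h4 : inner ℝ p (y (t - r) - x s) = inner ℝ p (y (t - r) - x r) +
          inner ℝ p (x r - x s) := by
        rw [← inner_add_right, sub_add_sub_cancel]
      have h5 := mul_le_mul_of_nonneg_left h1 (sub_nonneg.2 ht.le)
      have h6 : 0 ≤ K * L * ‖p‖ * ((t - r) * (r - s)) := by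
        have := sub_nonneg.2 ht.le
        have := sub_nonneg.2 hsr
        positivity
      rcases le_total (inner ℝ p (Ψ i (x s))) (inner ℝ p (Ψ j (x s))) with h | h
      · refine ⟨j, ?_⟩
        linarith [mul_le_mul_of_nonneg_left h (sub_nonneg.2 hsr)]
      · refine ⟨i, ?_⟩
        linarith [mul_le_mul_of_nonneg_left h (sub_nonneg.2 ht.le)]
    · simpa [not_le.2 ht, not_le.2 hsr] using hy.increment (s - r) (t - r) (by linarith)
        (by linarith) p

end IsSolution

end Solution

section Perturbation

variable {d N : ℕ} {Ψ : Fin N → EuclideanSpace ℝ (Fin d) → EuclideanSpace ℝ (Fin d)} {K : ℝ≥0}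
  {u : Fin N → ℝ → ℝ}

lemma IsSwitchingLaw.continuous_integral (hu : IsSwitchingLaw u)
    (hΨ : ∀ i, LipschitzWith K (Ψ i)) (hΨ0 : ∀ i, Ψ i 0 = 0)
    {w : ℝ → EuclideanSpace ℝ (Fin d)} (hw : Continuous w) :
    Continuous fun t : ℝ≥0 => ∫ r in (0 : ℝ)..t, ∑ i, u i r • Ψ i (w r) := by
  have hintg : ∀ a b, IntervalIntegrable
      ((Set.Ici (0 : ℝ)).indicator fun r => ∑ i, u i r • Ψ i (w r)) volume a b := by
    intro a b
    refine IntervalIntegrable.mono_fun' (g := fun r => K * ‖w r‖)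
      (Continuous.intervalIntegrable (by fun_prop) _ _) ?_ ?_
    · refine (Measurable.indicator ?_ measurableSet_Ici).aestronglyMeasurable
      refine Finset.measurable_sum _ fun i _ => (hu.1 i).smul ?_
      exact ((hΨ i).continuous.comp hw).measurable
    · refine ae_restrict_of_ae ?_
      have h := hu.2
      rw [ae_restrict_iff' measurableSet_Ici] at h
      filter_upwards [h] with r hr
      by_cases h0 : r ∈ Set.Ici (0 : ℝ)
      · rw [Set.indicator_of_mem h0]
        exact norm_sum_smul_le hΨ hΨ0 (hr h0) (w r)
      · rw [Set.indicator_of_notMem h0, norm_zero]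
        positivity
  refine ((intervalIntegral.continuous_primitive hintg 0).comp NNReal.continuous_coe).congr
    fun t => intervalIntegral.integral_congr fun r hr => ?_
  rw [Set.uIcc_of_le t.coe_nonneg] at hr
  exact Set.indicator_of_mem (Set.mem_Ici.2 hr.1) _

lemma IsSwitchingLaw.norm_integral_sub_le (hu : IsSwitchingLaw u)
    (hΨ : ∀ i, LipschitzWith K (Ψ i)) (hΨ0 : ∀ i, Ψ i 0 = 0)
    {w w' : ℝ → EuclideanSpace ℝ (Fin d)} (hw : Continuous w) (hw' : Continuous w') {D : ℝ}
    (hD : 0 ≤ D) (hww : ∀ r, 0 ≤ r → ‖w r - w' r‖ ≤ D * Real.exp (2 * K * r)) {t : ℝ}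
    (ht : 0 ≤ t) :
    ‖(∫ r in 0..t, ∑ i, u i r • Ψ i (w r)) - ∫ r in 0..t, ∑ i, u i r • Ψ i (w' r)‖ ≤
      D / 2 * Real.exp (2 * K * t) := by
  rw [← intervalIntegral.integral_sub (hu.intervalIntegrable hΨ hΨ0 hw le_rfl ht)
    (hu.intervalIntegrable hΨ hΨ0 hw' le_rfl ht)]
  have h1 : ∫ r in 0..t, K * (D * Real.exp (2 * K * r)) =
      D / 2 * Real.exp (2 * K * t) - D / 2 * Real.exp (2 * K * 0) := by
    refine intervalIntegral.integral_eq_sub_of_hasDerivAt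
      (f := fun r => D / 2 * Real.exp (2 * K * r)) (fun r _ => ?_) (Continuous.intervalIntegrable (by fun_prop) _ _)
    have h := ((hasDerivAt_id r).const_mul (2 * (K : ℝ))).exp.const_mul (D / 2)
    exact h.congr_deriv (by simp only [id_eq]; ring)
  have h2 := intervalIntegral.norm_integral_le_of_norm_le (μ := volume) ht
    (f := fun r => ∑ i, u i r • Ψ i (w r) - ∑ i, u i r • Ψ i (w' r))
    (g := fun r => K * (D * Real.exp (2 * K * r))) (by
      have h := hu.2
      rw [ae_restrict_iff' measurableSet_Ici] at h
      filter_upwards [h] with r hr hr'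
      exact (norm_sum_smul_sub_le hΨ (hr hr'.1.le) _ _).trans
        (mul_le_mul_of_nonneg_left (hww r hr'.1.le) K.coe_nonneg))
    (Continuous.intervalIntegrable (by fun_prop) _ _)
  rw [h1] at h2
  have : 0 ≤ D / 2 * Real.exp (2 * K * 0) := by positivity
  linarith

lemma IsSwitchingLaw.norm_integral_le (hu : IsSwitchingLaw u)
    (hΨ : ∀ i, LipschitzWith K (Ψ i)) (hΨ0 : ∀ i, Ψ i 0 = 0)
    {w : ℝ → EuclideanSpace ℝ (Fin d)} (hw : Continuous w) {D : ℝ}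
    (hD : 0 ≤ D) (hwD : ∀ r, 0 ≤ r → ‖w r‖ ≤ D * Real.exp (2 * K * r)) {t : ℝ} (ht : 0 ≤ t) :
    ‖∫ r in 0..t, ∑ i, u i r • Ψ i (w r)‖ ≤ D / 2 * Real.exp (2 * K * t) := by
  simpa [hΨ0] using hu.norm_integral_sub_le hΨ hΨ0 hw (continuous_const (y := 0)) hD
    (by simpa using hwD) ht

/-- Trajectories generated by the same switching law depend continuously on the initial value. -/
theorem IsTrajectoryWith.exists_eq_start (hΨ : ∀ i, LipschitzWith K (Ψ i)) (hΨ0 : ∀ i, Ψ i 0 = 0)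
    {x : ℝ≥0 → EuclideanSpace ℝ (Fin d)} (hx : IsTrajectoryWith Ψ u x) {b : ℝ}
    (hb : ∀ t, ‖x t‖ ≤ b) (v : EuclideanSpace ℝ (Fin d)) :
    ∃ y, IsTrajectoryWith Ψ u y ∧ y 0 = v ∧
      ∀ t : ℝ≥0, ‖x t - y t‖ ≤ 2 * Real.exp (2 * K * t) * ‖x 0 - v‖ := by
  have hu := hx.2.1
  let W : BoundedContinuousFunction ℝ≥0 (EuclideanSpace ℝ (Fin d)) → ℝ →
      EuclideanSpace ℝ (Fin d) := fun z r => Real.exp (2 * K * r) • z r.toNNReal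
  have hW : ∀ z, Continuous (W z) := fun z =>
    (by fun_prop : Continuous fun r : ℝ => Real.exp (2 * K * r)).smul
      (z.continuous.comp continuous_real_toNNReal)
  have hexp : ∀ t : ℝ, Real.exp (-(2 * K * t)) * Real.exp (2 * K * t) = 1 := fun t => by
    rw [← Real.exp_add]
    simp
  let T : BoundedContinuousFunction ℝ≥0 (EuclideanSpace ℝ (Fin d)) →
      BoundedContinuousFunction ℝ≥0 (EuclideanSpace ℝ (Fin d)) := fun z =>
    BoundedContinuousFunction.ofNormedAddCommGroup
      (fun t : ℝ≥0 => Real.exp (-(2 * K * t)) •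
        (v + ∫ r in (0 : ℝ)..t, ∑ i, u i r • Ψ i (W z r)))
      ((by fun_prop : Continuous fun t : ℝ≥0 => Real.exp (-(2 * K * (t : ℝ)))).smul
        (continuous_const.add (hu.continuous_integral hΨ hΨ0 (hW z)))) (‖v‖ + ‖z‖ / 2) (by
        intro t
        rw [norm_smul, Real.norm_of_nonneg (Real.exp_pos _).le]
        have h1 := hu.norm_integral_le hΨ hΨ0 (hW z) (norm_nonneg z) (fun r _ => by
          rw [norm_smul, Real.norm_of_nonneg (Real.exp_pos _).le, mul_comm]
          exact mul_le_mul_of_nonneg_right (z.norm_coe_le_norm _) (Real.exp_pos _).le)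
          t.coe_nonneg
        have h2 : Real.exp (-(2 * K * (t : ℝ))) ≤ 1 :=
          Real.exp_le_one_iff.2 (neg_nonpos.2 (by positivity))
        calc _ ≤ Real.exp (-(2 * K * (t : ℝ))) * (‖v‖ + ‖z‖ / 2 * Real.exp (2 * K * t)) := by
              gcongr
              exact (norm_add_le _ _).trans (add_le_add_right h1 _)
          _ = Real.exp (-(2 * K * (t : ℝ))) * ‖v‖ + ‖z‖ / 2 *
              (Real.exp (-(2 * K * (t : ℝ))) * Real.exp (2 * K * t)) := by ring
          _ ≤ ‖v‖ + ‖z‖ / 2 := by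
              rw [hexp, mul_one]
              gcongr
              exact mul_le_of_le_one_left (norm_nonneg v) h2)
  have hTapp : ∀ z t, T z t = Real.exp (-(2 * K * t)) •
        (v + ∫ r in (0 : ℝ)..t, ∑ i, u i r • Ψ i (W z r)) := fun z t => rfl
  have hT : ContractingWith (1 / 2) T := by
    refine ⟨by norm_num, LipschitzWith.of_dist_le_mul fun z z' => ?_⟩
    rw [BoundedContinuousFunction.dist_le (by positivity)]
    intro t
    have h1 := hu.norm_integral_sub_le hΨ hΨ0 (hW z) (hW z') (dist_nonneg (x := z) (y := z'))
      (fun r _ => by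
        rw [← smul_sub, norm_smul, Real.norm_of_nonneg (Real.exp_pos _).le, mul_comm,
          ← dist_eq_norm]
        exact mul_le_mul_of_nonneg_right (BoundedContinuousFunction.dist_coe_le_dist _)
          (Real.exp_pos _).le) t.coe_nonneg
    rw [dist_eq_norm, hTapp, hTapp, ← smul_sub, add_sub_add_left_eq_sub, norm_smul,
      Real.norm_of_nonneg (Real.exp_pos _).le]
    calc _ ≤ Real.exp (-(2 * K * (t : ℝ))) * (dist z z' / 2 * Real.exp (2 * K * t)) := by gcongr
      _ = dist z z' / 2 * (Real.exp (-(2 * K * (t : ℝ))) * Real.exp (2 * K * t)) := by ring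
      _ = ((1 / 2 : ℝ≥0) : ℝ) * dist z z' := by
        rw [hexp]
        push_cast
        ring
  let z := hT.fixedPoint T
  have hz : T z = z := hT.fixedPoint_isFixedPt
  have hzt : ∀ t : ℝ≥0, W z t = v + ∫ r in (0 : ℝ)..t, ∑ i, u i r • Ψ i (W z r) := by
    intro t
    have h1 : W z t = Real.exp (2 * K * t) • T z t := by
      rw [hz]
      simp [W]
    rw [h1, hTapp, smul_smul, mul_comm, hexp, one_smul]
  have hz0 : W z (0 : ℝ≥0) = v := by
    rw [hzt]
    simp
  have hb0 : 0 ≤ b := (norm_nonneg _).trans (hb 0)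
  let x' : BoundedContinuousFunction ℝ≥0 (EuclideanSpace ℝ (Fin d)) :=
    BoundedContinuousFunction.ofNormedAddCommGroup
      (fun t : ℝ≥0 => Real.exp (-(2 * K * t)) • x t)
      ((by fun_prop : Continuous fun t : ℝ≥0 => Real.exp (-(2 * K * (t : ℝ)))).smul hx.1) b (by
        intro t
        rw [norm_smul, Real.norm_of_nonneg (Real.exp_pos _).le]
        have h2 : Real.exp (-(2 * K * (t : ℝ))) ≤ 1 :=
          Real.exp_le_one_iff.2 (neg_nonpos.2 (by positivity))
        exact (mul_le_of_le_one_left (norm_nonneg _) h2).trans (hb t))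
  have hxe_apply : ∀ t, x' t = Real.exp (-(2 * K * t)) • x t := fun t => rfl
  have hWx : ∀ r, 0 ≤ r → W x' r = x r.toNNReal := by
    intro r hr
    simp only [W, hxe_apply, smul_smul, Real.coe_toNNReal r hr]
    rw [mul_comm, hexp, one_smul]
  have hdist : dist x' (T x') ≤ ‖x 0 - v‖ := by
    rw [BoundedContinuousFunction.dist_le (norm_nonneg _)]
    intro t
    have h1 : ∫ r in (0 : ℝ)..t, ∑ i, u i r • Ψ i (W x' r) = x t - x 0 := by
      have h2 := hx.sub_eq hΨ hΨ0 le_rfl t.coe_nonneg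
      rw [Real.toNNReal_coe, Real.toNNReal_zero] at h2
      rw [h2]
      refine intervalIntegral.integral_congr fun r hr => ?_
      rw [Set.uIcc_of_le t.coe_nonneg] at hr
      simp only [hWx r hr.1]
    rw [dist_eq_norm, hTapp, hxe_apply, h1, ← smul_sub, norm_smul,
      Real.norm_of_nonneg (Real.exp_pos _).le]
    have h2 : Real.exp (-(2 * K * (t : ℝ))) ≤ 1 :=
      Real.exp_le_one_iff.2 (neg_nonpos.2 (by positivity))
    have h3 : x t - (v + (x t - x 0)) = x 0 - v := by abel
    rw [h3]
    exact mul_le_of_le_one_left (norm_nonneg _) h2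
  have hfix : dist x' z ≤ 2 * ‖x 0 - v‖ := by
    have h1 := hT.dist_fixedPoint_le x'
    have h2 : (1 - ((1 / 2 : ℝ≥0) : ℝ)) = 1 / 2 := by norm_num
    rw [h2] at h1
    linarith
  refine ⟨fun t => W z t, ⟨(hW z).comp NNReal.continuous_coe, hu, fun t => ?_⟩, hz0, fun t => ?_⟩
  · beta_reduce
    rw [hz0, hzt, intervalIntegral.integral_of_le t.coe_nonneg]
    congr 1
    refine setIntegral_congr_fun measurableSet_Ioc fun r hr => ?_
    simp only [Real.coe_toNNReal r hr.1.le]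
  · have h1 : x t = W x' t := by simp [hWx]
    have h2 := (BoundedContinuousFunction.dist_coe_le_dist (f := x') (g := z) t).trans hfix
    rw [dist_eq_norm] at h2
    rw [h1]
    simp only [W, Real.toNNReal_coe]
    rw [← smul_sub, norm_smul, Real.norm_of_nonneg (Real.exp_pos _).le]
    calc _ ≤ Real.exp (2 * K * t) * (2 * ‖x 0 - v‖) := by gcongr
      _ = _ := by ring

end Perturbation

section Periodic

variable {d N : ℕ} {Ψ : Fin N → EuclideanSpace ℝ (Fin d) → EuclideanSpace ℝ (Fin d)} {K : ℝ≥0}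

lemma IsSolution.exists_isTrajectoryWith_periodic (hΨ : ∀ i, LipschitzWith K (Ψ i)) {L : ℝ}
    {x : ℝ → EuclideanSpace ℝ (Fin d)} (hx : IsSolution Ψ K L x) {p : ℝ} (hp : 0 < p)
    (hxp : x p = x 0) :
    ∃ u y, IsTrajectoryWith Ψ u y ∧ IsPeriodicLaw u ∧ ∀ n : ℕ, y (n * p.toNNReal) = x 0 := by
  let y : ℝ → EuclideanSpace ℝ (Fin d) := fun t => x (t - ⌊t / p⌋ * p)
  have hfl : ∀ t, ⌊t / p⌋ * p ≤ t := fun t => (le_div_iff₀ hp).1 (Int.floor_le _)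
  have hlt : ∀ t, t < (⌊t / p⌋ + 1) * p := fun t => (div_lt_iff₀ hp).1 (Int.lt_floor_add_one _)
  have hy : ∀ t (n : ℤ), n * p ≤ t → t < (n + 1) * p → y t = x (t - n * p) := by
    intro t n h1 h2
    have : ⌊t / p⌋ = n := Int.floor_eq_iff.2 ⟨(le_div_iff₀ hp).2 h1, (div_lt_iff₀ hp).2 h2⟩
    simp only [y, this]
  have hyp : ∀ t, y (t + p) = y t := by
    intro t
    rw [hy (t + p) (⌊t / p⌋ + 1) (by push_cast; linarith [hfl t])
      (by push_cast; linarith [hlt t])]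
    simp only [y]
    congr 1
    push_cast
    ring
  have hlip : ∀ s t, s ≤ t → ‖y t - y s‖ ≤ L * (t - s) := by
    intro s t hst
    have hs := hfl s
    have ht := hfl t
    have hs' := hlt s
    have ht' := hlt t
    rcases (Int.floor_le_floor (div_le_div_of_nonneg_right hst hp.le)).eq_or_lt with h | h
    · have h1 := hx.lipschitz (s - ⌊s / p⌋ * p) (t - ⌊t / p⌋ * p) (by linarith)
        (by rw [h]; linarith)
      rw [h] at h1
      simp only [y, h]
      linarith
    · have h1 := hx.lipschitz (s - ⌊s / p⌋ * p) p (by linarith) (by linarith)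
      have h2 := hx.lipschitz 0 (t - ⌊t / p⌋ * p) le_rfl (by linarith)
      have h3 : ((⌊s / p⌋ : ℝ) + 1) * p ≤ ⌊t / p⌋ * p := by
        gcongr
        exact_mod_cast h
      rw [hxp] at h1
      have h4 := mul_le_mul_of_nonneg_left h3 hx.nonneg
      have h5 := norm_sub_le_norm_sub_add_norm_sub (y t) (x 0) (y s)
      simp only [y] at h5 ⊢
      linarith
  have hL : LipschitzWith L.toNNReal y := by
    refine LipschitzWith.of_dist_le_mul fun t s => ?_
    rw [Real.coe_toNNReal L hx.nonneg, dist_eq_norm, Real.dist_eq]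
    rcases le_total s t with h | h
    · rw [abs_of_nonneg (sub_nonneg.2 h)]
      exact hlip s t h
    · rw [abs_sub_comm, abs_of_nonneg (sub_nonneg.2 h), norm_sub_rev]
      exact hlip t s h
  obtain ⟨u, hu, hup⟩ := exists_isTrajectoryWith (fun i => (hΨ i).continuous) hL
    fun t ht q => ⟨K * L * ‖q‖, (⌊t / p⌋ + 1) * p - t, by linarith [hlt t], fun h hh hh' => by
      obtain ⟨i, hi⟩ := hx.increment (t - ⌊t / p⌋ * p) (t + h - ⌊t / p⌋ * p)
        (by linarith [hfl t]) (by linarith) q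
      refine ⟨i, ?_⟩
      rw [hy t _ (hfl t) (hlt t), hy (t + h) _ (by linarith [hfl t]) (by linarith)]
      convert hi using 2 <;> ring⟩
  refine ⟨u, _, hu, ⟨p, hp, fun i => ae_of_all _ fun t => hup p hyp i t⟩, fun n => ?_⟩
  have h1 := hy (n * p) n (by simp) (by push_cast; linarith)
  simpa [hp.le] using h1

lemma IsSolution.apply_ne (hΨ : ∀ i, LipschitzWith K (Ψ i))
    (hPAS : ∀ (u : Fin N → ℝ → ℝ) (x : ℝ≥0 → EuclideanSpace ℝ (Fin d)),
      IsTrajectoryWith Ψ u x → (IsConstantLaw u ∨ IsPeriodicLaw u) →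
      Tendsto x atTop (𝓝 0)) {L : ℝ}
    {x : ℝ → EuclideanSpace ℝ (Fin d)} (hx : IsSolution Ψ K L x) (hx0 : x 0 ≠ 0) {p : ℝ}
    (hp : 0 < p) : x p ≠ x 0 := by
  intro hxp
  obtain ⟨u, y, hy, hu, hyn⟩ := hx.exists_isTrajectoryWith_periodic hΨ hp hxp
  have h1 := hPAS u y hy (.inr hu)
  have h2 : Tendsto (fun n : ℕ => (n : ℝ≥0) * p.toNNReal) atTop atTop :=
    tendsto_natCast_atTop_atTop.atTop_mul_const (Real.toNNReal_pos.2 hp)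
  have h3 := h1.comp h2
  simp only [Function.comp_def, hyn] at h3
  exact hx0 (tendsto_nhds_unique tendsto_const_nhds h3)

lemma eq_zero_of_sum_smul_eq_smul
    (hhom : ∀ (i : Fin N) (c : ℝ), 0 ≤ c → ∀ v, Ψ i (c • v) = c • Ψ i v)
    (hPAS : ∀ (u : Fin N → ℝ → ℝ) (x : ℝ≥0 → EuclideanSpace ℝ (Fin d)),
      IsTrajectoryWith Ψ u x → (IsConstantLaw u ∨ IsPeriodicLaw u) →
      Tendsto x atTop (𝓝 0)) {c : Fin N → ℝ} (hc : c ∈ stdSimplex ℝ (Fin N)) {l : ℝ} (hl : 0 ≤ l)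
    {v : EuclideanSpace ℝ (Fin d)} (h : ∑ i, c i • Ψ i v = l • v) : v = 0 := by
  have htraj : IsTrajectoryWith Ψ (fun i _ => c i) fun t : ℝ≥0 => Real.exp (l * t) • v := by
    refine ⟨by fun_prop, ⟨fun i => measurable_const, ae_of_all _ fun _ => ⟨fun i => ⟨hc.1 i, ?_⟩,
      hc.2⟩⟩, fun t => ?_⟩
    · rw [← hc.2]
      exact Finset.single_le_sum (fun j _ => hc.1 j) (Finset.mem_univ i)
    · have h1 : ∫ s in Set.Ioc (0 : ℝ) t, ∑ i, c i • Ψ i (Real.exp (l * s.toNNReal) • v) =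
          ∫ s in (0 : ℝ)..t, (l * Real.exp (l * s)) • v := by
        rw [intervalIntegral.integral_of_le t.coe_nonneg]
        refine setIntegral_congr_fun measurableSet_Ioc fun s hs => ?_
        simp only [Real.coe_toNNReal s hs.1.le, hhom _ _ (Real.exp_pos _).le]
        simp only [smul_comm _ (Real.exp (l * s)), ← Finset.smul_sum, h]
        rw [smul_smul, mul_comm]
      have h2 : ∫ s in (0 : ℝ)..t, (l * Real.exp (l * s)) • v =
          Real.exp (l * t) • v - Real.exp (l * 0) • v := by
        refine intervalIntegral.integral_eq_sub_of_hasDerivAt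
          (f := fun s => Real.exp (l * s) • v) (fun s _ => ?_)
          (Continuous.intervalIntegrable (by fun_prop) _ _)
        have h3 := (((hasDerivAt_id s).const_mul l).exp).smul_const v
        exact h3.congr_deriv (by simp only [id_eq, mul_one, mul_comm])
      rw [h1, h2]
      simp
  have h1 := (hPAS _ _ htraj (.inl ⟨c, fun i => ae_of_all _ fun _ => rfl⟩)).norm
  rw [norm_zero] at h1
  have h2 := ge_of_tendsto' (b := ‖v‖) h1 fun t => by
    rw [norm_smul, Real.norm_of_nonneg (Real.exp_pos _).le]
    exact le_mul_of_one_le_left (norm_nonneg v) (Real.one_le_exp (by positivity))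
  exact norm_le_zero_iff.1 h2

lemma exists_covector_of_forall_sum_smul_ne {E : Type*} [NormedAddCommGroup E]
    [InnerProductSpace ℝ E] [CompleteSpace E] {a : Fin N → E} {v : E} (hv : v ≠ 0)
    (h : ∀ c ∈ stdSimplex ℝ (Fin N), ∀ l : ℝ, 0 ≤ l → ∑ i, c i • a i ≠ l • v) :
    ∃ p, 0 < inner ℝ p v ∧ ∀ i, inner ℝ p (a i) < 0 := by
  have hS : IsCompact ((fun c : Fin N → ℝ => ∑ i, c i • a i) '' stdSimplex ℝ (Fin N)) :=
    (isCompact_stdSimplex ℝ (Fin N)).image (by fun_prop)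
  have hconv : Convex ℝ ((fun c : Fin N → ℝ => ∑ i, c i • a i) '' stdSimplex ℝ (Fin N)) := by
    refine (convex_stdSimplex ℝ (Fin N)).is_linear_image ?_
    exact ⟨fun c d => by simp [add_smul, Finset.sum_add_distrib],
      fun r c => by simp [Finset.smul_sum, smul_smul]⟩
  have hR : IsClosed ((fun l : ℝ => l • v) '' Set.Ici 0) :=
    (isClosedEmbedding_smul_left hv).isClosedMap _ isClosed_Ici
  have hRc : Convex ℝ ((fun l : ℝ => l • v) '' Set.Ici 0) :=
    (convex_Ici (0 : ℝ)).is_linear_image ⟨fun c d => add_smul c d v, fun r c => by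
      simp [smul_smul]⟩
  obtain ⟨f, r, r', h1, h2, h3⟩ := geometric_hahn_banach_compact_closed hconv hS hRc hR (by
    rw [Set.disjoint_left]
    rintro _ ⟨c, hc, rfl⟩ ⟨l, hl, hl'⟩
    exact h c hc l hl hl'.symm)
  have hr' : r' < 0 := by simpa using h3 0 ⟨0, by simp, by simp⟩
  have hfv : 0 ≤ f v := by
    by_contra! hneg
    have h4 := h3 ((r' / f v) • v) ⟨_, Set.mem_Ici.2 (div_nonneg_of_nonpos hr'.le hneg.le), rfl⟩
    rw [map_smul, smul_eq_mul, div_mul_cancel₀ _ hneg.ne] at h4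
    exact lt_irrefl _ h4
  have hfa : ∀ i, f (a i) < r := fun i => h1 _ ⟨Pi.single i 1, single_mem_stdSimplex ℝ i, by
    simp [Pi.single_apply, ite_smul]⟩
  obtain ⟨M, hM⟩ := (Set.finite_range fun i => |inner ℝ v (a i)|).bddAbove
  have hM0 : 0 < max M 0 + 1 := by positivity
  refine ⟨(InnerProductSpace.toDual ℝ E).symm f + (-r / (max M 0 + 1)) • v, ?_, fun i => ?_⟩
  · rw [inner_add_left, InnerProductSpace.toDual_symm_apply, inner_smul_left]
    have h4 : 0 < -r / (max M 0 + 1) := div_pos (by linarith) hM0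
    have h5 : 0 < inner ℝ v v := real_inner_self_pos.2 hv
    simpa using add_pos_of_nonneg_of_pos hfv (mul_pos h4 h5)
  · rw [inner_add_left, InnerProductSpace.toDual_symm_apply, inner_smul_left]
    have h4 : inner ℝ v (a i) ≤ max M 0 + 1 := by
      have := hM ⟨i, rfl⟩
      have := le_abs_self (inner ℝ v (a i))
      have := le_max_left M 0
      linarith
    have h5 : -r / (max M 0 + 1) * inner ℝ v (a i) ≤ -r := by
      calc _ ≤ -r / (max M 0 + 1) * (max M 0 + 1) :=
            mul_le_mul_of_nonneg_left h4 (div_nonneg (by linarith) hM0.le)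
        _ = -r := div_mul_cancel₀ _ hM0.ne'
    have := hfa i
    simp only [conj_trivial]
    linarith

end Periodic

section OrbitBound

variable {d N : ℕ} {Ψ : Fin N → EuclideanSpace ℝ (Fin d) → EuclideanSpace ℝ (Fin d)} {K : ℝ≥0}

/-- `c` bounds the norm of all solutions which start at `v`. -/
def IsOrbitBound (Ψ : Fin N → EuclideanSpace ℝ (Fin d) → EuclideanSpace ℝ (Fin d)) (K : ℝ≥0)
    (v : EuclideanSpace ℝ (Fin d)) (c : ℝ) : Prop :=
  ∀ L x, IsSolution Ψ K L x → x 0 = v → ∀ t, 0 ≤ t → ‖x t‖ ≤ c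

lemma IsOrbitBound.apply (hΨ : ∀ i, LipschitzWith K (Ψ i)) {L c : ℝ}
    {x : ℝ → EuclideanSpace ℝ (Fin d)} (hx : IsSolution Ψ K L x) (h : IsOrbitBound Ψ K (x 0) c)
    {t : ℝ} (ht : 0 ≤ t) : IsOrbitBound Ψ K (x t) c := by
  intro L' y hy hyx s hs
  have h1 := h _ _ ((hx.mono (le_max_left L L')).concat hΨ (hy.mono (le_max_right L L')) hyx)
    (by simp [ht]) (t + s) (by positivity)
  rcases hs.eq_or_lt with rfl | hs
  · simpa [hyx] using h1
  · simpa [hs.not_ge] using h1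

lemma IsOrbitBound.smul (hhom : ∀ i (c : ℝ), 0 ≤ c → ∀ v, Ψ i (c • v) = c • Ψ i v) {c : ℝ}
    {v : EuclideanSpace ℝ (Fin d)} (h : IsOrbitBound Ψ K v c) {l : ℝ} (hl : 0 < l) :
    IsOrbitBound Ψ K (l • v) (l * c) := by
  intro L x hx hxv t ht
  have h1 := h _ _ (hx.smul hhom (inv_nonneg.2 hl.le)) (by
    simp [hxv, smul_smul, hl.ne']) t ht
  rwa [norm_smul, Real.norm_of_nonneg (inv_nonneg.2 hl.le), inv_mul_le_iff₀ hl] at h1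

variable {C₀ : ℝ}

lemma IsSolution.norm_le (hΨ : ∀ i, LipschitzWith K (Ψ i))
    (hLyap : ∀ x : ℝ≥0 → EuclideanSpace ℝ (Fin d), IsTrajectory Ψ x →
      ∀ t : ℝ≥0, ‖x t‖ ≤ C₀ * ‖x 0‖) {L : ℝ} {x : ℝ → EuclideanSpace ℝ (Fin d)}
    (hx : IsSolution Ψ K L x) {s t : ℝ} (hs : 0 ≤ s) (hst : s ≤ t) : ‖x t‖ ≤ C₀ * ‖x s‖ := by
  have h := hLyap _ ((hx.shift hs).isTrajectory hΨ) (t - s).toNNReal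
  simpa [Real.coe_toNNReal _ (sub_nonneg.2 hst)] using h

lemma isOrbitBound_iff (hΨ : ∀ i, LipschitzWith K (Ψ i)) (hΨ0 : ∀ i, Ψ i 0 = 0)
    (hLyap : ∀ x : ℝ≥0 → EuclideanSpace ℝ (Fin d), IsTrajectory Ψ x →
      ∀ t : ℝ≥0, ‖x t‖ ≤ C₀ * ‖x 0‖) {v : EuclideanSpace ℝ (Fin d)} {c : ℝ} :
    IsOrbitBound Ψ K v c ↔ ∀ L x, IsSolution Ψ K L x → ∀ t, 0 ≤ t →
      ‖x t‖ ≤ c + 2 * Real.exp (2 * K * t) * ‖x 0 - v‖ := by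
  constructor
  · intro h L x hx t ht
    obtain ⟨u, hu⟩ := hx.isTrajectory hΨ
    obtain ⟨y, hy, hyv, hxy⟩ := hu.exists_eq_start hΨ hΨ0 (hLyap _ ⟨u, hu⟩) v
    have h1 := h _ _ (IsTrajectory.isSolution hΨ hΨ0 ⟨u, hy⟩ (hLyap y ⟨u, hy⟩)) (by simpa) t ht
    have h2 := hxy t.toNNReal
    rw [Real.coe_toNNReal t ht, NNReal.coe_zero] at h2
    linarith [norm_le_norm_add_norm_sub' (x t) (y t.toNNReal)]
  · intro h L x hx hxv t ht
    simpa [hxv] using h L x hx t ht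

lemma isClosed_setOf_isOrbitBound (hΨ : ∀ i, LipschitzWith K (Ψ i)) (hΨ0 : ∀ i, Ψ i 0 = 0)
    (hLyap : ∀ x : ℝ≥0 → EuclideanSpace ℝ (Fin d), IsTrajectory Ψ x →
      ∀ t : ℝ≥0, ‖x t‖ ≤ C₀ * ‖x 0‖) :
    IsClosed {q : EuclideanSpace ℝ (Fin d) × ℝ | IsOrbitBound Ψ K q.1 q.2} := by
  simp only [isOrbitBound_iff hΨ hΨ0 hLyap, Set.ofPred_forall]
  refine isClosed_iInter fun L => isClosed_iInter fun x => isClosed_iInter fun hx =>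
    isClosed_iInter fun t => isClosed_iInter fun ht => isClosed_le (by fun_prop) (by fun_prop)

end OrbitBound

section SolutionSet

variable {d N : ℕ} {Ψ : Fin N → EuclideanSpace ℝ (Fin d) → EuclideanSpace ℝ (Fin d)} {K : ℝ≥0}

/-- The solutions of norm at most `b` whose norm is at least `a` during the time set `S`. -/
def solutionSet (Ψ : Fin N → EuclideanSpace ℝ (Fin d) → EuclideanSpace ℝ (Fin d)) (K : ℝ≥0)
    (L a b : ℝ) (S : Set ℝ) : Set (ℝ → EuclideanSpace ℝ (Fin d)) :=
  {x | IsSolution Ψ K L x ∧ (∀ t ∈ S, a ≤ ‖x t‖) ∧ ∀ t, ‖x t‖ ≤ b}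

lemma isCompact_solutionSet (hΨ : ∀ i, LipschitzWith K (Ψ i)) (L a b : ℝ) (S : Set ℝ) :
    IsCompact (solutionSet Ψ K L a b S) := by
  have hc : ∀ i, Continuous (Ψ i) := fun i => (hΨ i).continuous
  refine (isCompact_univ_pi fun _ : ℝ => isCompact_closedBall
    (0 : EuclideanSpace ℝ (Fin d)) b).of_isClosed_subset ?_ fun x hx t _ => by
      simpa using hx.2.2 t
  have h1 : IsClosed {x : ℝ → EuclideanSpace ℝ (Fin d) | ∀ s t, 0 ≤ s → s ≤ t →
      ‖x t - x s‖ ≤ L * (t - s)} := by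
    simp only [Set.ofPred_forall]
    exact isClosed_iInter fun s => isClosed_iInter fun t => isClosed_iInter fun _ =>
      isClosed_iInter fun _ => isClosed_le (by fun_prop) (by fun_prop)
  have h2 : IsClosed {x : ℝ → EuclideanSpace ℝ (Fin d) | ∀ s t, 0 ≤ s → s ≤ t → ∀ p, ∃ i,
      inner ℝ p (x t - x s) ≤ (t - s) * inner ℝ p (Ψ i (x s)) + K * L * ‖p‖ * (t - s) ^ 2} := by
    simp only [Set.ofPred_forall, Set.ofPred_exists]
    refine isClosed_iInter fun s => isClosed_iInter fun t => isClosed_iInter fun _ =>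
      isClosed_iInter fun _ => isClosed_iInter fun p => isClosed_iUnion_of_finite fun i =>
      isClosed_le (by fun_prop) ?_
    have := (hc i).comp (continuous_apply (A := fun _ : ℝ => EuclideanSpace ℝ (Fin d)) s)
    exact ((continuous_const.inner this).const_mul _).add_const _
  have h3 : IsClosed {x : ℝ → EuclideanSpace ℝ (Fin d) | ∀ t ∈ S, a ≤ ‖x t‖} := by
    simp only [Set.ofPred_forall]
    exact isClosed_iInter fun t => isClosed_iInter fun _ => isClosed_le (by fun_prop) (by fun_prop)
  have h4 : IsClosed {x : ℝ → EuclideanSpace ℝ (Fin d) | ∀ t, ‖x t‖ ≤ b} := by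
    simp only [Set.ofPred_forall]
    exact isClosed_iInter fun t => isClosed_le (by fun_prop) (by fun_prop)
  convert (h1.inter h2).inter (h3.inter h4) using 1
  ext x
  exact ⟨fun h => ⟨⟨h.1.1, h.1.2⟩, h.2⟩, fun h => ⟨⟨h.1.1, h.1.2⟩, h.2⟩⟩

lemma shift_mem_solutionSet {L a b : ℝ} {x : ℝ → EuclideanSpace ℝ (Fin d)}
    (hx : x ∈ solutionSet Ψ K L a b (Set.Ici 0)) {r : ℝ} (hr : 0 ≤ r) :
    (fun t => x (r + t)) ∈ solutionSet Ψ K L a b (Set.Ici 0) :=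
  ⟨hx.1.shift hr, fun t ht => hx.2.1 (r + t) (Set.mem_Ici.2 (add_nonneg hr ht)),
    fun t => hx.2.2 (r + t)⟩

/-- A compact family of solutions which is invariant under time shifts contains, for a stable
system, either no solution or one which never comes close to the ray through a past position. -/
theorem exists_no_return (hΨ : ∀ i, LipschitzWith K (Ψ i))
    (hhom : ∀ (i : Fin N) (c : ℝ), 0 ≤ c → ∀ v, Ψ i (c • v) = c • Ψ i v) {C₀ : ℝ}
    (hLyap : ∀ x : ℝ≥0 → EuclideanSpace ℝ (Fin d), IsTrajectory Ψ x →
      ∀ t : ℝ≥0, ‖x t‖ ≤ C₀ * ‖x 0‖)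
    (hloop : ∀ L x, IsSolution Ψ K L x → x 0 ≠ 0 → ∀ p, 0 < p → x p ≠ x 0)
    {L a b : ℝ} (ha : 0 < a) (hne : (solutionSet Ψ K L a b (Set.Ici 0)).Nonempty) :
    ∃ x ∈ solutionSet Ψ K L a b (Set.Ici 0), ∀ α β, 0 < α → α ≤ β → ∃ m > 0, ∀ s h, 0 ≤ s →
      α ≤ h → h ≤ β → ∀ l : ℝ, 0 ≤ l → m ≤ ‖x (s + h) - l • x s‖ := by
  have hΨ0 : ∀ i, Ψ i 0 = 0 := fun i => by simpa using hhom i 0 le_rfl 0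
  set X := solutionSet Ψ K L a b (Set.Ici 0) with hX
  have hXc : IsCompact X := isCompact_solutionSet hΨ _ _ _ _
  have hLx : ∀ x ∈ X, ∀ t, 0 ≤ t → ‖x t‖ ≤ |C₀| * b := fun x hx t ht => by
    refine (hx.1.norm_le hΨ hLyap le_rfl ht).trans ?_
    exact mul_le_mul (le_abs_self _) (hx.2.2 0) (norm_nonneg _) (abs_nonneg _)
  have hcl := isClosed_setOf_isOrbitBound hΨ hΨ0 hLyap
  -- minimise the orbit bound
  obtain ⟨⟨x, c⟩, ⟨⟨hx, hc0⟩, hxc⟩, hmin⟩ : ∃ q ∈ (X ×ˢ Set.Icc 0 (|C₀| * b)) ∩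
      {q | IsOrbitBound Ψ K (q.1 0) q.2}, IsMinOn Prod.snd ((X ×ˢ Set.Icc 0 (|C₀| * b)) ∩
      {q | IsOrbitBound Ψ K (q.1 0) q.2}) q := by
    refine IsCompact.exists_isMinOn ((hXc.prod isCompact_Icc).inter_right
      (hcl.preimage (f := fun q : (ℝ → EuclideanSpace ℝ (Fin d)) × ℝ => (q.1 0, q.2))
        (by fun_prop))) ?_ continuous_snd.continuousOn
    obtain ⟨x, hx⟩ := hne
    refine ⟨(x, |C₀| * b), ⟨hx, ?_, le_rfl⟩, fun L y hy hyx t ht => ?_⟩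
    · exact (norm_nonneg _).trans (hLx x hx 0 le_rfl)
    · refine (hy.norm_le hΨ hLyap le_rfl ht).trans ?_
      rw [hyx]
      exact mul_le_mul (le_abs_self _) (hx.2.2 0) (norm_nonneg _) (abs_nonneg _)
  have hxbound : ∀ y ∈ X, ∀ c', IsOrbitBound Ψ K (y 0) c' → c ≤ c' := by
    intro y hy c' hc'
    rcases le_or_gt c' (|C₀| * b) with h | h
    · have h0 : 0 ≤ c' := (norm_nonneg _).trans (hc' _ y hy.1 rfl 0 le_rfl)
      exact hmin (a := (y, c')) ⟨⟨hy, h0, h⟩, hc'⟩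
    · exact hc0.2.trans h.le
  have hcpos : 0 < c := ha.trans_le ((hx.2.1 0 (by simp)).trans (hxc _ x hx.1 rfl 0 le_rfl))
  have hXcc : IsCompact (X ∩ {y | IsOrbitBound Ψ K (y 0) c}) :=
    hXc.inter_right (hcl.preimage (f := fun y : ℝ → EuclideanSpace ℝ (Fin d) => (y 0, c))
      (by fun_prop))
  have hray : ∀ y ∈ X, IsOrbitBound Ψ K (y 0) c → ∀ h, 0 < h → ∀ l : ℝ, 0 ≤ l →
      y h ≠ l • y 0 := by
    intro y hy hyc h hh l hl hyl
    have hl0 : 0 < l := by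
      refine hl.lt_of_ne' fun h0 => ?_
      have := hy.2.1 h (Set.mem_Ici.2 hh.le)
      rw [hyl, h0, zero_smul, norm_zero] at this
      linarith
    have h1 := hxbound _ (shift_mem_solutionSet hy hh.le) (l * c) (by
      simpa [hyl] using hyc.smul hhom hl0)
    have h2 := hxbound y hy (l⁻¹ * c) (by
      have := (IsOrbitBound.apply hΨ hy.1 hyc hh.le).smul hhom (inv_pos.2 hl0)
      rwa [hyl, smul_smul, inv_mul_cancel₀ hl0.ne', one_smul] at this)
    have h3 : 1 ≤ l := by
      by_contra! h4
      nlinarith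
    have h4 : 1 ≤ l⁻¹ := by
      by_contra! h4
      nlinarith
    have h5 : l = 1 := le_antisymm ((one_le_inv₀ hl0).1 h4) h3
    rw [h5, one_smul] at hyl
    refine hloop _ y hy.1 (fun h0 => ?_) h hh hyl
    have := hy.2.1 0 (by simp)
    rw [h0, norm_zero] at this
    linarith
  refine ⟨x, hx, fun α β hα hαβ => ?_⟩
  obtain ⟨⟨h₀, y₀, l₀⟩, ⟨hh₀, hy₀, hl₀⟩, hmin'⟩ : ∃ q ∈ (Set.Icc α β ×ˢ
      ((X ∩ {y | IsOrbitBound Ψ K (y 0) c}) ×ˢ Set.Icc 0 ((a + b) / a))),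
      IsMinOn (fun q : ℝ × (ℝ → EuclideanSpace ℝ (Fin d)) × ℝ => ‖q.2.1 q.1 - q.2.2 • q.2.1 0‖)
      (Set.Icc α β ×ˢ ((X ∩ {y | IsOrbitBound Ψ K (y 0) c}) ×ˢ Set.Icc 0 ((a + b) / a))) q := by
    refine IsCompact.exists_isMinOn (isCompact_Icc.prod (hXcc.prod isCompact_Icc))
      ⟨(α, x, 0), ⟨le_rfl, hαβ⟩, ⟨hx, hxc⟩, le_rfl, ?_⟩ ?_
    · have : 0 ≤ b := (norm_nonneg _).trans (hx.2.2 0)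
      positivity
    · refine continuousOn_prod_of_continuousOn_lipschitzOnWith _ L.toNNReal (fun h hh => ?_)
        fun q hq => ?_
      · have happ : ∀ r, Continuous fun q : (ℝ → EuclideanSpace ℝ (Fin d)) × ℝ => q.1 r :=
          fun r => (continuous_apply r).comp continuous_fst
        exact ((happ h).sub (continuous_snd.smul (happ 0))).norm.continuousOn
      · refine LipschitzOnWith.of_dist_le_mul fun s hs t ht => ?_
        have hlip : ∀ s t : ℝ, 0 ≤ s → 0 ≤ t → ‖q.1 s - q.1 t‖ ≤ L * |s - t| := by
          intro s t hs ht
          rcases le_total s t with h | h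
          · rw [norm_sub_rev, abs_sub_comm, abs_of_nonneg (sub_nonneg.2 h)]
            exact hq.1.1.1.lipschitz s t hs h
          · rw [abs_of_nonneg (sub_nonneg.2 h)]
            exact hq.1.1.1.lipschitz t s ht h
        rw [Real.dist_eq, Real.dist_eq, Real.coe_toNNReal _ hx.1.nonneg]
        refine (abs_norm_sub_norm_le _ _).trans ?_
        rw [sub_sub_sub_cancel_right]
        exact hlip s t (hα.le.trans hs.1) (hα.le.trans ht.1)
  have hm : 0 < ‖y₀ h₀ - l₀ • y₀ 0‖ :=
    norm_pos_iff.2 (sub_ne_zero.2 (hray y₀ hy₀.1 hy₀.2 h₀ (hα.trans_le hh₀.1) l₀ hl₀.1))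
  refine ⟨min ‖y₀ h₀ - l₀ • y₀ 0‖ a, lt_min hm ha, fun s h hs hh hh' l hl => ?_⟩
  rcases le_or_gt l ((a + b) / a) with hla | hla
  · refine (min_le_left _ _).trans ?_
    have h1 := hmin' (a := (h, fun t => x (s + t), l)) ⟨⟨hh, hh'⟩,
      ⟨shift_mem_solutionSet hx hs, by simpa using IsOrbitBound.apply hΨ hx.1 hxc hs⟩, hl, hla⟩
    simpa using h1
  · refine (min_le_right _ _).trans ?_
    have h1 := norm_sub_norm_le (l • x s) (x (s + h))
    rw [norm_sub_rev, norm_smul, Real.norm_of_nonneg hl] at h1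
    have h2 := mul_le_mul hla.le (hx.2.1 s (Set.mem_Ici.2 hs)) ha.le hl
    rw [div_mul_cancel₀ _ ha.ne'] at h2
    linarith [hx.2.2 (s + h)]

end SolutionSet

section Decay

variable {d N : ℕ} {Ψ : Fin N → EuclideanSpace ℝ (Fin d) → EuclideanSpace ℝ (Fin d)} {K : ℝ≥0}
  {C₀ : ℝ}

/-- Halving the norm in a uniform time implies uniform exponential decay. -/
lemma IsSolution.norm_le_exp (hΨ : ∀ i, LipschitzWith K (Ψ i)) (hC₀ : 0 < C₀)
    (hLyap : ∀ x : ℝ≥0 → EuclideanSpace ℝ (Fin d), IsTrajectory Ψ x →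
      ∀ t : ℝ≥0, ‖x t‖ ≤ C₀ * ‖x 0‖) {T : ℝ} (hT : 0 < T)
    (hhalf : ∀ L x, IsSolution Ψ K L x → ‖x T‖ ≤ 1 / 2 * ‖x 0‖) {L : ℝ}
    {x : ℝ → EuclideanSpace ℝ (Fin d)} (hx : IsSolution Ψ K L x) {t : ℝ} (ht : 0 ≤ t) :
    ‖x t‖ ≤ 2 * C₀ * Real.exp (-(Real.log 2 / T) * t) * ‖x 0‖ := by
  have h1 : ∀ n : ℕ, ‖x (n * T)‖ ≤ (1 / 2) ^ n * ‖x 0‖ := by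
    intro n
    induction n with
    | zero => simp
    | succ n ih =>
      have h2 := hhalf _ _ (hx.shift (r := n * T) (by positivity))
      rw [add_zero] at h2
      calc ‖x ((n + 1 : ℕ) * T)‖ = ‖x (n * T + T)‖ := by
            congr 2
            push_cast
            ring
        _ ≤ 1 / 2 * ((1 / 2) ^ n * ‖x 0‖) := h2.trans (by gcongr)
        _ = _ := by ring
  have h2 : (⌊t / T⌋₊ : ℝ) * T ≤ t := (le_div_iff₀ hT).1 (Nat.floor_le (by positivity))
  have h3 := hx.norm_le hΨ hLyap (by positivity) h2
  have h4 : ((1 : ℝ) / 2) ^ ⌊t / T⌋₊ ≤ 2 * Real.exp (-(Real.log 2 / T) * t) := by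
    have h5 : ((1 : ℝ) / 2) ^ ⌊t / T⌋₊ = Real.exp (-(⌊t / T⌋₊ * Real.log 2)) := by
      rw [Real.exp_neg, Real.exp_nat_mul, Real.exp_log two_pos, one_div, inv_pow]
    have h6 : (2 : ℝ) * Real.exp (-(Real.log 2 / T) * t) =
        Real.exp (Real.log 2 + -(Real.log 2 / T) * t) := by
      rw [Real.exp_add, Real.exp_log two_pos]
    rw [h5, h6, Real.exp_le_exp]
    have h7 := mul_le_mul_of_nonneg_right (Nat.lt_floor_add_one (t / T)).le
      (Real.log_pos one_lt_two).le
    have h8 : Real.log 2 / T * t = t / T * Real.log 2 := by ring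
    linarith
  calc ‖x t‖ ≤ C₀ * ((1 / 2) ^ ⌊t / T⌋₊ * ‖x 0‖) := h3.trans (by gcongr; exact h1 _)
    _ ≤ C₀ * (2 * Real.exp (-(Real.log 2 / T) * t) * ‖x 0‖) := by gcongr
    _ = _ := by ring

/-- If the norm is not halved in uniform time, some bounded solution stays away from zero. -/
lemma exists_solutionSet_nonempty (hΨ : ∀ i, LipschitzWith K (Ψ i))
    (hhom : ∀ (i : Fin N) (c : ℝ), 0 ≤ c → ∀ v, Ψ i (c • v) = c • Ψ i v) (hC₀ : 0 < C₀)
    (hLyap : ∀ x : ℝ≥0 → EuclideanSpace ℝ (Fin d), IsTrajectory Ψ x →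
      ∀ t : ℝ≥0, ‖x t‖ ≤ C₀ * ‖x 0‖)
    (hhalf : ∀ T : ℝ, 0 < T → ∃ L x, IsSolution Ψ K L x ∧ 1 / 2 * ‖x 0‖ < ‖x T‖) :
    (solutionSet Ψ K (K * C₀) (1 / (2 * C₀)) C₀ (Set.Ici 0)).Nonempty := by
  have hΨ0 : ∀ i, Ψ i 0 = 0 := fun i => by simpa using hhom i 0 le_rfl 0
  have hcpt := isCompact_solutionSet hΨ (K * C₀) (1 / (2 * C₀)) C₀
  have hne : ∀ n : ℕ,
      (solutionSet Ψ K (K * C₀) (1 / (2 * C₀)) C₀ (Set.Icc 0 n)).Nonempty := by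
    intro n
    obtain ⟨L, x, hx, hxT⟩ := hhalf (n + 1) (by positivity)
    have hx0 : 0 < ‖x 0‖ := by
      refine (norm_nonneg _).lt_of_ne' fun h0 => ?_
      have := hx.norm_le hΨ hLyap le_rfl (by positivity : (0 : ℝ) ≤ n + 1)
      rw [h0] at this hxT
      linarith
    have hy := hx.smul hhom (inv_nonneg.2 hx0.le)
    set y : ℝ → EuclideanSpace ℝ (Fin d) := fun t => ‖x 0‖⁻¹ • x t with hydef
    have hy0 : ‖y 0‖ = 1 := by
      simp [hydef, norm_smul, hx0.ne']
    have hyT : 1 / 2 < ‖y (n + 1)‖ := by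
      rw [hydef]
      simp only [norm_smul, norm_inv, norm_norm]
      rw [lt_inv_mul_iff₀ hx0]
      linarith
    have htraj := hy.isTrajectory hΨ
    have hb : ∀ t : ℝ≥0, ‖y t‖ ≤ C₀ := fun t => by
      simpa [hy0] using hLyap _ htraj t
    refine ⟨_, htraj.isSolution hΨ hΨ0 hb, fun t ht => ?_, fun t => hb _⟩
    have h1 := hy.norm_le hΨ hLyap ht.1 (ht.2.trans (by simp : (n : ℝ) ≤ n + 1))
    rw [Real.coe_toNNReal t ht.1, div_le_iff₀ (by positivity)]
    linarith
  obtain ⟨x, hx⟩ := IsCompact.nonempty_iInter_of_sequence_nonempty_isCompact_isClosed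
    (fun n : ℕ => solutionSet Ψ K (K * C₀) (1 / (2 * C₀)) C₀ (Set.Icc 0 n))
    (fun n x hx => ⟨hx.1, fun t ht => hx.2.1 t ⟨ht.1, ht.2.trans (by simp)⟩, hx.2.2⟩)
    hne (hcpt _) fun n => (hcpt _).isClosed
  rw [Set.mem_iInter] at hx
  exact ⟨x, (hx 0).1, fun t ht => (hx ⌈t⌉₊).2.1 t ⟨ht, Nat.le_ceil t⟩, (hx 0).2.2⟩

end Decay

/-- In dimension `d ≤ 3`, a Lyapunov stable and periodically asymptotically stable switched
system of homogeneous uniformly Lipschitz vector fields is globally uniformly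
exponentially stable. -/
theorem homogeneous_periodic_stability_implies_GUES
    (d N : ℕ) (hd1 : 1 ≤ d) (hd3 : d ≤ 3)
    (Ψ : Fin N → EuclideanSpace ℝ (Fin d) → EuclideanSpace ℝ (Fin d))
    (hhom : ∀ (i : Fin N) (c : ℝ), 0 ≤ c → ∀ v, Ψ i (c • v) = c • Ψ i v)
    (hlip : ∀ i, ∃ K : ℝ≥0, LipschitzWith K (Ψ i))
    (hLyap : ∃ C : ℝ, 0 < C ∧ ∀ x : ℝ≥0 → EuclideanSpace ℝ (Fin d), IsTrajectory Ψ x →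
      ∀ t : ℝ≥0, ‖x t‖ ≤ C * ‖x 0‖)
    (hPAS : ∀ (u : Fin N → ℝ → ℝ) (x : ℝ≥0 → EuclideanSpace ℝ (Fin d)),
      IsTrajectoryWith Ψ u x → (IsConstantLaw u ∨ IsPeriodicLaw u) →
      Tendsto x atTop (𝓝 0)) :
    ∃ C κ : ℝ, 0 < C ∧ 0 < κ ∧
      ∀ x : ℝ≥0 → EuclideanSpace ℝ (Fin d), IsTrajectory Ψ x →
        ∀ t : ℝ≥0, ‖x t‖ ≤ C * Real.exp (-κ * (t : ℝ)) * ‖x 0‖ := by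
  choose k hk using hlip
  obtain ⟨C₀, hC₀, hLyap⟩ := hLyap
  set K : ℝ≥0 := ∑ i, k i
  have hΨ : ∀ i, LipschitzWith K (Ψ i) := fun i =>
    (hk i).weaken (Finset.single_le_sum (fun _ _ => zero_le) (Finset.mem_univ i))
  have hΨ0 : ∀ i, Ψ i 0 = 0 := fun i => by simpa using hhom i 0 le_rfl 0
  by_cases hhalf : ∃ T : ℝ, 0 < T ∧ ∀ L x, IsSolution Ψ K L x → ‖x T‖ ≤ 1 / 2 * ‖x 0‖
  · obtain ⟨T, hT, hhalf⟩ := hhalf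
    refine ⟨2 * C₀, Real.log 2 / T, by positivity, div_pos (Real.log_pos one_lt_two) hT,
      fun x hx t => ?_⟩
    simpa using (hx.isSolution hΨ hΨ0 (hLyap x hx)).norm_le_exp hΨ hC₀ hLyap hT hhalf t.coe_nonneg
  · push Not at hhalf
    have hne := exists_solutionSet_nonempty hΨ hhom hC₀ hLyap hhalf
    obtain ⟨x, hx, hno⟩ := exists_no_return hΨ hhom hLyap
      (fun L x hx hx0 p hp => hx.apply_ne hΨ hPAS hx0 hp) (by positivity) hne
    refine absurd (⟨fun i => (hΨ i).continuous, hhom, fun v hv => ?_, ⟨_, by positivity, hx.2.1⟩,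
      ⟨_, fun t _ => hx.2.2 t⟩, ⟨_, hx.1.nonneg, hx.1.lipschitz⟩,
      ⟨_, mul_nonneg K.coe_nonneg hx.1.nonneg, fun s t hs hst p => ?_⟩, hno⟩ : IsEscaping Ψ x)
      (not_isEscaping hd3)
    · exact exists_covector_of_forall_sum_smul_ne hv fun c hc l hl h =>
        hv (eq_zero_of_sum_smul_eq_smul hhom hPAS hc hl h)
    · exact hx.1.increment s t hs hst p
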